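/- Let Γ ≤ E(3,1) = ℝ^4 ⋊ O(3,1) act freely, properly discontinuously and cocompactly on ℝ^4 (so that ℝ^4/Γ is a compact complete Lorentzian flat 4-manifold). Then Γ has a subgroup Γ' of finite index which contains a nontrivial pure translation lying in the center of Γ'. -/

import Mathlib

noncomputable section

/-- `Vec n` is the euclidean space `ℝ^n`. -/
abbrev Vec (n : ℕ) : Type := Fin n → ℝ

/-- The group of invertible affine transformations of `ℝ^n`. -/
abbrev AffGroup (n : ℕ) := Vec n ≃ᵃ[ℝ] Vec n

/-- The standard Lorentz quadratic form `Q(x) = x₁² + ⋯ + x_{m+1}² − x_{m+2}²` on `ℝ^{m+2}`. -/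
def lorentzQ (m : ℕ) (x : Vec (m + 2)) : ℝ :=
  (∑ i : Fin (m + 1), x i.castSucc ^ 2) - x (Fin.last (m + 1)) ^ 2

/-- Membership in the Lorentzian similarity group
`Sim_L(ℝ^{m+2}) = ℝ^{m+2} ⋊ (O(m+1,1) × ℝ^+)`: the linear part is `λ • A` with `λ > 0`
and `A` a linear map preserving the Lorentz form. -/
def InSimL (m : ℕ) (g : AffGroup (m + 2)) : Prop :=
  ∃ (lam : ℝ) (A : Vec (m + 2) →ₗ[ℝ] Vec (m + 2)), 0 < lam ∧
    (∀ v, lorentzQ m (A v) = lorentzQ m v) ∧ ∀ v, g.linear v = lam • A v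

/-- Properly discontinuous action on `ℝ^n`. -/
def ProperlyDisc {n : ℕ} (Γ : Subgroup (AffGroup n)) : Prop :=
  ∀ K : Set (Vec n), IsCompact K →
    {γ : AffGroup n | γ ∈ Γ ∧ (⇑γ '' K ∩ K).Nonempty}.Finite

/-- Free action on `ℝ^n`. -/
def FreeAction {n : ℕ} (Γ : Subgroup (AffGroup n)) : Prop :=
  ∀ γ ∈ Γ, (∃ x : Vec n, γ x = x) → γ = 1

/-- Cocompact action on `ℝ^n`: some compact set meets every orbit. -/
def CocompactAction {n : ℕ} (Γ : Subgroup (AffGroup n)) : Prop :=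
  ∃ K : Set (Vec n), IsCompact K ∧ ∀ x : Vec n, ∃ γ ∈ Γ, γ x ∈ K

noncomputable section
open Set Topology

abbrev E4 := Vec 4

/-- Lorentz bilinear form -/
def Bf (x y : E4) : ℝ := x 0 * y 0 + x 1 * y 1 + x 2 * y 2 - x 3 * y 3

structure Good (Γ : Subgroup (AffGroup 4)) : Prop where
  lor : ∀ γ ∈ Γ, ∀ x y : E4, Bf (γ.linear x) (γ.linear y) = Bf x y
  free : FreeAction Γ
  pd : ProperlyDisc Γ
  cc : CocompactAction Γ

theorem lorentzQ_eq (x : E4) : lorentzQ 2 x = Bf x x := by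
  have h : lorentzQ 2 x = (∑ i : Fin 3, x (Fin.castSucc i) ^ 2) - x 3 ^ 2 := rfl
  rw [h, Fin.sum_univ_three]
  have h0 : x (Fin.castSucc (0 : Fin 3)) = x 0 := rfl
  have h1 : x (Fin.castSucc (1 : Fin 3)) = x 1 := rfl
  have h2 : x (Fin.castSucc (2 : Fin 3)) = x 2 := rfl
  rw [h0, h1, h2, Bf]; ring

theorem Bf_polar (x y : E4) : Bf x y = (Bf (x + y) (x + y) - Bf x x - Bf y y) / 2 := by
  simp only [Bf, Pi.add_apply]; ring

theorem Bf_comm (x y : E4) : Bf x y = Bf y x := by simp only [Bf]; ring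
theorem Bf_add_left (x y z : E4) : Bf (x + y) z = Bf x z + Bf y z := by
  simp only [Bf, Pi.add_apply]; ring
theorem Bf_add_right (x y z : E4) : Bf x (y + z) = Bf x y + Bf x z := by
  simp only [Bf, Pi.add_apply]; ring
theorem Bf_sub_left (x y z : E4) : Bf (x - y) z = Bf x z - Bf y z := by
  simp only [Bf, Pi.sub_apply]; ring
theorem Bf_sub_right (x y z : E4) : Bf x (y - z) = Bf x y - Bf x z := by
  simp only [Bf, Pi.sub_apply]; ring
theorem Bf_smul_left (c : ℝ) (x y : E4) : Bf (c • x) y = c * Bf x y := by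
  simp only [Bf, Pi.smul_apply, smul_eq_mul]; ring
theorem Bf_smul_right (c : ℝ) (x y : E4) : Bf x (c • y) = c * Bf x y := by
  simp only [Bf, Pi.smul_apply, smul_eq_mul]; ring
theorem Bf_neg_left (x y : E4) : Bf (-x) y = - Bf x y := by
  simp only [Bf, Pi.neg_apply]; ring
theorem Bf_neg_right (x y : E4) : Bf x (-y) = - Bf x y := by
  simp only [Bf, Pi.neg_apply]; ring
theorem Bf_zero_left (y : E4) : Bf 0 y = 0 := by simp [Bf]
theorem Bf_zero_right (y : E4) : Bf y 0 = 0 := by simp [Bf]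

theorem Bf_nondeg (x : E4) (h : ∀ y, Bf x y = 0) : x = 0 := by
  have h0 := h ![1, 0, 0, 0]
  have h1 := h ![0, 1, 0, 0]
  have h2 := h ![0, 0, 1, 0]
  have h3 := h ![0, 0, 0, 1]
  simp [Bf] at h0 h1 h2 h3
  ext i; fin_cases i <;> simpa

theorem Bf_cont : Continuous fun p : E4 × E4 => Bf p.1 p.2 := by
  unfold Bf; fun_prop

theorem aff_apply (γ : AffGroup 4) (x : E4) : γ x = γ.linear x + γ 0 := by
  have := γ.map_vadd 0 x
  simpa using this

theorem aff_sub (γ : AffGroup 4) (x y : E4) : γ x - γ y = γ.linear (x - y) := by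
  rw [aff_apply γ x, aff_apply γ y, map_sub]; abel

theorem mul_ap (γ δ : AffGroup 4) (x : E4) : (γ * δ) x = γ (δ x) := rfl
theorem mul_lin (γ δ : AffGroup 4) (x : E4) : (γ * δ).linear x = γ.linear (δ.linear x) := rfl
theorem one_ap (x : E4) : (1 : AffGroup 4) x = x := rfl
theorem one_lin (x : E4) : (1 : AffGroup 4).linear x = x := rfl
theorem inv_ap (γ : AffGroup 4) (x : E4) : γ⁻¹ (γ x) = x := by
  rw [← mul_ap, inv_mul_cancel]; rfl
theorem ap_inv (γ : AffGroup 4) (x : E4) : γ (γ⁻¹ x) = x := by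
  rw [← mul_ap, mul_inv_cancel]; rfl
theorem inv_lin (γ : AffGroup 4) (x : E4) : γ⁻¹.linear (γ.linear x) = x := by
  rw [← mul_lin, inv_mul_cancel]; rfl
theorem lin_inv (γ : AffGroup 4) (x : E4) : γ.linear (γ⁻¹.linear x) = x := by
  rw [← mul_lin, mul_inv_cancel]; rfl

theorem aff_ext {γ δ : AffGroup 4} (h : ∀ x, γ x = δ x) : γ = δ := AffineEquiv.ext h

theorem aff_cont (γ : AffGroup 4) : Continuous γ := γ.toAffineMap.continuous_of_finiteDimensional

theorem aff_contDiff (γ : AffGroup 4) : ContDiff ℝ 1 γ := by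
  have : (γ : E4 → E4) = fun x => (LinearMap.toContinuousLinearMap (γ.linear : E4 →ₗ[ℝ] E4)) x + γ 0 := by
    ext1 x; rw [aff_apply]; rfl
  rw [this]; fun_prop

theorem Good.of_fin {Γ H : Subgroup (AffGroup 4)} (hG : Good Γ) (hH : H ≤ Γ)
    (F : Set (AffGroup 4)) (hF : F.Finite) (h : ∀ γ ∈ Γ, ∃ f ∈ F, f * γ ∈ H) : Good H := by
  refine ⟨fun γ hγ => hG.lor γ (hH hγ), fun γ hγ => hG.free γ (hH hγ), fun K hK => ?_, ?_⟩
  · exact (hG.pd K hK).subset fun γ hγ => ⟨hH hγ.1, hγ.2⟩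
  · obtain ⟨K, hK, hc⟩ := hG.cc
    refine ⟨⋃ f ∈ F, (f : E4 → E4) '' K, hF.isCompact_biUnion fun f _ => hK.image (aff_cont f), ?_⟩
    intro x
    obtain ⟨γ, hγ, hx⟩ := hc x
    obtain ⟨f, hf, hfγ⟩ := h γ hγ
    refine ⟨f * γ, hfγ, ?_⟩
    simp only [mem_iUnion]
    exact ⟨f, hf, γ x, hx, rfl⟩

/-- index two criterion -/
theorem Good.of_two {Γ H : Subgroup (AffGroup 4)} (hG : Good Γ) (hH : H ≤ Γ)
    (h : ∀ γ ∈ Γ, ∀ δ ∈ Γ, γ ∉ H → δ ∉ H → γ * δ ∈ H) : Good H := by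
  by_cases hall : ∀ γ ∈ Γ, γ ∈ H
  · exact hG.of_fin hH {1} (finite_singleton _) fun γ hγ => ⟨1, rfl, by simpa using hall γ hγ⟩
  · push Not at hall
    obtain ⟨g, hg, hgH⟩ := hall
    refine hG.of_fin hH {1, g} (by simp) fun γ hγ => ?_
    by_cases hγH : γ ∈ H
    · exact ⟨1, by simp, by simpa⟩
    · exact ⟨g, by simp, h g hg γ hγ hgH hγH⟩

theorem Good.inv_lor {Γ : Subgroup (AffGroup 4)} (hG : Good Γ) {γ} (hγ : γ ∈ Γ) (x y : E4) :
    Bf (γ.linear x) y = Bf x (γ⁻¹.linear y) := by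
  conv_lhs => rw [← lin_inv γ y]
  exact hG.lor γ hγ _ _

end

noncomputable section
open Set Topology

theorem lf_contDiffAt {ι F : Type*} [NormedAddCommGroup F] [NormedSpace ℝ F]
    (a : ι → E4 → ℝ) (g : ι → F) (x0 : E4)
    (s : Set ι) (hs : s.Finite) (U : Set E4) (hU : U ∈ 𝓝 x0) (h : ∀ x ∈ U, ∀ i ∉ s, a i x = 0)
    (ha : ∀ i, ContDiffAt ℝ 1 (a i) x0) : ContDiffAt ℝ 1 (fun x => ∑ᶠ i, a i x • g i) x0 := by
  have : (fun x => ∑ᶠ i, a i x • g i) =ᶠ[𝓝 x0] fun x => ∑ i ∈ hs.toFinset, a i x • g i := by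
    filter_upwards [hU] with x hx
    apply finsum_eq_sum_of_support_subset
    intro i hi
    by_contra hc
    apply hi
    have : i ∉ s := by simpa using hc
    simp [h x hx i this]
  refine ContDiffAt.congr_of_eventuallyEq ?_ this
  apply ContDiffAt.sum
  intro i _
  exact (ha i).smul contDiffAt_const

theorem Good.fin {Γ : Subgroup (AffGroup 4)} (hG : Good Γ) {φ : E4 → ℝ} (hφ : HasCompactSupport φ)
    {C : Set E4} (hC : IsCompact C) :
    {γ : Γ | ∃ x ∈ C, φ ((γ : AffGroup 4)⁻¹ x) ≠ 0}.Finite := by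
  have h1 := hG.pd (C ∪ tsupport φ) (hC.union hφ)
  refine (h1.preimage (f := fun γ : Γ => (γ : AffGroup 4)) Subtype.val_injective.injOn).subset ?_
  rintro γ ⟨x, hx, hne⟩
  refine ⟨γ.2, x, ⟨(γ : AffGroup 4)⁻¹ x, Or.inr (subset_tsupport _ hne), ap_inv _ _⟩, Or.inl hx⟩

theorem Good.fin' {Γ : Subgroup (AffGroup 4)} (hG : Good Γ) {φ : E4 → ℝ} (hφ : HasCompactSupport φ)
    (x : E4) : {γ : Γ | φ ((γ : AffGroup 4)⁻¹ x) ≠ 0}.Finite := by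
  refine (hG.fin hφ (isCompact_singleton (x := x))).subset ?_
  intro γ h
  exact ⟨x, rfl, h⟩

/-- averaging -/
def avg {F : Type*} [AddCommGroup F] [Module ℝ F] (Γ : Subgroup (AffGroup 4)) (φ : E4 → ℝ)
    (g : Γ → F) (x : E4) : F :=
  ∑ᶠ γ : Γ, φ ((γ : AffGroup 4)⁻¹ x) • g γ

theorem avg_contDiff {F : Type*} [NormedAddCommGroup F] [NormedSpace ℝ F]
    {Γ : Subgroup (AffGroup 4)} (hG : Good Γ) {φ : E4 → ℝ}
    (hφ : HasCompactSupport φ) (hd : ContDiff ℝ 1 φ) (g : Γ → F) : ContDiff ℝ 1 (avg Γ φ g) := by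
  rw [contDiff_iff_contDiffAt]
  intro x0
  refine lf_contDiffAt _ _ x0 _ (hG.fin hφ (isCompact_closedBall x0 1)) _
    (Metric.closedBall_mem_nhds x0 one_pos) ?_ ?_
  · intro x hx i hi
    by_contra hne
    exact hi ⟨x, hx, hne⟩
  · intro i
    exact (hd.comp (aff_contDiff _)).contDiffAt

theorem avg_shift {F : Type*} [AddCommGroup F] [Module ℝ F] (Γ : Subgroup (AffGroup 4)) (φ : E4 → ℝ)
    (g : Γ → F) (δ : Γ) (x : E4) : avg Γ φ g ((δ : AffGroup 4) x) = avg Γ φ (fun γ => g (δ * γ)) x := by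
  unfold avg
  rw [← finsum_comp_equiv (Equiv.mulLeft δ)]
  apply finsum_congr
  intro γ
  simp only [Equiv.coe_mulLeft, Subgroup.coe_mul, mul_inv_rev, mul_ap, inv_ap]

theorem Good.exists_bump {Γ : Subgroup (AffGroup 4)} (hG : Good Γ) :
    ∃ φ : E4 → ℝ, ContDiff ℝ 1 φ ∧ HasCompactSupport φ ∧ (∀ x, 0 ≤ φ x) ∧
      ∀ x, ∑ᶠ γ : Γ, φ ((γ : AffGroup 4)⁻¹ x) = 1 := by
  obtain ⟨K, hK, hc⟩ := hG.cc
  obtain ⟨R, hR0, hR⟩ := hK.isBounded.subset_closedBall_lt 0 0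
  let b : ContDiffBump (0 : E4) := ⟨R, R + 1, hR0, by linarith⟩
  have hb1 : ContDiff ℝ 1 b := b.contDiff
  have hbs : HasCompactSupport b := b.hasCompactSupport
  let s : E4 → ℝ := avg Γ b (fun _ => (1 : ℝ))
  have hs1 : ContDiff ℝ 1 s := avg_contDiff hG hbs hb1 _
  have hsi : ∀ (δ : Γ) x, s ((δ : AffGroup 4) x) = s x := fun δ x => avg_shift Γ b _ δ x
  have hse : ∀ x, s x = ∑ᶠ γ : Γ, b ((γ : AffGroup 4)⁻¹ x) := by
    intro x; simp [s, avg]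
  have hpos : ∀ x, 0 < s x := by
    intro x
    obtain ⟨γ, hγ, hx⟩ := hc x
    rw [hse]
    apply finsum_pos (fun i => b.nonneg)
    · refine ⟨⟨γ⁻¹, Γ.inv_mem hγ⟩, ?_⟩
      have : b (γ x) = 1 := b.one_of_mem_closedBall (hR hx)
      simp only [inv_inv, this]; norm_num
    · exact hG.fin' hbs x
  refine ⟨fun x => b x / s x, hb1.div hs1 fun x => (hpos x).ne', ?_, fun x => div_nonneg b.nonneg (hpos x).le, ?_⟩
  · have : (fun x => b x / s x) = fun x => b x * (s x)⁻¹ := by ext; rw [div_eq_mul_inv]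
    rw [this]
    exact hbs.mul_right
  · intro x
    have : ∀ γ : Γ, b ((γ : AffGroup 4)⁻¹ x) / s ((γ : AffGroup 4)⁻¹ x) = b ((γ : AffGroup 4)⁻¹ x) * (s x)⁻¹ := by
      intro γ
      have := hsi γ⁻¹ x
      simp only [InvMemClass.coe_inv] at this
      rw [this, div_eq_mul_inv]
    rw [finsum_congr this, ← finsum_mul, ← hse, mul_inv_cancel₀ (hpos x).ne']

end

noncomputable section
open Set Topology MeasureTheory

theorem det_poly (M : Matrix (Fin 4) (Fin 4) ℝ) : ∃ p : Polynomial ℝ, p.natDegree ≤ 4 ∧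
    ∀ s : ℝ, p.eval s = (1 + s • M).det := by
  refine ⟨Matrix.det ((Polynomial.X : Polynomial ℝ) • M.map Polynomial.C + (1 : Matrix (Fin 4) (Fin 4) ℝ).map Polynomial.C), ?_, ?_⟩
  · exact (Polynomial.natDegree_det_X_add_C_le M 1).trans (by simp)
  · intro s
    rw [← Polynomial.coe_evalRingHom, RingHom.map_det]
    congr 1
    ext i j
    by_cases h : i = j
    · subst h
      simp only [RingHom.mapMatrix_apply, Matrix.map_apply, Matrix.add_apply, Matrix.smul_apply, Matrix.one_apply_eq, Polynomial.coe_evalRingHom, smul_eq_mul, Polynomial.eval_add, Polynomial.eval_mul, Polynomial.eval_X, Polynomial.eval_C]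
      ring
    · simp only [RingHom.mapMatrix_apply, Matrix.map_apply, Matrix.add_apply, Matrix.smul_apply, Matrix.one_apply_ne h, Polynomial.coe_evalRingHom, smul_eq_mul, Polynomial.eval_add, Polynomial.eval_mul, Polynomial.eval_X, Polynomial.eval_C]
      ring

theorem det_poly_interp (ε : ℝ) (hε : 0 < ε) : ∃ w : Fin 5 → ℝ, ∃ t : Fin 5 → ℝ,
    (∀ j, 0 ≤ t j ∧ t j ≤ ε) ∧ (∑ j, w j = 1) ∧ ∀ D : E4 →L[ℝ] E4,
      (1 + D).det = ∑ j, w j * (1 + t j • D).det := by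
  let t : Fin 5 → ℝ := fun j => ε * j / 4
  have ht : Function.Injective t := by
    intro i j h
    simp only [t] at h
    have : (i : ℝ) = j := by
      have h2 : ε * (i : ℝ) = ε * j := by linarith
      exact mul_left_cancel₀ hε.ne' h2
    exact Fin.ext (by exact_mod_cast this)
  have key : ∀ p : Polynomial ℝ, p.natDegree ≤ 4 →
      p.eval 1 = ∑ j, (Lagrange.basis Finset.univ t j).eval 1 * p.eval (t j) := by
    intro p hp
    have h1 : p.degree < (Finset.univ : Finset (Fin 5)).card := by
      refine lt_of_le_of_lt Polynomial.degree_le_natDegree ?_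
      simp only [Finset.card_univ, Fintype.card_fin]
      exact_mod_cast Nat.lt_succ_of_le hp
    have h2 := Lagrange.eq_interpolate (ht.injOn (s := ((Finset.univ : Finset (Fin 5)) : Set (Fin 5)))) h1
    conv_lhs => rw [h2]
    rw [Lagrange.interpolate_apply, Polynomial.eval_finsetSum]
    apply Finset.sum_congr rfl
    intro j _
    rw [Polynomial.eval_mul, Polynomial.eval_C, mul_comm]
  refine ⟨fun j => (Lagrange.basis Finset.univ t j).eval 1, t, ?_, ?_, ?_⟩
  · intro j
    have hj : (j : ℝ) ≤ 4 := by exact_mod_cast Nat.lt_succ_iff.mp j.2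
    have hj0 : (0 : ℝ) ≤ j := by positivity
    constructor
    · simp only [t]; positivity
    · simp only [t]; nlinarith
  · have := key 1 (by simp)
    simpa using this.symm
  · intro D
    obtain ⟨p, hp, hev⟩ := det_poly (LinearMap.toMatrix' (D : E4 →ₗ[ℝ] E4))
    have hev' : ∀ s : ℝ, p.eval s = (1 + s • D).det := by
      intro s
      have h1 : (1 + s • D).det = LinearMap.det (((1 + s • D : E4 →L[ℝ] E4)) : E4 →ₗ[ℝ] E4) := rfl
      rw [hev, h1, ← LinearMap.det_toMatrix']
      congr 1
      have h3 : ((1 + s • D : E4 →L[ℝ] E4) : E4 →ₗ[ℝ] E4) = LinearMap.id + s • (D : E4 →ₗ[ℝ] E4) := rfl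
      rw [h3, map_add, map_smul, LinearMap.toMatrix'_id]
    have := key p hp
    rw [hev'] at this
    simp only [hev'] at this
    simpa using this

theorem Good.det_sq {Γ : Subgroup (AffGroup 4)} (hG : Good Γ) {γ} (hγ : γ ∈ Γ) :
    |LinearMap.det (γ.linear : E4 →ₗ[ℝ] E4)| = 1 := by
  let M := LinearMap.toMatrix' (γ.linear : E4 →ₗ[ℝ] E4)
  let J : Matrix (Fin 4) (Fin 4) ℝ := Matrix.diagonal ![1, 1, 1, -1]
  have hB : ∀ x y : E4, Bf x y = x ⬝ᵥ (J.mulVec y) := by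
    intro x y
    simp [Bf, J, dotProduct, Fin.sum_univ_four, Matrix.mulVec_diagonal]
    ring
  have hM : ∀ x : E4, γ.linear x = M.mulVec x := by
    intro x; simp [M, LinearMap.toMatrix'_mulVec]
  have h : M.transpose * J * M = J := by
    apply Matrix.ext_iff_mulVec.mpr
    intro y
    rw [← Matrix.mulVec_mulVec, ← Matrix.mulVec_mulVec]
    apply dotProduct_eq
    intro x
    rw [dotProduct_comm, dotProduct_comm _ x, Matrix.mulVec_transpose, dotProduct_comm, ← Matrix.dotProduct_mulVec, dotProduct_comm] 
    have := hG.lor γ hγ x y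
    rw [hB, hB, hM, hM] at this
    exact this
  have h2 : M.det * M.det = 1 := by
    have := congrArg Matrix.det h
    rw [Matrix.det_mul, Matrix.det_mul, Matrix.det_transpose] at this
    have hJ : J.det ≠ 0 := by simp [J, Matrix.det_diagonal, Fin.prod_univ_four]
    have : (M.det * M.det - 1) * J.det = 0 := by linarith
    rcases mul_eq_zero.mp this with h | h
    · linarith
    · exact absurd h hJ
  rw [← LinearMap.det_toMatrix']
  have : |M.det| * |M.det| = 1 := by rw [← abs_mul, h2, abs_one]
  nlinarith [abs_nonneg M.det]

theorem Good.mp {Γ : Subgroup (AffGroup 4)} (hG : Good Γ) {γ} (hγ : γ ∈ Γ) :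
    MeasurePreserving (γ : E4 → E4) volume volume := by
  have h1 : MeasurePreserving ((γ.linear : E4 →ₗ[ℝ] E4) : E4 → E4) volume volume := by
    refine ⟨(LinearMap.continuous_of_finiteDimensional _).measurable, ?_⟩
    have hd := hG.det_sq hγ
    rw [Measure.map_linearMap_addHaar_eq_smul_addHaar]
    · rw [abs_inv, hd]; simp
    · intro h; rw [h] at hd; simp at hd
  have h2 : MeasurePreserving (fun x : E4 => x + γ 0) volume volume := measurePreserving_add_right _ _
  have := h2.comp h1
  convert this using 1
  ext1 x
  exact aff_apply γ x

theorem Good.integral_comp {Γ : Subgroup (AffGroup 4)} (hG : Good Γ) {γ} (hγ : γ ∈ Γ) (f : E4 → ℝ) :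
    ∫ x, f (γ x) = ∫ x, f x := by
  apply (hG.mp hγ).integral_comp
  have hc : Continuous ((γ⁻¹ : AffGroup 4) : E4 → E4) := aff_cont _
  exact (Homeomorph.mk γ.toEquiv (aff_cont γ) hc).measurableEmbedding

end

noncomputable section
open Set Topology MeasureTheory

/-- the homotopy -/
def Gs (F : E4 → E4) (s : ℝ) (x : E4) : E4 := x + s • (F x - x)

theorem Gs_equiv {F : E4 → E4} {γ : AffGroup 4} (h : ∀ x, F (γ x) = γ (F x)) (s : ℝ) (x : E4) :
    Gs F s (γ x) = γ (Gs F s x) := by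
  unfold Gs
  rw [h, aff_sub, aff_apply γ (x + _), map_add, map_smul, aff_apply γ x]
  abel

theorem Gs_fderiv {F : E4 → E4} (hF : ContDiff ℝ 1 F) (s : ℝ) (x : E4) :
    HasFDerivAt (Gs F s) (1 + s • (fderiv ℝ F x - 1)) x := by
  have h1 : HasFDerivAt F (fderiv ℝ F x) x := (hF.differentiable one_ne_zero x).hasFDerivAt
  have h2 : HasFDerivAt (fun y : E4 => y) (1 : E4 →L[ℝ] E4) x := hasFDerivAt_id x
  exact h2.add ((h1.sub h2).const_smul s)

/-- jacobian -/
def jac (F : E4 → E4) (s : ℝ) (x : E4) : ℝ := (1 + s • (fderiv ℝ F x - 1)).det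

theorem jac_cont {F : E4 → E4} (hF : ContDiff ℝ 1 F) (s : ℝ) : Continuous (jac F s) := by
  unfold jac
  apply ContinuousLinearMap.continuous_det.comp
  have := hF.continuous_fderiv one_ne_zero
  fun_prop

theorem jac_inv {F : E4 → E4} (hF : ContDiff ℝ 1 F) {γ : AffGroup 4} (h : ∀ x, F (γ x) = γ (F x))
    (s : ℝ) (x : E4) : jac F s (γ x) = jac F s x := by
  let L : E4 →L[ℝ] E4 := LinearMap.toContinuousLinearMap (γ.linear : E4 →ₗ[ℝ] E4)
  have hγ : ∀ y, HasFDerivAt (γ : E4 → E4) L y := by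
    intro y
    have h1 : (γ : E4 → E4) = fun x => L x + γ 0 := by
      ext1 x; rw [aff_apply]; rfl
    rw [h1]
    exact L.hasFDerivAt.add_const _
  have h1 : HasFDerivAt (fun y => Gs F s (γ y)) ((1 + s • (fderiv ℝ F (γ x) - 1)).comp L) x :=
    (Gs_fderiv hF s (γ x)).comp x (hγ x)
  have h2 : HasFDerivAt (fun y => γ (Gs F s y)) (L.comp (1 + s • (fderiv ℝ F x - 1))) x :=
    (hγ _).comp x (Gs_fderiv hF s x)
  have h3 : (fun y => Gs F s (γ y)) = fun y => γ (Gs F s y) := by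
    ext1 y; exact Gs_equiv h s y
  rw [h3] at h1
  have h4 := h1.unique h2
  have h5 : ∀ A B : E4 →L[ℝ] E4, (A.comp B).det = A.det * B.det := by
    intro A B
    exact LinearMap.det_comp (A : E4 →ₗ[ℝ] E4) (B : E4 →ₗ[ℝ] E4)
  have h6 := congrArg ContinuousLinearMap.det h4
  rw [h5, h5] at h6
  have h7 : L.det ≠ 0 := by
    have : L.det = LinearMap.det (γ.linear : E4 →ₗ[ℝ] E4) := rfl
    rw [this]
    exact (LinearEquiv.isUnit_det' γ.linear).ne_zero
  unfold jac
  rw [mul_comm] at h6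
  exact mul_left_cancel₀ h7 h6

theorem principle_small {Γ : Subgroup (AffGroup 4)} (hG : Good Γ) {F : E4 → E4} (hF : ContDiff ℝ 1 F)
    (heq : ∀ γ ∈ Γ, ∀ x, F (γ x) = γ (F x)) (C : Set E4) (hC : IsCompact C) :
    ∃ ε > 0, ∀ s, 0 ≤ s → s ≤ ε → Function.Bijective (Gs F s) ∧ ∀ x ∈ C, 0 < jac F s x := by
  obtain ⟨K, hK, hc⟩ := hG.cc
  obtain ⟨r0, hr0, hKr⟩ := hK.isBounded.subset_closedBall_lt 0 0
  obtain ⟨rC, hrC, hCr⟩ := hC.isBounded.subset_closedBall_lt 0 0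
  have hFc : Continuous F := hF.continuous
  obtain ⟨M, hM⟩ := (hK.image (f := fun x => F x - x) (by fun_prop)).isBounded.exists_norm_le
  have hM0 : ∀ x ∈ K, ‖F x - x‖ ≤ |M| := fun x hx => (hM _ ⟨x, hx, rfl⟩).trans (le_abs_self M)
  let K1 : Set E4 := Metric.closedBall 0 (r0 + |M|)
  have hT := hG.pd K1 (isCompact_closedBall _ _)
  set T := {γ : AffGroup 4 | γ ∈ Γ ∧ (⇑γ '' K1 ∩ K1).Nonempty}
  have hK2 : IsCompact (⋃ γ ∈ T, (γ : E4 → E4) '' K) :=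
    hT.isCompact_biUnion fun f _ => hK.image (aff_cont f)
  obtain ⟨r2, hr2, hKr2⟩ := hK2.isBounded.subset_closedBall_lt 0 0
  set r : ℝ := 2 * (r0 + ‖F 0 - 0‖) + r2 + rC + 1 with hr
  have hnn := norm_nonneg (F 0 - 0)
  have hrpos : 0 < r := by positivity
  have hDc : Continuous fun x => fderiv ℝ F x - 1 := by
    have := hF.continuous_fderiv one_ne_zero
    fun_prop
  obtain ⟨l, hl⟩ := ((isCompact_closedBall (0 : E4) r).image hDc).isBounded.exists_norm_le
  have hl' : ∀ x ∈ Metric.closedBall (0 : E4) r, ‖fderiv ℝ F x - 1‖ ≤ |l| :=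
    fun x hx => (hl _ ⟨x, hx, rfl⟩).trans (le_abs_self l)
  have hl0 := abs_nonneg l
  -- determinant positivity
  have hdet : ∃ η > 0, ∀ X : E4 →L[ℝ] E4, ‖X‖ < η → 0 < (1 + X).det := by
    have h1 : Continuous fun X : E4 →L[ℝ] E4 => (1 + X).det :=
      ContinuousLinearMap.continuous_det.comp (by fun_prop)
    have h2 : (0 : ℝ) < (1 + (0 : E4 →L[ℝ] E4)).det := by
      have : (1 + (0 : E4 →L[ℝ] E4)).det = LinearMap.det (LinearMap.id : E4 →ₗ[ℝ] E4) := by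
        rw [add_zero]; rfl
      rw [this]; simp
    have h3 := (h1.tendsto 0).eventually (lt_mem_nhds h2)
    obtain ⟨η, hη, h4⟩ := Metric.eventually_nhds_iff.mp h3
    exact ⟨η, hη, fun X hX => h4 (by simpa using hX)⟩
  obtain ⟨η, hη, hdet⟩ := hdet
  refine ⟨min 1 (min (1 / (2 * (|l| + 1))) (η / (2 * (|l| + 1)))), by positivity, ?_⟩
  intro s hs0 hs
  have hs1 : s ≤ 1 := hs.trans (min_le_left _ _)
  have hs2 : s * (2 * (|l| + 1)) ≤ 1 := by
    have := hs.trans ((min_le_right _ _).trans (min_le_left _ _))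
    rwa [le_div_iff₀ (by positivity)] at this
  have hs3 : s * (2 * (|l| + 1)) ≤ η := by
    have := hs.trans ((min_le_right _ _).trans (min_le_right _ _))
    rwa [le_div_iff₀ (by positivity)] at this
  have hlip : ∀ x ∈ Metric.closedBall (0 : E4) r, ∀ y ∈ Metric.closedBall (0 : E4) r,
      ‖(F y - y) - (F x - x)‖ ≤ |l| * ‖y - x‖ := by
    intro x hx y hy
    refine (convex_closedBall (0 : E4) r).norm_image_sub_le_of_norm_hasFDerivWithin_le
      (f := fun x => F x - x) (f' := fun x => fderiv ℝ F x - 1) ?_ hl' hx hy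
    intro z _
    exact (((hF.differentiable one_ne_zero z).hasFDerivAt).sub (hasFDerivAt_id z)).hasFDerivWithinAt
  have hsub : ∀ x ∈ K, x ∈ Metric.closedBall (0 : E4) r := by
    intro x hx
    have := hKr hx
    simp only [Metric.mem_closedBall, dist_zero_right] at this ⊢
    linarith
  have hGK : ∀ x ∈ K, Gs F s x ∈ K1 := by
    intro x hx
    have h1 := hKr hx
    have h2 := hM0 x hx
    simp only [K1, Metric.mem_closedBall, dist_zero_right] at h1 ⊢
    unfold Gs
    refine (norm_add_le _ _).trans ?_
    rw [norm_smul, Real.norm_eq_abs, abs_of_nonneg hs0]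
    have : s * ‖F x - x‖ ≤ 1 * |M| := mul_le_mul hs1 h2 (norm_nonneg _) zero_le_one
    linarith
  refine ⟨⟨?_, ?_⟩, ?_⟩
  · have inj1 : ∀ x ∈ K, ∀ y, Gs F s x = Gs F s y → x = y := by
      intro x hx y hxy
      obtain ⟨γ, hγ, hy⟩ := hc y
      have h1 : Gs F s (γ y) = γ (Gs F s y) := Gs_equiv (heq γ hγ) s y
      have h2 : γ⁻¹ ∈ T := by
        refine ⟨Γ.inv_mem hγ, Gs F s y, ⟨Gs F s (γ y), hGK _ hy, ?_⟩, ?_⟩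
        · rw [h1, inv_ap]
        · rw [← hxy]; exact hGK x hx
      have h3 : y ∈ Metric.closedBall (0 : E4) r := by
        have h4 : y ∈ ⋃ γ ∈ T, (γ : E4 → E4) '' K := by
          simp only [mem_iUnion]
          exact ⟨γ⁻¹, h2, γ y, hy, inv_ap _ _⟩
        have := hKr2 h4
        simp only [Metric.mem_closedBall, dist_zero_right] at this ⊢
        linarith
      have h4 := hlip x (hsub x hx) y h3
      have h5 : x - y = s • ((F y - y) - (F x - x)) := by
        unfold Gs at hxy
        have : x - y = s • (F y - y) - s • (F x - x) := by
          rw [sub_eq_sub_iff_add_eq_add, hxy]; abel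
        rw [this]; module
      have h6 : ‖x - y‖ ≤ s * (|l| * ‖y - x‖) := by
        rw [h5, norm_smul, Real.norm_eq_abs, abs_of_nonneg hs0]
        gcongr
      rw [norm_sub_rev y x] at h6
      have h7 := norm_nonneg (x - y)
      have h8 : s * |l| ≤ 1 / 2 := by nlinarith
      have h9 : ‖x - y‖ ≤ 0 := by nlinarith
      have := norm_le_zero_iff.mp h9
      exact sub_eq_zero.mp this
    intro x y hxy
    obtain ⟨γ, hγ, hx⟩ := hc x
    have := inj1 (γ x) hx (γ y) (by
      rw [Gs_equiv (heq γ hγ), Gs_equiv (heq γ hγ), hxy])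
    exact γ.injective this
  · have happ : ApproximatesLinearOn (Gs F s) (1 : E4 →L[ℝ] E4) (Metric.closedBall (0 : E4) r) (1 / 2) := by
      intro x hx y hy
      have h4 := hlip y hy x hx
      have h5 : Gs F s x - Gs F s y - (1 : E4 →L[ℝ] E4) (x - y) = s • ((F x - x) - (F y - y)) := by
        unfold Gs
        show (x + s • (F x - x)) - (y + s • (F y - y)) - (x - y) = _
        module
      rw [h5, norm_smul, Real.norm_eq_abs, abs_of_nonneg hs0]
      have h7 := norm_nonneg (x - y)
      have h8 : s * |l| ≤ 1 / 2 := by nlinarith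
      have h9 : s * ‖F x - x - (F y - y)‖ ≤ s * (|l| * ‖x - y‖) := by gcongr
      push_cast
      nlinarith
    have hsurj := happ.surjOn_closedBall_of_nonlinearRightInverse
      (f'symm := ⟨fun x => x, 1, fun y => by simp, fun y => rfl⟩) hrpos.le subset_rfl
    intro y
    obtain ⟨γ, hγ, hy⟩ := hc y
    have : γ y ∈ Metric.closedBall (Gs F s 0) ((((1 : NNReal) : ℝ)⁻¹ - ((1 / 2 : NNReal) : ℝ)) * r) := by
      have h1 := hKr hy
      simp only [Metric.mem_closedBall, dist_zero_right] at h1 ⊢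
      rw [dist_eq_norm]
      have h2 : ‖Gs F s 0‖ ≤ ‖F 0 - 0‖ := by
        unfold Gs
        rw [zero_add, norm_smul, Real.norm_eq_abs, abs_of_nonneg hs0]
        nlinarith
      have h3 := norm_sub_le (γ y) (Gs F s 0)
      push_cast
      linarith
    obtain ⟨x, _, hx⟩ := hsurj this
    refine ⟨γ⁻¹ x, ?_⟩
    rw [Gs_equiv (heq _ (Γ.inv_mem hγ)), hx, inv_ap]
  · intro x hx
    apply hdet
    have h1 : x ∈ Metric.closedBall (0 : E4) r := by
      have := hCr hx
      simp only [Metric.mem_closedBall, dist_zero_right] at this ⊢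
      linarith
    rw [norm_smul, Real.norm_eq_abs, abs_of_nonneg hs0]
    have := hl' x h1
    have : s * ‖fderiv ℝ F x - 1‖ ≤ s * |l| := by gcongr
    rcases hs0.eq_or_lt with h | h
    · rw [← h]; simpa using hη
    · nlinarith

theorem principle_const {Γ : Subgroup (AffGroup 4)} (hG : Good Γ) {F : E4 → E4} (hF : ContDiff ℝ 1 F)
    (heq : ∀ γ ∈ Γ, ∀ x, F (γ x) = γ (F x)) {φ : E4 → ℝ} (hφ : ContDiff ℝ 1 φ)
    (hφs : HasCompactSupport φ) (h1 : ∀ x, ∑ᶠ γ : Γ, φ ((γ : AffGroup 4)⁻¹ x) = 1)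
    (s : ℝ) (hb : Function.Bijective (Gs F s)) (hpos : ∀ x ∈ tsupport φ, 0 < jac F s x) :
    ∫ x, φ x * jac F s x = ∫ x, φ x := by
  have hGc : Continuous (Gs F s) := by
    have := hF.continuous
    unfold Gs; fun_prop
  have hjc := jac_cont hF s
  have hφc := hφ.continuous
  have hT := hG.fin hφs (hφs.image hGc : IsCompact (Gs F s '' tsupport φ))
  set T := {γ : Γ | ∃ x ∈ Gs F s '' tsupport φ, φ ((γ : AffGroup 4)⁻¹ x) ≠ 0}
  have hacont : ∀ γ : AffGroup 4, Continuous γ := aff_cont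
  -- step 1
  have e1 : ∀ x, φ x * jac F s x = ∑ γ ∈ hT.toFinset, φ x * φ ((γ : AffGroup 4)⁻¹ (Gs F s x)) * |jac F s x| := by
    intro x
    by_cases hx : φ x = 0
    · simp [hx]
    · have hx' : x ∈ tsupport φ := subset_tsupport _ hx
      rw [abs_of_pos (hpos x hx')]
      have := h1 (Gs F s x)
      rw [finsum_eq_sum_of_support_subset (s := hT.toFinset)] at this
      · rw [← Finset.sum_mul, ← Finset.mul_sum, this, mul_one]
      · intro γ hγ
        simp only [Finite.coe_toFinset]
        exact ⟨_, ⟨x, hx', rfl⟩, hγ⟩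
  have int1 : ∀ γ : Γ, Integrable fun x => φ x * φ ((γ : AffGroup 4)⁻¹ (Gs F s x)) * |jac F s x| := by
    intro γ
    apply Continuous.integrable_of_hasCompactSupport
    · have := hacont (γ : AffGroup 4)⁻¹
      fun_prop
    · exact (hφs.mul_right).mul_right
  have e2 : ∀ γ : Γ, ∫ x, φ x * φ ((γ : AffGroup 4)⁻¹ (Gs F s x)) * |jac F s x| =
      ∫ x, φ ((γ : AffGroup 4) x) * φ (Gs F s x) * |jac F s x| := by
    intro γ
    rw [← hG.integral_comp γ.2]
    apply integral_congr_ae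
    filter_upwards with x
    rw [Gs_equiv (heq _ γ.2), inv_ap, jac_inv hF (heq _ γ.2)]
  have int2 : ∀ γ : Γ, Integrable fun x => φ ((γ : AffGroup 4) x) * φ (Gs F s x) * |jac F s x| := by
    intro γ
    apply Continuous.integrable_of_hasCompactSupport
    · have := hacont (γ : AffGroup 4)
      fun_prop
    · have hcs : HasCompactSupport fun x => φ ((γ : AffGroup 4) x) := by
        have hc : Continuous (((γ : AffGroup 4)⁻¹ : AffGroup 4) : E4 → E4) := aff_cont _
        exact hφs.comp_homeomorph (Homeomorph.mk (γ : AffGroup 4).toEquiv (aff_cont γ) hc)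
      exact (hcs.mul_right).mul_right
  have e3 : ∀ x, ∑ γ ∈ hT.toFinset, φ ((γ : AffGroup 4) x) * φ (Gs F s x) * |jac F s x| =
      |jac F s x| • φ (Gs F s x) := by
    intro x
    by_cases hx : φ (Gs F s x) = 0
    · simp [hx]
    · have := h1 x
      rw [← finsum_comp_equiv (Equiv.inv Γ)] at this
      simp only [Equiv.inv_apply, InvMemClass.coe_inv, inv_inv] at this
      rw [finsum_eq_sum_of_support_subset (s := hT.toFinset)] at this
      · rw [← Finset.sum_mul, ← Finset.sum_mul, this, one_mul, smul_eq_mul, mul_comm]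
      · intro γ hγ
        simp only [Finite.coe_toFinset]
        refine ⟨_, ⟨(γ : AffGroup 4) x, subset_tsupport _ hγ, rfl⟩, ?_⟩
        rw [Gs_equiv (heq _ γ.2), inv_ap]
        exact hx
  have e4 := integral_image_eq_integral_abs_det_fderiv_smul volume MeasurableSet.univ
    (fun x _ => (Gs_fderiv hF s x).hasFDerivWithinAt) hb.1.injOn φ
  rw [image_univ, hb.2.range_eq, setIntegral_univ, setIntegral_univ] at e4
  calc ∫ x, φ x * jac F s x = ∫ x, ∑ γ ∈ hT.toFinset, φ x * φ ((γ : AffGroup 4)⁻¹ (Gs F s x)) * |jac F s x| := by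
        simp only [← e1]
    _ = ∑ γ ∈ hT.toFinset, ∫ x, φ x * φ ((γ : AffGroup 4)⁻¹ (Gs F s x)) * |jac F s x| :=
        integral_finsetSum _ fun γ _ => int1 γ
    _ = ∑ γ ∈ hT.toFinset, ∫ x, φ ((γ : AffGroup 4) x) * φ (Gs F s x) * |jac F s x| := by
        simp only [e2]
    _ = ∫ x, ∑ γ ∈ hT.toFinset, φ ((γ : AffGroup 4) x) * φ (Gs F s x) * |jac F s x| :=
        (integral_finsetSum _ fun γ _ => int2 γ).symm
    _ = ∫ x, |jac F s x| • φ (Gs F s x) := by simp only [e3]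
    _ = ∫ x, φ x := e4.symm

theorem principle {Γ : Subgroup (AffGroup 4)} (hG : Good Γ) {F : E4 → E4} (hF : ContDiff ℝ 1 F)
    (heq : ∀ γ ∈ Γ, ∀ x, F (γ x) = γ (F x)) (hdet : ∀ x, (fderiv ℝ F x).det = 0) : False := by
  obtain ⟨φ, hφ, hφs, hφ0, h1⟩ := hG.exists_bump
  obtain ⟨ε, hε, hsm⟩ := principle_small hG hF heq _ hφs
  obtain ⟨w, t, ht, hw, hp⟩ := det_poly_interp ε hε
  have hJ : ∀ j, ∫ x, φ x * jac F (t j) x = ∫ x, φ x := fun j =>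
    principle_const hG hF heq hφ hφs h1 (t j) (hsm _ (ht j).1 (ht j).2).1 (hsm _ (ht j).1 (ht j).2).2
  have h2 : ∀ x, ∑ j, w j * (φ x * jac F (t j) x) = 0 := by
    intro x
    have := hp (fderiv ℝ F x - 1)
    rw [add_sub_cancel, hdet] at this
    have h3 : ∑ j, w j * (φ x * jac F (t j) x) = φ x * ∑ j, w j * jac F (t j) x := by
      rw [Finset.mul_sum]; apply Finset.sum_congr rfl; intros; ring
    rw [h3]
    unfold jac
    rw [← this, mul_zero]
  have h3 : ∫ x, φ x = 0 := by
    calc ∫ x, φ x = ∑ j, w j * ∫ x, φ x * jac F (t j) x := by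
          simp only [hJ]; rw [← Finset.sum_mul, hw, one_mul]
      _ = ∑ j, ∫ x, w j * (φ x * jac F (t j) x) := by simp only [integral_const_mul]
      _ = ∫ x, ∑ j, w j * (φ x * jac F (t j) x) := by
          symm
          apply integral_finsetSum
          intro j _
          apply Integrable.const_mul
          apply Continuous.integrable_of_hasCompactSupport
          · exact hφ.continuous.mul (jac_cont hF _)
          · exact hφs.mul_right
      _ = 0 := by simp only [h2, integral_zero]
  have h4 : Integrable φ := hφ.continuous.integrable_of_hasCompactSupport hφs
  have h5 : φ = 0 := by
    have := (integral_eq_zero_iff_of_nonneg hφ0 h4).mp h3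
    exact (hφ.continuous.ae_eq_iff_eq volume continuous_zero).mp this
  have := h1 0
  simp [h5] at this

/-- no invariant set in a hyperplane -/
theorem no_hyperplane {Γ : Subgroup (AffGroup 4)} (hG : Good Γ) (l : E4 →L[ℝ] ℝ) (hl : l ≠ 0) (c : ℝ)
    (w : E4) (hw : ∀ γ ∈ Γ, l (γ w) = c) : False := by
  obtain ⟨φ, hφ, hφs, hφ0, h1⟩ := hG.exists_bump
  have hF : ContDiff ℝ 1 (avg Γ φ fun γ => (γ : AffGroup 4) w) := avg_contDiff hG hφs hφ _
  have hfs : ∀ (x : E4) (g : Γ → E4), (Function.support fun γ : Γ => φ ((γ : AffGroup 4)⁻¹ x) • g γ).Finite := by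
    intro x g
    refine (hG.fin' hφs x).subset fun γ hγ h => hγ ?_
    simp only [h, zero_smul]
  refine principle hG hF ?_ ?_
  · intro γ hγ x
    have := avg_shift Γ φ (fun γ => (γ : AffGroup 4) w) ⟨γ, hγ⟩ x
    simp only at this
    rw [this]
    unfold avg
    have h2 : ∀ δ : Γ, φ ((δ : AffGroup 4)⁻¹ x) • ((⟨γ, hγ⟩ * δ : Γ) : AffGroup 4) w =
        γ.linear (φ ((δ : AffGroup 4)⁻¹ x) • (δ : AffGroup 4) w) + φ ((δ : AffGroup 4)⁻¹ x) • γ 0 := by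
      intro δ
      rw [map_smul, ← smul_add, ← aff_apply]
      rfl
    rw [finsum_congr h2, finsum_add_distrib, aff_apply γ (finsum _)]
    · congr 1
      · rw [map_finsum γ.linear (hfs x _)]
      · rw [← finsum_smul, h1, one_smul]
    · refine (hfs x (fun δ => (δ : AffGroup 4) w)).subset fun δ hδ h => hδ ?_
      simp only at h ⊢
      rw [h, map_zero]
    · exact hfs x _
  · intro x
    have hconst : ∀ x, l (avg Γ φ (fun γ => (γ : AffGroup 4) w) x) = c := by
      intro x
      unfold avg
      rw [map_finsum l (hfs x _)]
      have : ∀ γ : Γ, l (φ ((γ : AffGroup 4)⁻¹ x) • (γ : AffGroup 4) w) = φ ((γ : AffGroup 4)⁻¹ x) * c := by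
        intro γ; rw [map_smul, hw _ γ.2, smul_eq_mul]
      rw [finsum_congr this, ← finsum_mul, h1, one_mul]
    have hd := l.hasFDerivAt.comp x (hF.differentiable one_ne_zero x).hasFDerivAt
    have hd2 : HasFDerivAt (l ∘ avg Γ φ fun γ => (γ : AffGroup 4) w) (0 : E4 →L[ℝ] ℝ) x := by
      have : (l ∘ avg Γ φ fun γ => (γ : AffGroup 4) w) = fun _ => c := funext hconst
      rw [this]; exact hasFDerivAt_const c x
    have h3 := hd.unique hd2
    by_contra hne
    apply hl
    have hu : IsUnit (LinearMap.det (fderiv ℝ (avg Γ φ fun γ => (γ : AffGroup 4) w) x : E4 →ₗ[ℝ] E4)) := by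
      rw [isUnit_iff_ne_zero]; exact hne
    let e := LinearEquiv.ofIsUnitDet (f := (fderiv ℝ (avg Γ φ fun γ => (γ : AffGroup 4) w) x : E4 →ₗ[ℝ] E4)) (v := Pi.basisFun ℝ (Fin 4)) (v' := Pi.basisFun ℝ (Fin 4)) (by
      rw [← LinearMap.det_toMatrix (Pi.basisFun ℝ (Fin 4))] at hu; exact hu)
    ext y
    have h4 : e (e.symm y) = y := e.apply_symm_apply y
    have h5 : (fderiv ℝ (avg Γ φ fun γ => (γ : AffGroup 4) w) x) (e.symm y) = y := h4
    have h6 := congrArg (fun f : E4 →L[ℝ] ℝ => f (e.symm y)) h3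
    simp only [ContinuousLinearMap.comp_apply, h5] at h6
    exact h6

end

noncomputable section
open Set Topology MeasureTheory

/-- future cone -/
def Fut (y : E4) : Prop := Bf y y < 0 ∧ 0 < y 3

def e3 : E4 := ![0, 0, 0, 1]

theorem Bf_e3 (y : E4) : Bf e3 y = - y 3 := by simp [Bf, e3]
theorem Fut_e3 : Fut e3 := by constructor <;> simp [Bf, e3]

def gap (y : E4) : ℝ := y 3 - √(y 0 ^ 2 + y 1 ^ 2 + y 2 ^ 2)

theorem Bf_le_gap {x y : E4} (hx : Bf x x ≤ 0) (hx3 : 0 ≤ x 3) : x 3 * gap y ≤ - Bf x y := by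
  set s := √(y 0 ^ 2 + y 1 ^ 2 + y 2 ^ 2) with hs
  have hs0 : 0 ≤ s := Real.sqrt_nonneg _
  have hs2 : s ^ 2 = y 0 ^ 2 + y 1 ^ 2 + y 2 ^ 2 := Real.sq_sqrt (by positivity)
  have h1 : (x 0 * y 0 + x 1 * y 1 + x 2 * y 2) ^ 2 ≤ (x 3 * s) ^ 2 := by
    have h2 : (x 0 * y 0 + x 1 * y 1 + x 2 * y 2) ^ 2 ≤
        (x 0 ^ 2 + x 1 ^ 2 + x 2 ^ 2) * (y 0 ^ 2 + y 1 ^ 2 + y 2 ^ 2) := by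
      nlinarith [sq_nonneg (x 0 * y 1 - x 1 * y 0), sq_nonneg (x 0 * y 2 - x 2 * y 0),
        sq_nonneg (x 1 * y 2 - x 2 * y 1)]
    have h3 : x 0 ^ 2 + x 1 ^ 2 + x 2 ^ 2 ≤ x 3 ^ 2 := by simp only [Bf] at hx; nlinarith
    rw [mul_pow, hs2]
    refine h2.trans ?_
    gcongr
  have h4 := abs_le.mp (abs_le_of_sq_le_sq h1 (by positivity))
  have h5 : gap y = y 3 - s := rfl
  rw [h5]
  simp only [Bf]
  nlinarith [h4.1, h4.2]

theorem gap_pos {y : E4} (hy : Fut y) : 0 < gap y := by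
  unfold gap
  rw [sub_pos, Real.sqrt_lt' hy.2]
  have := hy.1
  simp only [Bf] at this
  nlinarith

theorem gap_cont : Continuous gap := by unfold gap; fun_prop

theorem Bf_neg_of {x y : E4} (hx : Bf x x ≤ 0) (hx3 : 0 < x 3) (hy : Fut y) : Bf x y < 0 := by
  have := Bf_le_gap (y := y) hx hx3.le
  have := mul_pos hx3 (gap_pos hy)
  linarith

theorem Fut_Bf {x y : E4} (hx : Fut x) (hy : Fut y) : Bf x y < 0 := Bf_neg_of hx.1.le hx.2 hy

theorem Fut.smul {y : E4} (hy : Fut y) {c : ℝ} (hc : 0 < c) : Fut (c • y) := by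
  constructor
  · rw [Bf_smul_left, Bf_smul_right]
    have := mul_pos hc hc
    nlinarith [hy.1]
  · simpa using mul_pos hc hy.2

theorem Fut.add {x y : E4} (hx : Fut x) (hy : Fut y) : Fut (x + y) := by
  constructor
  · rw [Bf_add_left, Bf_add_right, Bf_add_right, Bf_comm y x]
    have := Fut_Bf hx hy
    linarith [hx.1, hy.1]
  · simpa using add_pos hx.2 hy.2

theorem Fut_convex : Convex ℝ {y | Fut y} := by
  rw [convex_iff_forall_pos]
  intro x hx y hy a b ha hb _
  exact (Fut.smul hx ha).add (Fut.smul hy hb)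

theorem Fut_open : IsOpen {y | Fut y} := by
  have h1 : Continuous fun y : E4 => Bf y y := Bf_cont.comp (continuous_id.prodMk continuous_id)
  exact (isOpen_lt h1 continuous_const).inter (isOpen_lt continuous_const (continuous_apply 3))

theorem Fut_or {y : E4} (h : Bf y y < 0) : Fut y ∨ Fut (-y) := by
  have : y 3 ≠ 0 := by
    intro h0
    simp only [Bf, h0] at h
    nlinarith [sq_nonneg (y 0), sq_nonneg (y 1), sq_nonneg (y 2)]
  rcases this.lt_or_gt with h3 | h3
  · right; exact ⟨by rw [Bf_neg_left, Bf_neg_right]; linarith, by simpa using h3⟩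
  · left; exact ⟨h, h3⟩

theorem Fut_of_Bf {x y : E4} (hx : Fut x) (hy : Bf y y < 0) (h : Bf x y < 0) : Fut y := by
  rcases Fut_or hy with h1 | h1
  · exact h1
  · have := Fut_Bf hx h1
    rw [Bf_neg_right] at this
    linarith

/-- orthochronous subgroup -/
def orth (Γ : Subgroup (AffGroup 4)) (hG : Good Γ) : Subgroup (AffGroup 4) where
  carrier := {γ | γ ∈ Γ ∧ ∀ y, Fut y → Fut (γ.linear y)}
  one_mem' := ⟨Γ.one_mem, fun y hy => hy⟩
  mul_mem' := fun {a b} ha hb => ⟨Γ.mul_mem ha.1 hb.1, fun y hy => ha.2 _ (hb.2 y hy)⟩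
  inv_mem' := fun {a} ha => ⟨Γ.inv_mem ha.1, fun y hy => by
    have h1 : Bf (a⁻¹.linear y) (a⁻¹.linear y) < 0 := by
      rw [hG.lor _ (Γ.inv_mem ha.1)]; exact hy.1
    rcases Fut_or h1 with h | h
    · exact h
    · have := ha.2 _ h
      rw [map_neg, lin_inv] at this
      have h3 := this.2
      have := hy.2
      simp at h3
      linarith⟩

theorem orth_good {Γ : Subgroup (AffGroup 4)} (hG : Good Γ) : Good (orth Γ hG) := by
  refine hG.of_two (fun γ h => h.1) ?_
  have key : ∀ γ ∈ Γ, γ ∉ orth Γ hG → ∀ y, Fut y → Fut (-(γ.linear y)) := by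
    intro γ hγ hn y hy
    have : ∃ z, Fut z ∧ ¬ Fut (γ.linear z) := by
      by_contra hcon
      push Not at hcon
      exact hn ⟨hγ, hcon⟩
    obtain ⟨z, hz, hz'⟩ := this
    have h1 : Bf (γ.linear z) (γ.linear z) < 0 := by rw [hG.lor _ hγ]; exact hz.1
    have h2 := (Fut_or h1).resolve_left hz'
    refine Fut_of_Bf h2 ?_ ?_
    · rw [Bf_neg_left, Bf_neg_right, hG.lor _ hγ]; linarith [hy.1]
    · rw [Bf_neg_left, Bf_neg_right, hG.lor _ hγ]; linarith [Fut_Bf hz hy]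
  intro γ hγ δ hδ h1 h2
  refine ⟨Γ.mul_mem hγ hδ, fun y hy => ?_⟩
  have := key γ hγ h1 _ (key δ hδ h2 y hy)
  rw [map_neg, neg_neg] at this
  exact this

structure Good1 (Γ : Subgroup (AffGroup 4)) : Prop extends Good Γ where
  fut : ∀ γ ∈ Γ, ∀ y, Fut y → Fut (γ.linear y)

theorem orth_good1 {Γ : Subgroup (AffGroup 4)} (hG : Good Γ) : Good1 (orth Γ hG) :=
  { orth_good hG with fut := fun _ h => h.2 }

/-- normalized equivariant map to hyperboloid -/
theorem exists_f {Γ : Subgroup (AffGroup 4)} (hG : Good1 Γ) :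
    ∃ f : E4 → E4, ContDiff ℝ 1 f ∧ (∀ x, Fut (f x)) ∧ (∀ x, Bf (f x) (f x) = -1) ∧
      ∀ γ ∈ Γ, ∀ x, f (γ x) = γ.linear (f x) := by
  obtain ⟨φ, hφ, hφs, hφ0, h1⟩ := hG.exists_bump
  set g : E4 → E4 := avg Γ φ fun γ => (γ : AffGroup 4).linear e3 with hg
  have hgd : ContDiff ℝ 1 g := avg_contDiff hG.toGood hφs hφ _
  have hgF : ∀ x, Fut (g x) := fun x =>
    Fut_convex.finsum_mem (fun γ : Γ => hφ0 _) (h1 x) fun γ _ => hG.fut γ γ.2 _ Fut_e3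
  have hge : ∀ γ ∈ Γ, ∀ x, g (γ x) = γ.linear (g x) := by
    intro γ hγ x
    have h2 : g (γ x) = _ := avg_shift Γ φ (fun γ => (γ : AffGroup 4).linear e3) ⟨γ, hγ⟩ x
    rw [h2, hg]
    unfold avg
    have hf : (Function.support fun δ : Γ => φ ((δ : AffGroup 4)⁻¹ x) • (δ : AffGroup 4).linear e3).Finite :=
      (hG.fin' hφs x).subset fun δ hδ => by
        intro h0
        simp [h0] at hδ
    have := (γ.linear : E4 →ₗ[ℝ] E4).toAddMonoidHom.map_finsum hf
    simp only [LinearMap.toAddMonoidHom_coe, LinearEquiv.coe_coe] at this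
    rw [this]
    apply finsum_congr
    intro δ
    rw [map_smul]
    rfl
  have hpos : ∀ x, 0 < - Bf (g x) (g x) := fun x => by linarith [(hgF x).1]
  refine ⟨fun x => (√(- Bf (g x) (g x)))⁻¹ • g x, ?_, ?_, ?_, ?_⟩
  · have hB : ContDiff ℝ 1 fun x => - Bf (g x) (g x) := by
      have h := contDiff_pi.mp hgd
      unfold Bf
      have h0 := h 0; have h1 := h 1; have h2 := h 2; have h3 := h 3
      fun_prop
    refine ContDiff.smul (ContDiff.inv (hB.sqrt fun x => (hpos x).ne') ?_) hgd
    intro x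
    exact (Real.sqrt_pos.mpr (hpos x)).ne'
  · intro x
    exact (hgF x).smul (inv_pos.mpr (Real.sqrt_pos.mpr (hpos x)))
  · intro x
    rw [Bf_smul_left, Bf_smul_right]
    have h2 := Real.sqrt_pos.mpr (hpos x)
    have h3 := Real.sq_sqrt (hpos x).le
    field_simp
    linarith
  · intro γ hγ x
    simp only
    rw [hge γ hγ, hG.lor γ hγ, map_smul]

theorem det_zero_of_orth (A : E4 →L[ℝ] E4) (y : E4) (hy : y ≠ 0) (h : ∀ v, Bf (A v) y = 0) :
    A.det = 0 := by
  by_contra hd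
  have hs : Function.Surjective A := by
    have := LinearMap.isUnit_iff_range_eq_top (A : E4 →ₗ[ℝ] E4) |>.mp
      ((LinearMap.isUnit_iff_isUnit_det _).mpr (isUnit_iff_ne_zero.mpr hd))
    exact LinearMap.range_eq_top.mp this
  apply hy
  apply Bf_nondeg
  intro z
  obtain ⟨v, rfl⟩ := hs z
  rw [Bf_comm]; exact h v

theorem caseA {Γ : Subgroup (AffGroup 4)} (hG : Good1 Γ)
    (hfin : ∀ R : ℝ, {γ : Γ | ((γ : AffGroup 4).linear e3) 3 ≤ R}.Finite) : False := by
  obtain ⟨f, hf, hfF, hf1, hfe⟩ := exists_f hG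
  obtain ⟨K, hK, hc⟩ := hG.cc
  obtain ⟨r, hr⟩ : ∃ r, ∀ x ∈ K, f x 3 ≤ r := by
    have := (hK.image ((continuous_apply 3).comp hf.continuous)).bddAbove
    obtain ⟨r, hr⟩ := this
    exact ⟨r, fun x hx => hr ⟨x, hx, rfl⟩⟩
  set χ : ℝ → ℝ := fun t => Real.smoothTransition (r + 1 - t) with hχ
  have hχd : ContDiff ℝ 1 χ := by
    have : ContDiff ℝ 1 Real.smoothTransition := Real.smoothTransition.contDiff
    exact this.comp (contDiff_const.sub contDiff_id)
  have hχ0 : ∀ t, 0 ≤ χ t := fun t => Real.smoothTransition.nonneg _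
  have hχz : ∀ t, χ t ≠ 0 → t ≤ r + 1 := by
    intro t h
    by_contra hh
    push Not at hh
    exact h (Real.smoothTransition.zero_of_nonpos (by linarith))
  have hχp : ∀ t, t ≤ r → 0 < χ t := fun t ht => Real.smoothTransition.pos_of_pos (by linarith)
  set a : Γ → E4 → ℝ := fun γ y => χ (- Bf ((γ : AffGroup 4).linear e3) y) with ha
  have haz : ∀ γ y, 0 < gap y → a γ y ≠ 0 → ((γ : AffGroup 4).linear e3) 3 ≤ (r + 1) / gap y := by
    intro γ y hy h
    have h1 := hχz _ h
    have h2 := hG.fut γ γ.2 _ Fut_e3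
    have h3 := Bf_le_gap (y := y) h2.1.le h2.2.le
    rw [le_div_iff₀ hy]
    linarith
  have hafin : ∀ y, Fut y → (Function.support fun γ => a γ y).Finite := by
    intro y hy
    exact (hfin ((r + 1) / gap y)).subset fun γ h => haz γ y (gap_pos hy) h
  have had : ∀ γ, ContDiff ℝ 1 (a γ) := by
    intro γ
    refine hχd.comp ?_
    unfold Bf
    fun_prop
  have hlf : ∀ y0, Fut y0 → ∃ s : Set Γ, s.Finite ∧ ∃ U ∈ 𝓝 y0, ∀ y ∈ U, ∀ γ ∉ s, a γ y = 0 := by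
    intro y0 hy0
    have hg := gap_pos hy0
    refine ⟨_, hfin ((|r + 1|) / (gap y0 / 2)), {y | gap y0 / 2 < gap y},
      (isOpen_lt continuous_const gap_cont).mem_nhds (by simp only [mem_ofPred_eq]; linarith), ?_⟩
    intro y hy γ hγ
    by_contra h
    have hy' : gap y0 / 2 < gap y := hy
    have h1 := haz γ y (by linarith) h
    apply hγ
    refine h1.trans ?_
    have : (r + 1) / gap y ≤ |r + 1| / gap y := by
      gcongr
      · linarith
      · exact le_abs_self _
    refine this.trans ?_
    gcongr
  set Num : E4 → E4 := fun y => ∑ᶠ γ : Γ, a γ y • (γ : AffGroup 4) 0 with hNum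
  set Den : E4 → ℝ := fun y => ∑ᶠ γ : Γ, a γ y • (1 : ℝ) with hDen
  have hNumd : ∀ y, Fut y → ContDiffAt ℝ 1 Num y := by
    intro y hy
    obtain ⟨s, hs, U, hU, h⟩ := hlf y hy
    exact lf_contDiffAt a _ y s hs U hU h fun γ => (had γ).contDiffAt
  have hDend : ∀ y, Fut y → ContDiffAt ℝ 1 Den y := by
    intro y hy
    obtain ⟨s, hs, U, hU, h⟩ := hlf y hy
    exact lf_contDiffAt a _ y s hs U hU h fun γ => (had γ).contDiffAt
  have hashift : ∀ δ : Γ, ∀ γ y, a (δ * γ) ((δ : AffGroup 4).linear y) = a γ y := by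
    intro δ γ y
    simp only [ha]
    rw [show ((δ * γ : Γ) : AffGroup 4).linear e3 = (δ : AffGroup 4).linear ((γ : AffGroup 4).linear e3) from rfl,
      hG.lor _ δ.2]
  have hDene : ∀ δ : Γ, ∀ y, Den ((δ : AffGroup 4).linear y) = Den y := by
    intro δ y
    simp only [hDen]
    rw [← finsum_comp_equiv (Equiv.mulLeft δ)]
    apply finsum_congr
    intro γ
    simp only [Equiv.coe_mulLeft, hashift]
  have hNume : ∀ δ : Γ, ∀ y, Fut y → Num ((δ : AffGroup 4).linear y) =
      (δ : AffGroup 4).linear (Num y) + Den y • (δ : AffGroup 4) 0 := by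
    intro δ y hy
    have hs1 : (Function.support fun γ : Γ => a γ y • (γ : AffGroup 4) 0).Finite :=
      (hafin y hy).subset fun γ hγ h0 => by simp [h0] at hγ
    have hs2 : (Function.support fun γ : Γ => a γ y • (δ : AffGroup 4).linear ((γ : AffGroup 4) 0)).Finite :=
      (hafin y hy).subset fun γ hγ h0 => by simp [h0] at hγ
    have hs3 : (Function.support fun γ : Γ => a γ y • (δ : AffGroup 4) 0).Finite :=
      (hafin y hy).subset fun γ hγ h0 => by simp [h0] at hγ
    have h1 := ((δ : AffGroup 4).linear : E4 →ₗ[ℝ] E4).toAddMonoidHom.map_finsum hs1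
    simp only [LinearMap.toAddMonoidHom_coe, LinearEquiv.coe_coe, map_smul] at h1
    have h2 : Den y • (δ : AffGroup 4) 0 = ∑ᶠ γ : Γ, a γ y • (δ : AffGroup 4) 0 := by
      simp only [hDen, smul_eq_mul, mul_one]
      rw [finsum_smul']
      exact hafin y hy
    simp only [hNum]
    rw [h1, h2, ← finsum_add_distrib hs2 hs3, ← finsum_comp_equiv (Equiv.mulLeft δ)]
    apply finsum_congr
    intro γ
    simp only [Equiv.coe_mulLeft, hashift]
    rw [← smul_add, ← aff_apply]
    rfl
  have hDenpos : ∀ x, 0 < Den (f x) := by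
    intro x
    obtain ⟨γ, hγ, hx⟩ := hc x
    refine finsum_pos (fun γ => by simpa using hχ0 _) ⟨⟨γ⁻¹, Γ.inv_mem hγ⟩, ?_⟩ ?_
    · simp only [smul_eq_mul, mul_one]
      apply hχp
      have : f x = γ⁻¹.linear (f (γ x)) := by
        rw [← hfe _ (Γ.inv_mem hγ), inv_ap]
      rw [this, hG.lor _ (Γ.inv_mem hγ), Bf_e3, neg_neg]
      exact hr _ hx
    · have := hafin _ (hfF x)
      simp only [smul_eq_mul, mul_one]
      exact this
  set F : E4 → E4 := fun x => (Den (f x))⁻¹ • Num (f x) with hF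
  have hh : ∀ x, ContDiffAt ℝ 1 (fun y => (Den y)⁻¹ • Num y) (f x) := fun x =>
    ((hDend _ (hfF x)).inv (hDenpos x).ne').smul (hNumd _ (hfF x))
  have hFd : ContDiff ℝ 1 F := by
    rw [contDiff_iff_contDiffAt]
    intro x
    exact (hh x).comp x hf.contDiffAt
  refine principle hG.toGood hFd ?_ ?_
  · intro γ hγ x
    simp only [hF]
    rw [hfe γ hγ, hDene ⟨γ, hγ⟩, hNume ⟨γ, hγ⟩ _ (hfF x), aff_apply γ ((Den (f x))⁻¹ • Num (f x)), map_smul, smul_add, smul_smul,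
      inv_mul_cancel₀ (hDenpos x).ne', one_smul]
  · intro x
    have hfx : HasFDerivAt f (fderiv ℝ f x) x := (hf.differentiable one_ne_zero x).hasFDerivAt
    have hhx := ((hh x).differentiableAt one_ne_zero).hasFDerivAt
    have h1 : HasFDerivAt F _ x := hhx.comp x hfx
    rw [h1.fderiv]
    have h2 : (fderiv ℝ f x).det = 0 := by
      refine det_zero_of_orth _ (f x) ?_ ?_
      · intro h0
        have := hf1 x
        rw [h0, Bf_zero_left] at this
        norm_num at this
      · intro v
        have hp : ∀ i, HasFDerivAt (fun z => f z i) _ x := fun i => hasFDerivAt_pi'.mp hfx i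
        have hB : HasFDerivAt (fun x => Bf (f x) (f x)) _ x :=
          ((((hp 0).mul (hp 0)).add ((hp 1).mul (hp 1))).add ((hp 2).mul (hp 2))).sub ((hp 3).mul (hp 3))
        have hB2 : HasFDerivAt (fun x => Bf (f x) (f x)) (0 : E4 →L[ℝ] ℝ) x := by
          simp_rw [hf1]; exact hasFDerivAt_const _ _
        have := congrArg (fun T : E4 →L[ℝ] ℝ => T v) (hB.unique hB2)
        simp at this
        simp only [Bf]
        linarith
    have h3 : ∀ A B : E4 →L[ℝ] E4, (A.comp B).det = A.det * B.det := fun A B => LinearMap.det_comp _ _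
    rw [h3, h2, mul_zero]

end

noncomputable section
open Set Topology

theorem nr_inv_bound {R : Type*} [NormedRing R] [NormOneClass R] {g h : R} (hgh : h * g = 1)
    (hg : ‖g - 1‖ ≤ 1 / 2) : ‖h‖ ≤ 2 := by
  have h1 : h = 1 - h * (g - 1) := by rw [mul_sub, hgh]; abel_nf; simp
  have h2 : ‖h‖ ≤ 1 + ‖h‖ * ‖g - 1‖ := by
    calc ‖h‖ = ‖1 - h * (g - 1)‖ := by rw [← h1]
      _ ≤ ‖(1 : R)‖ + ‖h * (g - 1)‖ := norm_sub_le _ _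
      _ ≤ 1 + ‖h‖ * ‖g - 1‖ := by rw [norm_one]; gcongr; exact norm_mul_le _ _
  have := norm_nonneg h
  nlinarith

theorem nr_comm_bound {R : Type*} [NormedRing R] [NormOneClass R] {g h g' h' : R} (hg : g' * g = 1)
    (hh : h' * h = 1) (hg1 : g * g' = 1) (hh1 : h * h' = 1) (hgb : ‖g - 1‖ ≤ 1 / 16) (hhb : ‖h - 1‖ ≤ 1 / 16) :
    ‖g * h * g' * h' - 1‖ ≤ 1 / 2 * ‖h - 1‖ := by
  have hg2 := nr_inv_bound hg (by linarith)
  have hh2 := nr_inv_bound hh (by linarith)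
  have e : g * h * g' * h' - 1 = ((g - 1) * (h - 1) - (h - 1) * (g - 1)) * (g' * h') := by
    have e1 : h * g * (g' * h') = 1 := by
      rw [mul_assoc, ← mul_assoc g, hg1, one_mul, hh1]
    have e2 : (g - 1) * (h - 1) - (h - 1) * (g - 1) = g * h - h * g := by noncomm_ring
    rw [e2, sub_mul, e1]; noncomm_ring
  rw [e]
  have n1 := norm_nonneg (g - 1)
  have n2 := norm_nonneg (h - 1)
  calc _ ≤ ‖(g - 1) * (h - 1) - (h - 1) * (g - 1)‖ * ‖g' * h'‖ := norm_mul_le _ _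
    _ ≤ (‖g - 1‖ * ‖h - 1‖ + ‖h - 1‖ * ‖g - 1‖) * (2 * 2) := by
      gcongr
      · exact (norm_sub_le _ _).trans (add_le_add (norm_mul_le _ _) (norm_mul_le _ _))
      · exact (norm_mul_le _ _).trans (mul_le_mul hg2 hh2 (norm_nonneg _) (by norm_num))
    _ ≤ 1 / 2 * ‖h - 1‖ := by nlinarith

def Lc (γ : AffGroup 4) : E4 →L[ℝ] E4 := LinearMap.toContinuousLinearMap (γ.linear : E4 →ₗ[ℝ] E4)

theorem Lc_ap (γ : AffGroup 4) (x : E4) : Lc γ x = γ.linear x := rfl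
theorem Lc_mul (γ δ : AffGroup 4) : Lc (γ * δ) = Lc γ * Lc δ := rfl
theorem Lc_one : Lc 1 = 1 := rfl
theorem Lc_inv_mul (γ : AffGroup 4) : Lc γ⁻¹ * Lc γ = 1 := by rw [← Lc_mul, inv_mul_cancel, Lc_one]
theorem Lc_mul_inv (γ : AffGroup 4) : Lc γ * Lc γ⁻¹ = 1 := by rw [← Lc_mul, mul_inv_cancel, Lc_one]

/-- homogeneous embedding -/
def iot (r : ℝ) (γ : AffGroup 4) : (E4 × ℝ) →L[ℝ] (E4 × ℝ) :=
  ((Lc γ).comp (ContinuousLinearMap.fst ℝ E4 ℝ) +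
    (ContinuousLinearMap.snd ℝ E4 ℝ).smulRight (r • γ 0)).prod (ContinuousLinearMap.snd ℝ E4 ℝ)

theorem iot_ap (r : ℝ) (γ : AffGroup 4) (p : E4 × ℝ) : iot r γ p = (γ.linear p.1 + p.2 • r • γ 0, p.2) := rfl

theorem iot_mul (r : ℝ) (γ δ : AffGroup 4) : iot r (γ * δ) = iot r γ * iot r δ := by
  refine ContinuousLinearMap.ext fun p => ?_
  show iot r (γ * δ) p = iot r γ (iot r δ p)
  simp only [iot_ap, mul_lin, mul_ap]
  rw [aff_apply γ (δ 0)]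
  simp only [map_add, map_smul, smul_add]
  rw [add_assoc]

theorem iot_one (r : ℝ) : iot r 1 = 1 := by
  refine ContinuousLinearMap.ext fun p => ?_
  show iot r 1 p = p
  simp [iot_ap, one_lin, one_ap]

theorem iot_inj {r : ℝ} (hr : r ≠ 0) {γ : AffGroup 4} (h : iot r γ = 1) : γ = 1 := by
  have h1 : ∀ p, iot r γ p = p := fun p => by rw [h]; rfl
  apply aff_ext
  intro x
  have h2 := congrArg Prod.fst (h1 (x, 0))
  have h3 := congrArg Prod.fst (h1 (0, 1))
  simp [iot_ap] at h2 h3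
  rw [aff_apply, h2, one_ap]
  simp [hr] at h3
  rw [h3, add_zero]

theorem iot_norm {r : ℝ} (hr : 0 ≤ r) (γ : AffGroup 4) : ‖iot r γ - 1‖ ≤ ‖Lc γ - 1‖ + r * ‖γ 0‖ := by
  refine ContinuousLinearMap.opNorm_le_bound _ (by positivity) fun p => ?_
  have : (iot r γ - 1) p = ((Lc γ - 1) p.1 + p.2 • r • γ 0, 0) := by
    show iot r γ p - p = _
    rw [iot_ap]
    ext1
    · show γ.linear p.1 + p.2 • r • γ 0 - p.1 = (γ.linear p.1 - p.1) + p.2 • r • γ 0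
      abel
    · simp
  rw [this, Prod.norm_def]
  simp only [norm_zero]
  refine max_le ?_ (by positivity)
  refine (norm_add_le _ _).trans ?_
  rw [norm_smul, norm_smul, Real.norm_of_nonneg hr, add_mul]
  have h1 := (Lc γ - 1).le_opNorm p.1
  have h2 := norm_fst_le p
  have h3 := norm_snd_le p
  have h4 := norm_nonneg (Lc γ - 1)
  have h5 := norm_nonneg (γ 0)
  have : ‖Lc γ - 1‖ * ‖p.1‖ ≤ ‖Lc γ - 1‖ * ‖p‖ := by gcongr
  have : ‖p.2‖ * (r * ‖γ 0‖) ≤ ‖p‖ * (r * ‖γ 0‖) := by gcongr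
  linarith

theorem iot_lower {r : ℝ} (hr : 0 ≤ r) (γ : AffGroup 4) : r * ‖γ 0‖ ≤ ‖iot r γ - 1‖ := by
  have h := (iot r γ - 1).le_opNorm ((0 : E4), (1 : ℝ))
  have h1 : (iot r γ - 1) ((0 : E4), (1 : ℝ)) = (r • γ 0, 0) := by
    show iot r γ ((0 : E4), (1 : ℝ)) - ((0 : E4), (1 : ℝ)) = _
    rw [iot_ap]; simp
  rw [h1] at h
  simp [Prod.norm_def] at h
  rw [norm_smul, Real.norm_of_nonneg hr] at h
  exact h

theorem zass {Γ : Subgroup (AffGroup 4)} (hG : Good Γ) (S : Finset (AffGroup 4)) (hS : ∀ s ∈ S, s ∈ Γ)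
    (hSn : ∀ s ∈ S, ‖Lc s - 1‖ ≤ 1 / 32) (h1 : ∃ s ∈ S, s ≠ 1) :
    ∃ z ∈ Γ, z ≠ 1 ∧ ∀ s ∈ S, s * z = z * s := by
  obtain ⟨r, hr, hrS⟩ : ∃ r : ℝ, 0 < r ∧ ∀ s ∈ S, r * ‖s 0‖ ≤ 1 / 32 := by
    refine ⟨1 / (32 * (1 + ∑ s ∈ S, ‖s 0‖)), ?_, ?_⟩
    · have : 0 ≤ ∑ s ∈ S, ‖s 0‖ := Finset.sum_nonneg fun s _ => norm_nonneg _
      positivity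
    · intro s hs
      have h2 : ‖s 0‖ ≤ ∑ s ∈ S, ‖s 0‖ := Finset.single_le_sum (f := fun s : AffGroup 4 => ‖s 0‖)
        (fun s _ => norm_nonneg _) hs
      have h3 := norm_nonneg (s 0)
      rw [div_mul_eq_mul_div, div_le_div_iff₀ (by positivity) (by norm_num)]
      linarith
  set W : Set (AffGroup 4) := {γ | γ ∈ Γ ∧ γ ≠ 1 ∧ ‖iot r γ - 1‖ ≤ 1 / 16} with hW
  have hWfin : W.Finite := by
    refine (hG.pd (Metric.closedBall 0 (1 / r)) (isCompact_closedBall _ _)).subset ?_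
    rintro γ ⟨hγ, _, hn⟩
    refine ⟨hγ, γ 0, ⟨0, by simp; positivity, rfl⟩, ?_⟩
    have := (iot_lower hr.le γ).trans hn
    rw [Metric.mem_closedBall, dist_zero_right, le_div_iff₀ hr]
    linarith
  have hmem : ∀ s ∈ S, ‖iot r s - 1‖ ≤ 1 / 16 := by
    intro s hs
    have := iot_norm hr.le s
    linarith [hSn s hs, hrS s hs]
  obtain ⟨s1, hs1, hs1n⟩ := h1
  obtain ⟨z, hz, hmin⟩ := hWfin.exists_minimalFor (fun γ => ‖iot r γ - 1‖) W ⟨s1, hS _ hs1, hs1n, hmem _ hs1⟩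
  refine ⟨z, hz.1, hz.2.1, fun s hs => ?_⟩
  by_contra hne
  have hc : s * z * s⁻¹ * z⁻¹ ≠ 1 := by
    intro h
    apply hne
    rw [mul_inv_eq_one, mul_inv_eq_iff_eq_mul] at h
    exact h
  have hinv : ∀ g, iot r g⁻¹ * iot r g = 1 := fun g => by rw [← iot_mul, inv_mul_cancel, iot_one]
  have hinv' : ∀ g, iot r g * iot r g⁻¹ = 1 := fun g => by rw [← iot_mul, mul_inv_cancel, iot_one]
  have hb := nr_comm_bound (hinv s) (hinv z) (hinv' s) (hinv' z) (hmem s hs) hz.2.2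
  rw [← iot_mul, ← iot_mul, ← iot_mul] at hb
  have hzpos : 0 < ‖iot r z - 1‖ := by
    rw [norm_pos_iff, sub_ne_zero]
    exact fun h => hz.2.1 (iot_inj hr.ne' h)
  have hmemc : s * z * s⁻¹ * z⁻¹ ∈ W :=
    ⟨Γ.mul_mem (Γ.mul_mem (Γ.mul_mem (hS s hs) hz.1) (Γ.inv_mem (hS s hs))) (Γ.inv_mem hz.1), hc,
      by linarith [hz.2.2]⟩
  have := hmin hmemc (by simp only; linarith)
  simp only at this
  linarith

theorem lor_entry {Γ : Subgroup (AffGroup 4)} (hG : Good1 Γ) {γ} (hγ : γ ∈ Γ) {R : ℝ}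
    (h : (γ.linear e3) 3 ≤ R) : ‖Lc γ‖ ≤ 4 * (1 + R) := by
  have hf := hG.fut γ hγ _ Fut_e3
  have hR : 0 < R := hf.2.trans_le h
  set b : Fin 4 → E4 := fun i => Pi.single i 1 with hb
  have hi := hG.fut _ (Γ.inv_mem hγ) _ Fut_e3
  have hi3 : (γ⁻¹.linear e3) 3 = (γ.linear e3) 3 := by
    have h1 := hG.inv_lor hγ e3 e3
    rw [Bf_comm, Bf_e3, Bf_e3] at h1
    linarith
  have hiB : Bf (γ⁻¹.linear e3) (γ⁻¹.linear e3) = -1 := by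
    rw [hG.lor _ (Γ.inv_mem hγ), Bf_e3]; simp [e3]
  -- third row
  have hrow : ∀ i, |(γ.linear (b i)) 3| ≤ R := by
    intro i
    have h1 := hG.inv_lor hγ (b i) e3
    rw [Bf_comm, Bf_e3] at h1
    set y := γ⁻¹.linear e3
    simp only [Bf] at hiB
    have hy3 : y 3 ≤ R := by rw [hi3]; exact h
    have h2 : (γ.linear (b i) 3) ^ 2 ≤ R ^ 2 := by
      rw [← neg_sq, h1]
      have h3 : y 3 ^ 2 ≤ R ^ 2 := pow_le_pow_left₀ hi.2.le hy3 2
      fin_cases i <;> simp [Bf, hb, Pi.single_apply] <;> nlinarith [sq_nonneg (y 0), sq_nonneg (y 1), sq_nonneg (y 2)]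
    exact abs_le_of_sq_le_sq h2 hR.le
  have hent : ∀ i j, |(γ.linear (b i)) j| ≤ 1 + R := by
    intro i j
    have h1 : Bf (γ.linear (b i)) (γ.linear (b i)) ≤ 1 := by
      rw [hG.lor γ hγ]
      fin_cases i <;> simp [Bf, hb]
    have h2 := hrow i
    set y := γ.linear (b i)
    have h3 := sq_le_sq' (abs_le.mp h2).1 (abs_le.mp h2).2
    simp only [Bf] at h1
    refine abs_le_of_sq_le_sq ?_ (by positivity)
    fin_cases j <;> simp <;> nlinarith [sq_nonneg (y 0), sq_nonneg (y 1), sq_nonneg (y 2)]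
  refine ContinuousLinearMap.opNorm_le_bound _ (by positivity) fun x => ?_
  rw [pi_norm_le_iff_of_nonneg (by positivity)]
  intro j
  have hx : x = ∑ i, x i • b i := by
    ext k; simp [hb, Finset.sum_apply, Pi.single_apply]
  have : (Lc γ x) j = ∑ i, x i * (γ.linear (b i)) j := by
    conv_lhs => rw [hx]
    simp [Lc_ap, map_sum, Finset.sum_apply]
  rw [this]
  calc _ ≤ ∑ i, ‖x i * (γ.linear (b i)) j‖ := norm_sum_le _ _
    _ ≤ ∑ i : Fin 4, ‖x‖ * (1 + R) := by
      apply Finset.sum_le_sum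
      intro i _
      rw [norm_mul]
      exact mul_le_mul (norm_le_pi_norm x i) (hent i j) (norm_nonneg _) (norm_nonneg _)
    _ = 4 * (1 + R) * ‖x‖ := by simp; ring

theorem lor_inv3 {Γ : Subgroup (AffGroup 4)} (hG : Good1 Γ) {γ} (hγ : γ ∈ Γ) :
    (γ⁻¹.linear e3) 3 = (γ.linear e3) 3 := by
  have h1 := hG.inv_lor hγ e3 e3
  rw [Bf_comm, Bf_e3, Bf_e3] at h1
  linarith

theorem exists_small {Γ : Subgroup (AffGroup 4)} (hG : Good1 Γ) {ε : ℝ} (hε : 0 < ε) :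
    ∃ γ ∈ Γ, γ ≠ 1 ∧ ‖Lc γ - 1‖ ≤ ε := by
  by_contra hcon
  push Not at hcon
  refine caseA hG fun R => ?_
  by_contra hinf
  set C := 4 * (1 + R)
  set T := {γ : Γ | ((γ : AffGroup 4).linear e3) 3 ≤ R}
  have hTi : T.Infinite := hinf
  obtain ⟨γ0, hγ0⟩ := hTi.nonempty
  have hC : 0 < C := by
    have h1 := (hG.fut γ0 γ0.2 _ Fut_e3).2
    have h2 : ((γ0 : AffGroup 4).linear e3) 3 ≤ R := hγ0
    simp only [C]; linarith
  have hcomp : IsCompact (Metric.closedBall (0 : E4 →L[ℝ] E4) C) := by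
    have : ProperSpace (E4 →L[ℝ] E4) := FiniteDimensional.proper ℝ _
    exact isCompact_closedBall _ _
  have hδ : 0 < ε / C / 2 := by positivity
  obtain ⟨t, htf, ht⟩ := Metric.totallyBounded_iff.mp hcomp.totallyBounded _ hδ
  have hmem : ∀ γ ∈ T, ∃ y ∈ t, dist (Lc (γ : AffGroup 4)) y < ε / C / 2 := by
    intro γ hγ
    have h1 : Lc (γ : AffGroup 4) ∈ Metric.closedBall (0 : E4 →L[ℝ] E4) C := by
      rw [Metric.mem_closedBall, dist_zero_right]; exact lor_entry hG γ.2 hγ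
    have := ht h1
    simpa using this
  choose! f hf1 hf2 using hmem
  obtain ⟨y, hy, γ1, h1, γ2, h2, hne, h12⟩ :
      ∃ y ∈ t, ∃ γ1 ∈ T, ∃ γ2 ∈ T, γ1 ≠ γ2 ∧ f γ1 = f γ2 := by
    obtain ⟨γ1, h1, γ2, h2, hne, h12⟩ := hTi.exists_ne_map_eq_of_mapsTo (f := f) (t := t) hf1 htf
    exact ⟨f γ1, hf1 _ h1, γ1, h1, γ2, h2, hne, h12⟩
  have hd : ‖Lc (γ2 : AffGroup 4) - Lc (γ1 : AffGroup 4)‖ < ε / C := by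
    rw [← dist_eq_norm]
    have h3 := hf2 _ h1
    have h4 := hf2 _ h2
    rw [← h12] at h4
    have := dist_triangle_right (Lc (γ2 : AffGroup 4)) (Lc (γ1 : AffGroup 4)) (f γ1)
    linarith
  have hlt := hcon ((γ1 : AffGroup 4)⁻¹ * γ2) (Γ.mul_mem (Γ.inv_mem γ1.2) γ2.2) (by
    intro h
    apply hne
    rw [inv_mul_eq_one] at h
    exact Subtype.ext h)
  have e : Lc ((γ1 : AffGroup 4)⁻¹ * γ2) - 1 = Lc (γ1 : AffGroup 4)⁻¹ * (Lc (γ2 : AffGroup 4) - Lc (γ1 : AffGroup 4)) := by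
    rw [mul_sub, Lc_inv_mul, Lc_mul]
  rw [e] at hlt
  have hb : ‖Lc (γ1 : AffGroup 4)⁻¹‖ ≤ C := lor_entry hG (Γ.inv_mem γ1.2) (by rw [lor_inv3 hG γ1.2]; exact h1)
  have h5 := norm_mul_le (Lc (γ1 : AffGroup 4)⁻¹) (Lc (γ2 : AffGroup 4) - Lc (γ1 : AffGroup 4))
  have h6 : ‖Lc (γ1 : AffGroup 4)⁻¹‖ * ‖Lc (γ2 : AffGroup 4) - Lc (γ1 : AffGroup 4)‖ ≤ C * (ε / C) := by
    gcongr
  rw [mul_div_cancel₀ _ hC.ne'] at h6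
  linarith

end

noncomputable section
open Set Topology Filter

/-- `Bf y` as a linear functional -/
def Bl (y : E4) : E4 →ₗ[ℝ] ℝ where
  toFun := Bf y
  map_add' := Bf_add_right y
  map_smul' := fun c x => Bf_smul_right c y x

theorem Bl_ap (y x : E4) : Bl y x = Bf y x := rfl

theorem det_adj (D D' : E4 →ₗ[ℝ] E4) (h : ∀ u v, Bf (D u) v = Bf u (D' v)) :
    LinearMap.det D = LinearMap.det D' := by
  let M := LinearMap.toMatrix' D
  let M' := LinearMap.toMatrix' D'
  let J : Matrix (Fin 4) (Fin 4) ℝ := Matrix.diagonal ![1, 1, 1, -1]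
  have hB : ∀ x y : E4, Bf x y = x ⬝ᵥ (J.mulVec y) := by
    intro x y
    simp [Bf, J, dotProduct, Fin.sum_univ_four, Matrix.mulVec_diagonal]
    ring
  have hM : ∀ x : E4, D x = M.mulVec x := by
    intro x; simp [M, LinearMap.toMatrix'_mulVec]
  have hM' : ∀ x : E4, D' x = M'.mulVec x := by
    intro x; simp [M', LinearMap.toMatrix'_mulVec]
  have h : M.transpose * J = J * M' := by
    apply Matrix.ext_iff_mulVec.mpr
    intro y
    rw [← Matrix.mulVec_mulVec, ← Matrix.mulVec_mulVec]
    apply dotProduct_eq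
    intro x
    rw [dotProduct_comm, dotProduct_comm _ x, Matrix.mulVec_transpose, dotProduct_comm, ← Matrix.dotProduct_mulVec, dotProduct_comm] 
    have := h x y
    rw [hB, hB, hM, hM'] at this
    exact this
  have := congrArg Matrix.det h
  rw [Matrix.det_mul, Matrix.det_mul, Matrix.det_transpose] at this
  have hJ : J.det ≠ 0 := by simp [J, Matrix.det_diagonal, Fin.prod_univ_four]
  have h3 : M.det = M'.det := by
    apply mul_right_cancel₀ hJ
    linarith
  rw [LinearMap.det_toMatrix', LinearMap.det_toMatrix'] at h3
  exact h3

/-- skew operator with a timelike kernel vector has another kernel vector -/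
theorem skew_ker (K : E4 →ₗ[ℝ] E4) (hK : ∀ u v, Bf (K u) v = - Bf u (K v)) {y : E4} (hy : Bf y y ≠ 0)
    (hKy : K y = 0) : ∃ w, w ≠ 0 ∧ Bf y w = 0 ∧ K w = 0 := by
  let P : E4 →ₗ[ℝ] E4 := (Bl y).smulRight ((Bf y y)⁻¹ • y)
  have hP : ∀ x, P x = Bf y x • (Bf y y)⁻¹ • y := fun x => rfl
  let D := K + P
  let D' := -K + P
  have hd1 : LinearMap.det D = LinearMap.det D' := by
    apply det_adj
    intro u v
    show Bf (K u + P u) v = Bf u (-K v + P v)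
    rw [Bf_add_left, Bf_add_right, Bf_neg_right, hK, hP, hP]
    simp only [Bf_smul_left, Bf_smul_right, Bf_comm u y]
    ring
  let T : E4 →ₗ[ℝ] E4 := LinearMap.transvection ((-2 * (Bf y y)⁻¹) • Bl y) y
  have hT : LinearMap.det T = -1 := by
    rw [LinearMap.transvection.det]
    simp only [LinearMap.smul_apply, Bl_ap, smul_eq_mul]
    field_simp; norm_num
  have hD' : D' = (-1 : ℝ) • (D ∘ₗ T) := by
    refine LinearMap.ext fun x => ?_
    show -K x + P x = (-1 : ℝ) • (K (T x) + P (T x))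
    have : T x = x + (-2 * (Bf y y)⁻¹ * Bf y x) • y := by
      simp only [T, LinearMap.transvection.apply, LinearMap.smul_apply, Bl_ap, smul_eq_mul]
    rw [this, map_add, map_smul, hKy, hP, hP, Bf_add_right, Bf_smul_right]
    simp only [smul_smul, smul_zero, add_zero, smul_add]
    have e : (Bf y x + -2 * (Bf y y)⁻¹ * Bf y x * Bf y y) * (Bf y y)⁻¹ = - (Bf y x * (Bf y y)⁻¹) := by
      field_simp; ring
    rw [← mul_assoc]
    have e2 : -1 * (Bf y x + -2 * (Bf y y)⁻¹ * Bf y x * Bf y y) * (Bf y y)⁻¹ = (Bf y x * (Bf y y)⁻¹) := by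
      rw [mul_assoc, e]; ring
    rw [e2]; module
  have hd2 : LinearMap.det D' = - LinearMap.det D := by
    rw [hD', LinearMap.det_smul, LinearMap.det_comp, hT]
    simp
    norm_num
  have hd0 : LinearMap.det D = 0 := by linarith
  obtain ⟨w, hw, hw0⟩ : ∃ w, w ≠ 0 ∧ D w = 0 := by
    have := LinearMap.bot_lt_ker_of_det_eq_zero hd0
    obtain ⟨w, hw, hw0⟩ := SetLike.exists_of_lt this
    exact ⟨w, by simpa using hw0, hw⟩
  have h1 : K w + P w = 0 := hw0
  have h2 : Bf y w = 0 := by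
    have := congrArg (Bf y) h1
    rw [Bf_add_right, Bf_zero_right, Bf_comm y (K w), hK, hKy, Bf_zero_right, hP] at this
    simp only [Bf_smul_right] at this
    rw [inv_mul_cancel₀ hy] at this
    linarith
  refine ⟨w, hw, h2, ?_⟩
  rw [hP, h2] at h1
  simpa using h1

theorem null_par {x y : E4} (hx : Bf x x = 0) (hy : Bf y y = 0) (hxy : Bf x y = 0) (h0 : y ≠ 0) :
    ∃ c : ℝ, x = c • y := by
  have h3 : y 3 ≠ 0 := by
    intro h3
    apply h0
    simp only [Bf, h3] at hy
    ext i
    fin_cases i <;> simp <;> nlinarith [sq_nonneg (y 0), sq_nonneg (y 1), sq_nonneg (y 2)]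
  refine ⟨x 3 / y 3, ?_⟩
  set c := x 3 / y 3
  have hc : x 3 = c * y 3 := by simp only [c]; field_simp
  have h4 : Bf (x - c • y) (x - c • y) = 0 := by
    simp only [Bf_sub_left, Bf_sub_right, Bf_smul_left, Bf_smul_right, hx, hy, hxy, Bf_comm y x]; simp
  simp only [Bf, Pi.sub_apply, Pi.smul_apply, smul_eq_mul, hc, sub_self] at h4
  have a0 := sq_nonneg (x 0 - c * y 0)
  have a1 := sq_nonneg (x 1 - c * y 1)
  have a2 := sq_nonneg (x 2 - c * y 2)
  have b0 : x 0 - c * y 0 = 0 := by nlinarith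
  have b1 : x 1 - c * y 1 = 0 := by nlinarith
  have b2 : x 2 - c * y 2 = 0 := by nlinarith
  ext i
  fin_cases i <;> simp <;> linarith

theorem orth_pos {y w : E4} (hy : Bf y y < 0) (hw : w ≠ 0) (h : Bf y w = 0) : 0 < Bf w w := by
  wlog hyF : Fut y generalizing y
  · exact this (y := -y) (by rw [Bf_neg_left, Bf_neg_right]; linarith) (by rw [Bf_neg_left, h, neg_zero])
      ((Fut_or hy).resolve_left hyF)
  by_contra hn
  push Not at hn
  rcases lt_trichotomy (w 3) 0 with h3 | h3 | h3
  · have := Bf_neg_of (x := -w) (by rw [Bf_neg_left, Bf_neg_right]; linarith) (by simpa using h3) hyF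
    rw [Bf_neg_left, Bf_comm, h] at this
    simp at this
  · apply hw
    simp only [Bf, h3] at hn
    ext i
    fin_cases i <;> simp [h3] <;> nlinarith [sq_nonneg (w 0), sq_nonneg (w 1), sq_nonneg (w 2)]
  · have := Bf_neg_of hn h3 hyF
    rw [Bf_comm, h] at this
    simp at this

theorem causal_norm {y : E4} (hy : Bf y y ≤ 0) (h3 : 0 ≤ y 3) : ‖y‖ ≤ y 3 := by
  rw [pi_norm_le_iff_of_nonneg h3]
  intro i
  simp only [Bf] at hy
  refine abs_le_of_sq_le_sq ?_ h3
  fin_cases i <;> simp <;> nlinarith [sq_nonneg (y 0), sq_nonneg (y 1), sq_nonneg (y 2)]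

theorem pow_lin (γ : AffGroup 4) (n : ℕ) (x : E4) : (γ ^ (n + 1)).linear x = γ.linear ((γ ^ n).linear x) := by
  rw [pow_succ', mul_lin]

theorem exists_null_fixed {Γ : Subgroup (AffGroup 4)} (hG : Good1 Γ) {γ} (hγ : γ ∈ Γ) :
    ∃ n : E4, n ≠ 0 ∧ Bf n n = 0 ∧ ∃ c : ℝ, γ.linear (γ.linear n) = c • n := by
  set y : ℕ → E4 := fun n => (γ ^ n).linear e3 with hy
  have hys : ∀ n, y (n + 1) = γ.linear (y n) := fun n => pow_lin γ n e3
  have hyF : ∀ n, Fut (y n) := fun n => hG.fut _ (Γ.pow_mem hγ n) _ Fut_e3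
  have hyB : ∀ n, Bf (y n) (y n) = -1 := fun n => by
    rw [hy]; simp only; rw [hG.lor _ (Γ.pow_mem hγ n), Bf_e3]; simp [e3]
  have hy1 : ∀ n, 1 ≤ y n 3 := by
    intro n
    have h1 := hyB n
    have h2 := (hyF n).2
    simp only [Bf] at h1
    nlinarith [sq_nonneg (y n 0), sq_nonneg (y n 1), sq_nonneg (y n 2)]
  have hLcont : Continuous fun x : E4 => γ.linear x := (Lc γ).continuous
  by_cases hb : ∃ R, ∀ n, y n 3 ≤ R
  · obtain ⟨R, hR⟩ := hb
    have hR0 : 0 < R := by linarith [hR 0, hy1 0]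
    set w : ℕ → E4 := fun N => ((N : ℝ) + 1)⁻¹ • ∑ n ∈ Finset.range (N + 1), y n with hw
    have hN : ∀ N : ℕ, (0 : ℝ) < (N : ℝ) + 1 := fun N => by positivity
    have hwF : ∀ N, Fut (w N) := by
      intro N
      refine Fut.smul ?_ (inv_pos.mpr (hN N))
      induction N with
      | zero => simpa using hyF 0
      | succ k ih => rw [Finset.sum_range_succ]; exact ih.add (hyF _)
    have hw3 : ∀ N, w N 3 ∈ Icc 1 R := by
      intro N
      simp only [hw, Pi.smul_apply, Finset.sum_apply, smul_eq_mul]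
      have h1 : ∑ n ∈ Finset.range (N + 1), y n 3 ≤ ∑ n ∈ Finset.range (N + 1), R :=
        Finset.sum_le_sum fun n _ => hR n
      have h2 : ∑ n ∈ Finset.range (N + 1), (1 : ℝ) ≤ ∑ n ∈ Finset.range (N + 1), y n 3 :=
        Finset.sum_le_sum fun n _ => hy1 n
      simp at h1 h2
      rw [mem_Icc, ← div_eq_inv_mul, le_div_iff₀ (hN N), div_le_iff₀ (hN N)]
      constructor <;> linarith
    have hwb : ∀ N, w N ∈ Metric.closedBall (0 : E4) R := by
      intro N
      rw [Metric.mem_closedBall, dist_zero_right]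
      exact (causal_norm (hwF N).1.le (hwF N).2.le).trans (hw3 N).2
    obtain ⟨v, _, φ, hφ, hv⟩ := (isCompact_closedBall (0 : E4) R).tendsto_subseq hwb
    have hAw : ∀ N, γ.linear (w N) - w N = ((N : ℝ) + 1)⁻¹ • (y (N + 1) - y 0) := by
      intro N
      simp only [hw, map_smul, ← smul_sub]
      congr 1
      rw [map_sum, ← Finset.sum_sub_distrib, ← Finset.sum_range_sub]
      simp only [hys]
    have hlim1 : Tendsto (fun k => γ.linear (w (φ k)) - w (φ k)) atTop (𝓝 (γ.linear v - v)) :=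
      ((hLcont.tendsto v).comp hv).sub hv
    have hlim2 : Tendsto (fun N => γ.linear (w N) - w N) atTop (𝓝 0) := by
      rw [tendsto_zero_iff_norm_tendsto_zero]
      have h0 : Tendsto (fun N : ℕ => (2 * R) * (1 / ((N : ℝ) + 1))) atTop (𝓝 ((2 * R) * 0)) :=
        tendsto_one_div_add_atTop_nhds_zero_nat.const_mul _
      rw [mul_zero] at h0
      refine squeeze_zero (fun N => norm_nonneg _) (fun N => ?_) h0
      rw [hAw, norm_smul, norm_inv, Real.norm_of_nonneg (hN N).le, mul_comm, one_div]
      gcongr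
      have h1 := causal_norm (hyF (N + 1)).1.le (hyF (N + 1)).2.le
      have h2 := causal_norm (hyF 0).1.le (hyF 0).2.le
      have h3 := norm_sub_le (y (N + 1)) (y 0)
      linarith [hR (N + 1), hR 0]
    have hfix : γ.linear v = v :=
      sub_eq_zero.mp (tendsto_nhds_unique hlim1 (hlim2.comp hφ.tendsto_atTop))
    have hv3 : 1 ≤ v 3 := ge_of_tendsto' (((continuous_apply 3).tendsto v).comp hv) fun k => (hw3 _).1
    have hvB : Bf v v ≤ 0 := by
      have hc : Continuous fun x : E4 => Bf x x := Bf_cont.comp (continuous_id.prodMk continuous_id)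
      exact le_of_tendsto' ((hc.tendsto v).comp hv) fun k => (hwF _).1.le
    have hv0 : v ≠ 0 := by rintro rfl; simp at hv3; linarith
    rcases hvB.eq_or_lt with h | h
    · exact ⟨v, hv0, h, 1, by rw [hfix, hfix, one_smul]⟩
    · let K : E4 →ₗ[ℝ] E4 := (γ.linear : E4 →ₗ[ℝ] E4) - (γ⁻¹.linear : E4 →ₗ[ℝ] E4)
      have hKa : ∀ x, K x = γ.linear x - γ⁻¹.linear x := fun x => rfl
      have hfix' : γ⁻¹.linear v = v := by conv_lhs => rw [← hfix, inv_lin]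
      obtain ⟨w, hw0, hvw, hKw⟩ := skew_ker K (by
        intro u v
        rw [hKa, hKa, Bf_sub_left, Bf_sub_right, hG.inv_lor hγ, hG.inv_lor (Γ.inv_mem hγ), inv_inv]
        ring) h.ne (by rw [hKa, hfix, hfix', sub_self])
      have hw2 : γ.linear (γ.linear w) = w := by
        rw [hKa, sub_eq_zero] at hKw
        rw [hKw, lin_inv]
      have hwp := orth_pos h hw0 hvw
      set t := √(- Bf v v / Bf w w) with ht
      have ht2 : t ^ 2 = - Bf v v / Bf w w := Real.sq_sqrt (div_nonneg (by linarith) hwp.le)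
      have hz : Bf (v + t • w) (v + t • w) = 0 := by
        simp only [Bf_add_left, Bf_add_right, Bf_smul_left, Bf_smul_right, Bf_comm w v, hvw]
        have : t * (t * Bf w w) = - Bf v v := by
          rw [← mul_assoc, ← sq, ht2]; field_simp
        linarith
      refine ⟨v + t • w, ?_, hz, 1, ?_⟩
      · intro h0
        have := congrArg (Bf v) h0
        rw [Bf_add_right, Bf_smul_right, hvw, Bf_zero_right] at this
        linarith
      · simp only [map_add, map_smul, hfix, hw2, one_smul]
  · push Not at hb
    have : ∀ k : ℕ, ∃ n, (k : ℝ) < y n 3 := fun k => hb k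
    choose m hm using this
    set c : ℕ → ℝ := fun k => y (m k) 3 with hc
    have hc1 : ∀ k, 1 ≤ c k := fun k => hy1 _
    have hc0 : ∀ k, 0 < c k := fun k => by linarith [hc1 k]
    have hcl : Tendsto (fun k => (c k)⁻¹) atTop (𝓝 0) := by
      apply Tendsto.inv_tendsto_atTop
      exact tendsto_atTop_mono (fun k => (hm k).le) tendsto_natCast_atTop_atTop
    set v : ℕ → E4 := fun k => (c k)⁻¹ • y (m k) with hv
    have hv3 : ∀ k, v k 3 = 1 := fun k => by
      show (c k)⁻¹ * c k = 1
      exact inv_mul_cancel₀ (hc0 k).ne'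
    have hvF : ∀ k, Fut (v k) := fun k => (hyF _).smul (inv_pos.mpr (hc0 k))
    have hvb : ∀ k, v k ∈ Metric.closedBall (0 : E4) 1 := by
      intro k
      rw [Metric.mem_closedBall, dist_zero_right]
      exact (causal_norm (hvF k).1.le (hvF k).2.le).trans (hv3 k).le
    obtain ⟨n, _, φ, hφ, hn⟩ := (isCompact_closedBall (0 : E4) 1).tendsto_subseq hvb
    have hn3 : n 3 = 1 := tendsto_nhds_unique (((continuous_apply 3).tendsto n).comp hn)
      (by simp only [Function.comp_def, hv3]; exact tendsto_const_nhds)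
    have hn0 : n ≠ 0 := by rintro rfl; simp at hn3
    have hcl' : ∀ b : ℝ, Tendsto (fun k => (c (φ k))⁻¹ * ((c (φ k))⁻¹ * b)) atTop (𝓝 0) := by
      intro b
      have h1 := hcl.comp hφ.tendsto_atTop
      have := h1.mul (h1.mul_const b)
      simpa using this
    have hB1 : Bf n n = 0 := by
      have hcc : Continuous fun x : E4 => Bf x x := Bf_cont.comp (continuous_id.prodMk continuous_id)
      refine tendsto_nhds_unique ((hcc.tendsto n).comp hn) ?_
      refine (hcl' (-1)).congr fun k => ?_
      simp only [Function.comp, hv, Bf_smul_left, Bf_smul_right, hyB]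
    have hB2 : Bf (γ.linear n) n = 0 := by
      have hcc : Continuous fun x : E4 => Bf (γ.linear x) x := Bf_cont.comp (hLcont.prodMk continuous_id)
      refine tendsto_nhds_unique ((hcc.tendsto n).comp hn) ?_
      refine (hcl' (Bf (γ.linear e3) e3)).congr fun k => ?_
      simp only [Function.comp, hv, map_smul, Bf_smul_left, Bf_smul_right]
      congr 2
      have : γ.linear (y (m (φ k))) = (γ ^ (m (φ k))).linear (γ.linear e3) := by
        rw [← hys, ← mul_lin, ← pow_succ]
      rw [this, hy]
      simp only
      rw [hG.lor _ (Γ.pow_mem hγ _)]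
    obtain ⟨μ, hμ⟩ := null_par (by rw [hG.lor γ hγ, hB1]) hB1 hB2 hn0
    exact ⟨n, hn0, hB1, μ * μ, by rw [hμ, map_smul, hμ, smul_smul]⟩

end

noncomputable section
open Set Topology Filter ComplexConjugate

structure Frame (n : E4) where
  U : E4 →ₗ[ℝ] ℝ
  Z : E4 →ₗ[ℝ] ℂ
  V : E4 →ₗ[ℝ] ℝ
  bf : ∀ x y, Bf x y = (Z x).re * (Z y).re + (Z x).im * (Z y).im + U x * V y + V x * U y
  surj : ∀ u z v, ∃ x, U x = u ∧ Z x = z ∧ V x = v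
  Un : U n = 1
  Zn : Z n = 0
  Vn : V n = 0
  neg : ∀ x, Fut x → V x < 0

theorem onb3 (p0 p1 p2 : ℝ) (h : p0 ^ 2 + p1 ^ 2 + p2 ^ 2 = 1) : ∃ e0 e1 e2 f0 f1 f2 : ℝ,
    e0 ^ 2 + e1 ^ 2 + e2 ^ 2 = 1 ∧ f0 ^ 2 + f1 ^ 2 + f2 ^ 2 = 1 ∧ e0 * f0 + e1 * f1 + e2 * f2 = 0 ∧
    p0 * e0 + p1 * e1 + p2 * e2 = 0 ∧ p0 * f0 + p1 * f1 + p2 * f2 = 0 ∧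
    p0 ^ 2 + e0 ^ 2 + f0 ^ 2 = 1 ∧ p1 ^ 2 + e1 ^ 2 + f1 ^ 2 = 1 ∧ p2 ^ 2 + e2 ^ 2 + f2 ^ 2 = 1 ∧
    p0 * p1 + e0 * e1 + f0 * f1 = 0 ∧ p0 * p2 + e0 * e2 + f0 * f2 = 0 ∧ p1 * p2 + e1 * e2 + f1 * f2 = 0 := by
  by_cases h0 : p0 ^ 2 + p1 ^ 2 = 0
  · have a0 : p0 = 0 := by nlinarith [sq_nonneg p0, sq_nonneg p1]
    have a1 : p1 = 0 := by nlinarith [sq_nonneg p0, sq_nonneg p1]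
    subst a0 a1
    refine ⟨1, 0, 0, 0, 1, 0, ?_⟩
    norm_num at h ⊢
    rcases h with h | h <;> simp [h]
  · have hp : 0 < p0 ^ 2 + p1 ^ 2 := lt_of_le_of_ne (by positivity) (Ne.symm h0)
    set s := √(p0 ^ 2 + p1 ^ 2)
    have hs : s ≠ 0 := (Real.sqrt_pos.mpr hp).ne'
    have hs2 : s ^ 2 = p0 ^ 2 + p1 ^ 2 := Real.sq_sqrt hp.le
    have hp2 : p2 ^ 2 = 1 - s ^ 2 := by linarith
    refine ⟨-p1 / s, p0 / s, 0, -p0 * p2 / s, -p1 * p2 / s, s, ?_, ?_, ?_, ?_, ?_, ?_, ?_, ?_, ?_, ?_, ?_⟩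
    · field_simp; linarith
    · field_simp; linear_combination (p0 ^ 2 + p1 ^ 2) * hp2 + (s ^ 2 - 1) * hs2
    · field_simp; ring
    · field_simp; ring
    · field_simp; linear_combination p2 * hs2
    · field_simp; linear_combination p0 ^ 2 * hp2 - hs2
    · field_simp; linear_combination p1 ^ 2 * hp2 - hs2
    · linarith
    · field_simp; linear_combination p0 * p1 * hp2
    · field_simp; ring
    · field_simp; ring

theorem frame_exists {n : E4} (hn : Bf n n = 0) (h3 : n 3 = 1) : Nonempty (Frame n) := by
  have hn' : n 0 ^ 2 + n 1 ^ 2 + n 2 ^ 2 = 1 := by simp only [Bf, h3] at hn; linarith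
  obtain ⟨e0, e1, e2, f0, f1, f2, r1, r2, r3, r4, r5, c1, c2, c3, c4, c5, c6⟩ := onb3 _ _ _ hn'
  refine ⟨⟨{ toFun := fun x => (n 0 * x 0 + n 1 * x 1 + n 2 * x 2 + x 3) / 2
             map_add' := fun x y => by simp; ring
             map_smul' := fun c x => by simp; ring },
           { toFun := fun x => ⟨e0 * x 0 + e1 * x 1 + e2 * x 2, f0 * x 0 + f1 * x 1 + f2 * x 2⟩
             map_add' := fun x y => by apply Complex.ext <;> simp <;> ring
             map_smul' := fun c x => by apply Complex.ext <;> simp <;> ring },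
           Bl n, ?_, ?_, ?_, ?_, hn, ?_⟩⟩
  · intro x y
    simp only [Bl_ap, LinearMap.coe_mk, AddHom.coe_mk, Bf, h3]
    linear_combination (-(x 0 * y 0)) * c1 + (-(x 1 * y 1)) * c2 + (-(x 2 * y 2)) * c3
      + (-(x 0 * y 1 + x 1 * y 0)) * c4 + (-(x 0 * y 2 + x 2 * y 0)) * c5 + (-(x 1 * y 2 + x 2 * y 1)) * c6
  · intro u z v
    refine ⟨![(u + v / 2) * n 0 + z.re * e0 + z.im * f0, (u + v / 2) * n 1 + z.re * e1 + z.im * f1,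
      (u + v / 2) * n 2 + z.re * e2 + z.im * f2, u - v / 2], ?_, ?_, ?_⟩
    · simp only [LinearMap.coe_mk, AddHom.coe_mk, Matrix.cons_val]
      linear_combination (u + v / 2) / 2 * hn' + z.re / 2 * r4 + z.im / 2 * r5
    · simp only [LinearMap.coe_mk, AddHom.coe_mk, Matrix.cons_val]
      apply Complex.ext
      · simp only
        linear_combination (u + v / 2) * r4 + z.re * r1 + z.im * r3
      · simp only
        linear_combination (u + v / 2) * r5 + z.re * r3 + z.im * r2
    · simp only [Bl_ap, Bf, h3, Matrix.cons_val]
      linear_combination (u + v / 2) * hn' + z.re * r4 + z.im * r5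
  · simp only [LinearMap.coe_mk, AddHom.coe_mk, h3]
    linear_combination hn' / 2
  · simp only [LinearMap.coe_mk, AddHom.coe_mk]
    apply Complex.ext
    · simp only [Complex.zero_re]; linear_combination r4
    · simp only [Complex.zero_im]; linear_combination r5
  · intro x hx
    exact Bf_neg_of hn.le (by rw [h3]; exact one_pos) hx

namespace Frame
variable {n : E4} (F : Frame n)

theorem inj {x y : E4} (h1 : F.U x = F.U y) (h2 : F.Z x = F.Z y) (h3 : F.V x = F.V y) : x = y := by
  rw [← sub_eq_zero]
  apply Bf_nondeg
  intro z
  rw [F.bf, map_sub, map_sub, map_sub, h1, h2, h3]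
  simp

theorem V_eq (x : E4) : F.V x = Bf n x := by
  rw [F.bf, F.Un, F.Zn, F.Vn]; simp

theorem cont_U : Continuous F.U := F.U.continuous_of_finiteDimensional
theorem cont_V : Continuous F.V := F.V.continuous_of_finiteDimensional
theorem cont_Z : Continuous F.Z := F.Z.continuous_of_finiteDimensional

/-- rotation type -/
structure Ty (A : E4 →ₗ[ℝ] E4) (l : ℝ) (ρ w : ℂ) : Prop where
  pos : 0 < l
  nrm : ‖ρ‖ = 1
  V : ∀ x, F.V (A x) = l⁻¹ * F.V x
  Z : ∀ x, F.Z (A x) = ρ * F.Z x + w * F.V x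

theorem Ty.U {F : Frame n} {A : E4 →ₗ[ℝ] E4} {l : ℝ} {ρ w : ℂ} (h : F.Ty A l ρ w)
    (hA : ∀ x y, Bf (A x) (A y) = Bf x y) (x : E4) :
    F.U (A x) = l * (F.U x - (conj w * ρ * F.Z x).re - (w.re ^ 2 + w.im ^ 2) / 2 * F.V x) := by
  obtain ⟨m, m1, m2, m3⟩ := F.surj 0 0 1
  have hl := h.pos
  have h1 := hA m m
  have h2 := hA x m
  rw [F.bf, F.bf, h.V, h.Z, m1, m2, m3] at h1
  rw [F.bf, F.bf, h.V, h.Z, h.V, h.Z, m1, m2, m3] at h2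
  simp at h1 h2 ⊢
  field_simp at h1 h2
  linear_combination h2 - F.V x / 2 * h1

theorem ty_or {A : E4 →ₗ[ℝ] E4} (hA : ∀ x y, Bf (A x) (A y) = Bf x y) (hF : ∀ y, Fut y → Fut (A y))
    {μ : ℝ} (hn : A n = μ • n) : (∃ l ρ w, F.Ty A l ρ w) ∨
      ∃ (l : ℝ) (ρ w : ℂ), 0 < l ∧ ‖ρ‖ = 1 ∧ (∀ x, F.V (A x) = l⁻¹ * F.V x) ∧
        ∀ x, F.Z (A x) = ρ * conj (F.Z x) + w * F.V x := by
  have hV1 : ∀ x, μ * F.V (A x) = F.V x := by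
    intro x
    rw [F.V_eq, F.V_eq, ← hA n x, hn, Bf_smul_left]
  have hμ : 0 < μ := by
    have h1 := F.neg _ Fut_e3
    have h2 := F.neg _ (hF _ Fut_e3)
    have h3 := hV1 e3
    nlinarith
  have hV : ∀ x, F.V (A x) = μ⁻¹ * F.V x := by
    intro x; rw [← hV1 x]; field_simp
  obtain ⟨e, e1, e2, e3⟩ := F.surj 0 1 0
  obtain ⟨f, f1, f2, f3⟩ := F.surj 0 Complex.I 0
  obtain ⟨m, m1, m2, m3⟩ := F.surj 0 0 1
  have hx : ∀ x, x = F.U x • n + (F.Z x).re • e + (F.Z x).im • f + F.V x • m := by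
    intro x
    apply F.inj
    · simp [F.Un, e1, f1, m1]
    · simp [F.Zn, e2, f2, m2]
    · simp [F.Vn, e3, f3, m3]
  have hZ : ∀ x, F.Z (A x) = (F.Z x).re • F.Z (A e) + (F.Z x).im • F.Z (A f) + F.V x • F.Z (A m) := by
    intro x
    conv_lhs => rw [hx x]
    simp only [map_add, map_smul, hn, F.Zn, smul_zero, zero_add]
  let T : ℂ →ₗ[ℝ] ℂ :=
    { toFun := fun z => z.re • F.Z (A e) + z.im • F.Z (A f)
      map_add' := fun x y => by simp; ring
      map_smul' := fun c x => by simp; ring }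
  have hT : ∀ z, T z = z.re • F.Z (A e) + z.im • F.Z (A f) := fun z => rfl
  have hiso : ∀ z, ‖T z‖ = ‖z‖ := by
    intro z
    obtain ⟨x, x1, x2, x3⟩ := F.surj 0 z 0
    have h1 := hA x x
    rw [F.bf, F.bf, hV, hZ, x1, x2, x3] at h1
    rw [← sq_eq_sq₀ (norm_nonneg _) (norm_nonneg _), Complex.sq_norm, Complex.sq_norm, Complex.normSq_apply,
      Complex.normSq_apply, hT]
    simp only [zero_smul, add_zero, mul_zero, zero_mul] at h1
    exact h1
  let Ti : ℂ →ₗᵢ[ℝ] ℂ := ⟨T, hiso⟩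
  let Te : ℂ ≃ₗᵢ[ℝ] ℂ := Ti.toLinearIsometryEquiv rfl
  have hTe : ∀ z, Te z = z.re • F.Z (A e) + z.im • F.Z (A f) := fun z => rfl
  have hZ2 : ∀ x, F.Z (A x) = Te (F.Z x) + F.Z (A m) * F.V x := by
    intro x
    rw [hZ, hTe]; simp [mul_comm]
  obtain ⟨a, ha | ha⟩ := linear_isometry_complex Te
  · left
    refine ⟨μ, ((a : Circle) : ℂ), F.Z (A m), hμ, Circle.norm_coe a, hV, fun x => ?_⟩
    have hr : Te (F.Z x) = ((a : Circle) : ℂ) * F.Z x := by rw [ha]; rfl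
    rw [hZ2, hr]
  · right
    refine ⟨μ, ((a : Circle) : ℂ), F.Z (A m), hμ, Circle.norm_coe a, hV, fun x => ?_⟩
    have hr : Te (F.Z x) = ((a : Circle) : ℂ) * conj (F.Z x) := by rw [ha]; rfl
    rw [hZ2, hr]

theorem Ty.comp {F : Frame n} {A B : E4 →ₗ[ℝ] E4} {l l' : ℝ} {ρ w ρ' w' : ℂ} (h : F.Ty A l ρ w)
    (h' : F.Ty B l' ρ' w') : F.Ty (A ∘ₗ B) (l * l') (ρ * ρ') (ρ * w' + w * (l'⁻¹ : ℝ)) where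
  pos := mul_pos h.pos h'.pos
  nrm := by rw [norm_mul, h.nrm, h'.nrm, one_mul]
  V := fun x => by rw [LinearMap.comp_apply, h.V, h'.V, mul_inv]; ring
  Z := fun x => by rw [LinearMap.comp_apply, h.Z, h'.Z, h'.V]; push_cast; ring

theorem Ty.uniq {F : Frame n} {A : E4 →ₗ[ℝ] E4} {l l' : ℝ} {ρ w ρ' w' : ℂ} (h : F.Ty A l ρ w)
    (h' : F.Ty A l' ρ' w') : l = l' ∧ ρ = ρ' ∧ w = w' := by
  obtain ⟨e, e1, e2, e3⟩ := F.surj 0 1 0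
  obtain ⟨m, m1, m2, m3⟩ := F.surj 0 0 1
  have h1 := h.V m
  have h2 := h.Z e
  have h3 := h.Z m
  rw [h'.V, m3] at h1
  rw [h'.Z, e2, e3] at h2
  rw [h'.Z, m2, m3] at h3
  simp at h1 h2 h3
  exact ⟨h1.symm, h2.symm, h3.symm⟩

theorem Ty.eq_id {F : Frame n} {A : E4 →ₗ[ℝ] E4} (hA : ∀ x y, Bf (A x) (A y) = Bf x y)
    (h : F.Ty A 1 1 0) (x : E4) : A x = x := by
  apply F.inj
  · rw [h.U hA]; simp
  · rw [h.Z]; simp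
  · rw [h.V]; simp

theorem Ty.one (F : Frame n) : F.Ty LinearMap.id 1 1 0 :=
  ⟨one_pos, by simp, fun x => by simp, fun x => by simp⟩

/-- fixing three null lines -/
theorem Ty.three {F : Frame n} {A : E4 →ₗ[ℝ] E4} {l : ℝ} {ρ w : ℂ} (hA : ∀ x y, Bf (A x) (A y) = Bf x y)
    (h : F.Ty A l ρ w) {n1 n2 : E4} (hn1 : Bf n1 n1 = 0) (hn2 : Bf n2 n2 = 0) (hnn : Bf n n = 0)
    (hp1 : ∀ c : ℝ, n1 ≠ c • n) (hp2 : ∀ c : ℝ, n2 ≠ c • n) (hp : ∀ c : ℝ, n1 ≠ c • n2) {c1 c2 : ℝ}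
    (h1 : A n1 = c1 • n1) (h2 : A n2 = c2 • n2) (x : E4) : A x = x := by
  have hn0 : n ≠ 0 := by rintro rfl; have := F.Un; simp at this
  have hv1 : F.V n1 ≠ 0 := by
    intro h0
    rw [F.V_eq, Bf_comm] at h0
    obtain ⟨c, hc⟩ := null_par hn1 hnn h0 hn0
    exact hp1 c hc
  have hv2 : F.V n2 ≠ 0 := by
    intro h0
    rw [F.V_eq, Bf_comm] at h0
    obtain ⟨c, hc⟩ := null_par hn2 hnn h0 hn0
    exact hp2 c hc
  have a1 : c1 = l⁻¹ := by
    have := h.V n1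
    rw [h1, map_smul, smul_eq_mul] at this
    exact mul_right_cancel₀ hv1 this
  have a2 : c2 = l⁻¹ := by
    have := h.V n2
    rw [h2, map_smul, smul_eq_mul] at this
    exact mul_right_cancel₀ hv2 this
  have b1 := h.Z n1
  have b2 := h.Z n2
  rw [h1, map_smul, a1, Complex.real_smul] at b1
  rw [h2, map_smul, a2, Complex.real_smul] at b2
  have hv1' : (F.V n1 : ℂ) ≠ 0 := by exact_mod_cast hv1
  have hv2' : (F.V n2 : ℂ) ≠ 0 := by exact_mod_cast hv2
  have hq : F.Z n1 * F.V n2 ≠ F.Z n2 * F.V n1 := by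
    intro hq
    apply hp (F.V n1 / F.V n2)
    have hz : F.Z n1 = ((F.V n1 / F.V n2 : ℝ) : ℂ) * F.Z n2 := by
      push_cast; field_simp; linear_combination hq
    apply F.inj
    · rw [F.bf] at hn1 hn2
      rw [map_smul, smul_eq_mul]
      rw [hz] at hn1
      rw [Complex.re_ofReal_mul, Complex.im_ofReal_mul] at hn1
      field_simp at hn1 ⊢
      have : 2 * F.V n1 * F.V n2 * (F.U n1 * F.V n2 - F.V n1 * F.U n2) = 0 := by
        linear_combination hn1 - F.V n1 ^ 2 * hn2
      rcases mul_eq_zero.mp this with h0 | h0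
      · exfalso
        have : F.V n1 * F.V n2 ≠ 0 := mul_ne_zero hv1 hv2
        apply this; linarith
      · linarith
    · rw [map_smul, Complex.real_smul, hz]
    · rw [map_smul, smul_eq_mul]; field_simp
  have hr : ρ = ((l⁻¹ : ℝ) : ℂ) := by
    have : (ρ - ((l⁻¹ : ℝ) : ℂ)) * (F.Z n1 * F.V n2 - F.Z n2 * F.V n1) = 0 := by
      linear_combination -F.V n2 * b1 + F.V n1 * b2
    rcases mul_eq_zero.mp this with h0 | h0
    · exact sub_eq_zero.mp h0
    · exact absurd (sub_eq_zero.mp h0) hq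
  have hl : l = 1 := by
    have := h.nrm
    rw [hr, Complex.norm_real, Real.norm_of_nonneg (inv_nonneg.mpr h.pos.le)] at this
    exact inv_eq_one.mp this
  subst hl
  have hr1 : ρ = 1 := by rw [hr]; simp
  subst hr1
  have hw : w = 0 := by
    have : w * F.V n1 = 0 := by simp at b1; simp [b1]
    exact (mul_eq_zero.mp this).resolve_right hv1'
  subst hw
  exact h.eq_id hA x

end Frame
end

noncomputable section
open Set Topology Filter ComplexConjugate

theorem Frame.ty_sq {n : E4} (F : Frame n) {A : E4 →ₗ[ℝ] E4} (hA : ∀ x y, Bf (A x) (A y) = Bf x y)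
    (hF : ∀ y, Fut y → Fut (A y)) {μ : ℝ} (hn : A n = μ • n) : ∃ l ρ w, F.Ty (A ∘ₗ A) l ρ w := by
  rcases F.ty_or hA hF hn with ⟨l, ρ, w, h⟩ | ⟨l, ρ, w, h1, h2, h3, h4⟩
  · exact ⟨_, _, _, h.comp h⟩
  · refine ⟨l * l, 1, ρ * conj w + w * (l⁻¹ : ℝ), mul_pos h1 h1, by simp, ?_, ?_⟩
    · intro x
      rw [LinearMap.comp_apply, h3, h3, mul_inv]; ring
    · intro x
      have : ρ * conj ρ = 1 := by
        rw [Complex.mul_conj, Complex.normSq_eq_norm_sq, h2]; simp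
      rw [LinearMap.comp_apply, h4, h4, h3]
      simp only [map_add, map_mul, Complex.conj_conj, Complex.conj_ofReal]
      push_cast
      linear_combination F.Z x * this

def NoTrans (Γ : Subgroup (AffGroup 4)) : Prop := ∀ γ ∈ Γ, (∀ x, γ.linear x = x) → γ = 1

def Nul (n : E4) : Prop := n ≠ 0 ∧ Bf n n = 0

theorem Nul.tr {x y z : E4} (hx : Nul x) (hy : Nul y) (h1 : Bf x y = 0) (h2 : Bf y z = 0) : Bf x z = 0 := by
  obtain ⟨c, hc⟩ := null_par hx.2 hy.2 h1 hy.1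
  rw [hc, Bf_smul_left, h2, mul_zero]

theorem Nul.three {n : E4} (h : Nul n) : n 3 ≠ 0 := by
  intro h0
  apply h.1
  have h2 := h.2
  simp only [Bf, h0] at h2
  funext i
  fin_cases i
  · show n 0 = 0; nlinarith [sq_nonneg (n 0), sq_nonneg (n 1), sq_nonneg (n 2)]
  · show n 1 = 0; nlinarith [sq_nonneg (n 0), sq_nonneg (n 1), sq_nonneg (n 2)]
  · show n 2 = 0; nlinarith [sq_nonneg (n 0), sq_nonneg (n 1), sq_nonneg (n 2)]
  · exact h0

theorem Good.nul {Γ : Subgroup (AffGroup 4)} (hG : Good Γ) {γ : AffGroup 4} (hγ : γ ∈ Γ) {n : E4} (h : Nul n) :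
    Nul (γ.linear n) :=
  ⟨by simpa using h.1, by rw [hG.lor γ hγ]; exact h.2⟩

theorem Good.sq_one {Γ : Subgroup (AffGroup 4)} (hG : Good Γ) {γ : AffGroup 4} (hγ : γ ∈ Γ) (h : γ * γ = 1) :
    γ = 1 := by
  apply hG.free γ hγ
  refine ⟨(1 / 2 : ℝ) • γ 0, ?_⟩
  have h1 : γ (γ 0) = 0 := by rw [← mul_ap, h, one_ap]
  rw [aff_apply] at h1
  rw [aff_apply, map_smul, eq_neg_of_add_eq_zero_left h1]
  module

def T4 (s : AffGroup 4) (n : E4) : Prop := Bf ((s ^ 4).linear n) n = 0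

theorem three_lines0 {Γ : Subgroup (AffGroup 4)} (hG : Good1 Γ) (hN : NoTrans Γ) {δ : AffGroup 4} (h4 : δ ∈ Γ)
    {n1 n2 n3 : E4} (h1 : Nul n1) (h2 : Nul n2) (h3 : Nul n3) (t1 : Bf (δ.linear n1) n1 = 0)
    (t2 : Bf (δ.linear n2) n2 = 0) (t3 : Bf (δ.linear n3) n3 = 0)
    (h12 : Bf n1 n2 ≠ 0) (h13 : Bf n1 n3 ≠ 0) (h23 : Bf n2 n3 ≠ 0) : δ = 1 := by
  set n := (n1 3)⁻¹ • n1 with hn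
  have i0 : (n1 3)⁻¹ ≠ 0 := inv_ne_zero h1.three
  have hn3 : n 3 = 1 := by
    simp only [hn, Pi.smul_apply, smul_eq_mul]; exact inv_mul_cancel₀ h1.three
  have hnn : Bf n n = 0 := by rw [hn, Bf_smul_left, Bf_smul_right, h1.2]; simp
  obtain ⟨F⟩ := frame_exists hnn hn3
  have par : ∀ {m}, Nul m → Bf (δ.linear m) m = 0 → ∃ c : ℝ, δ.linear m = c • m := by
    intro m hm ht
    exact null_par (hG.toGood.nul h4 hm).2 hm.2 ht hm.1
  obtain ⟨c1, e1⟩ := par h1 t1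
  obtain ⟨c2, e2⟩ := par h2 t2
  obtain ⟨c3, e3⟩ := par h3 t3
  have e1' : (δ.linear : E4 →ₗ[ℝ] E4) n = c1 • n := by
    show δ.linear n = c1 • n
    rw [hn, map_smul, e1, smul_comm]
  obtain ⟨l, ρ, w, hT⟩ := F.ty_sq (fun x y => hG.lor _ h4 x y) (hG.fut _ h4) e1'
  have hA : ∀ x y, Bf (((δ.linear : E4 →ₗ[ℝ] E4) ∘ₗ (δ.linear : E4 →ₗ[ℝ] E4)) x)
      (((δ.linear : E4 →ₗ[ℝ] E4) ∘ₗ (δ.linear : E4 →ₗ[ℝ] E4)) y) = Bf x y := by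
    intro x y
    show Bf (δ.linear (δ.linear x)) (δ.linear (δ.linear y)) = _
    rw [hG.lor _ h4, hG.lor _ h4]
  have hid := hT.three hA h2.2 h3.2 hnn (n1 := n2) (n2 := n3) (c1 := c2 * c2) (c2 := c3 * c3)
    (fun c hc => h12 (by rw [hc, hn, Bf_smul_right, Bf_smul_right, h1.2]; simp))
    (fun c hc => h13 (by rw [hc, hn, Bf_smul_right, Bf_smul_right, h1.2]; simp))
    (fun c hc => h23 (by rw [hc, Bf_smul_left, h3.2]; simp))
    (by show δ.linear (δ.linear n2) = _
        rw [e2, map_smul, e2, smul_smul])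
    (by show δ.linear (δ.linear n3) = _
        rw [e3, map_smul, e3, smul_smul])
  exact hG.sq_one h4 (hN _ (Γ.mul_mem h4 h4) (fun x => by rw [mul_lin]; exact hid x))

theorem three_lines {Γ : Subgroup (AffGroup 4)} (hG : Good1 Γ) (hN : NoTrans Γ) {γ : AffGroup 4} (hγ : γ ∈ Γ)
    {n1 n2 n3 : E4} (h1 : Nul n1) (h2 : Nul n2) (h3 : Nul n3) (t1 : T4 γ n1) (t2 : T4 γ n2) (t3 : T4 γ n3)
    (h12 : Bf n1 n2 ≠ 0) (h13 : Bf n1 n3 ≠ 0) (h23 : Bf n2 n3 ≠ 0) : γ = 1 := by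
  have h4' := three_lines0 hG hN (Γ.pow_mem hγ 4) h1 h2 h3 t1 t2 t3 h12 h13 h23
  have h2' : γ ^ 2 = 1 := hG.sq_one (Γ.pow_mem hγ 2) (by rw [← pow_add]; exact h4')
  exact hG.sq_one hγ (by rw [← pow_two]; exact h2')

theorem T4_comm {Γ : Subgroup (AffGroup 4)} (hG : Good1 Γ) (hN : NoTrans Γ) {s z : AffGroup 4} (hs : s ∈ Γ)
    (hz : z ∈ Γ) (hz1 : z ≠ 1) (hc : s * z = z * s) {m : E4} (hm : Nul m) (ht : T4 z m) : T4 s m := by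
  have step : ∀ m, T4 z m → T4 z (s.linear m) := by
    intro m ht
    unfold T4 at *
    have : z ^ 4 * s = s * z ^ 4 := ((Commute.pow_right (show Commute s z from hc) 4).eq).symm
    rw [← mul_lin, this, mul_lin, hG.lor s hs, ht]
  have n1 := hG.toGood.nul hs hm
  have n2 := hG.toGood.nul hs n1
  have key : Bf m (s.linear (s.linear m)) = 0 := by
    by_contra h13
    by_cases h12 : Bf m (s.linear m) = 0
    · exact h13 (hm.tr n1 h12 (by rw [hG.lor s hs]; exact h12))
    · exact hz1 (three_lines hG hN hz hm n1 n2 ht (step _ ht) (step _ (step _ ht)) h12 h13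
        (by rw [hG.lor s hs]; exact h12))
  have n3 := hG.toGood.nul hs n2
  have n4 := hG.toGood.nul hs n3
  have : Bf m (s.linear (s.linear (s.linear (s.linear m)))) = 0 :=
    hm.tr n2 key (by rw [hG.lor s hs, hG.lor s hs]; exact key)
  unfold T4
  rw [Bf_comm, show s ^ 4 = s * (s * (s * s)) by simp only [pow_succ, pow_zero, one_mul, mul_assoc], mul_lin, mul_lin, mul_lin]
  exact this

theorem T4_par {s : AffGroup 4} {x y : E4} (hx : Nul x) (hy : Nul y) (h : Bf x y = 0) (ht : T4 s y) : T4 s x := by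
  obtain ⟨c, hc⟩ := null_par hx.2 hy.2 h hy.1
  unfold T4 at *
  rw [hc, map_smul, Bf_smul_left, Bf_smul_right, ht]; simp

theorem exists_T4 {Γ : Subgroup (AffGroup 4)} (hG : Good1 Γ) {s : AffGroup 4} (hs : s ∈ Γ) : ∃ n, Nul n ∧ T4 s n := by
  obtain ⟨n, hn, hn0, c, hc⟩ := exists_null_fixed hG hs
  refine ⟨n, ⟨hn, hn0⟩, ?_⟩
  unfold T4
  rw [show s ^ 4 = s * (s * (s * s)) by simp only [pow_succ, pow_zero, one_mul, mul_assoc], mul_lin, mul_lin, mul_lin, hc, map_smul, map_smul, hc,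
    Bf_smul_left, Bf_smul_left, hn0]; simp

theorem exists_S {Γ : Subgroup (AffGroup 4)} (hG : Good1 Γ) (hN : NoTrans Γ) :
    ∃ n, Nul n ∧ ∀ s ∈ Γ, ‖Lc s - 1‖ ≤ 1 / 32 → T4 s n := by
  classical
  by_contra hcon
  push Not at hcon
  obtain ⟨s0, hs0, hs01, hsm0⟩ := exists_small hG (show (0 : ℝ) < 1 / 32 by norm_num)
  obtain ⟨n1, hn1, ht1⟩ := exists_T4 hG hs0
  obtain ⟨s1, hs1, hsm1, hnt1⟩ := hcon n1 hn1
  have key : ∀ s2 ∈ Γ, ‖Lc s2 - 1‖ ≤ 1 / 32 → ∃ m, Nul m ∧ T4 s0 m ∧ T4 s1 m ∧ T4 s2 m := by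
    intro s2 hs2 hsm2
    obtain ⟨z, hz, hz1, hzc⟩ := zass hG.toGood ({s0, s1, s2} : Finset (AffGroup 4))
      (by intro s hs; simp at hs; rcases hs with rfl | rfl | rfl <;> assumption)
      (by intro s hs; simp at hs; rcases hs with rfl | rfl | rfl <;> assumption)
      ⟨s0, by simp, hs01⟩
    obtain ⟨m, hm, hmt⟩ := exists_T4 hG hz
    exact ⟨m, hm, T4_comm hG hN hs0 hz hz1 (hzc _ (by simp)) hm hmt,
      T4_comm hG hN hs1 hz hz1 (hzc _ (by simp)) hm hmt, T4_comm hG hN hs2 hz hz1 (hzc _ (by simp)) hm hmt⟩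
  by_cases h2 : ∃ n2, Nul n2 ∧ T4 s0 n2 ∧ Bf n1 n2 ≠ 0
  · obtain ⟨n2, hn2, ht2, h12⟩ := h2
    obtain ⟨s2, hs2, hsm2, hnt2⟩ := hcon n2 hn2
    obtain ⟨m, hm, m0, m1, m2⟩ := key s2 hs2 hsm2
    by_cases a1 : Bf n1 m = 0
    · exact hnt1 (T4_par hn1 hm a1 m1)
    by_cases a2 : Bf n2 m = 0
    · exact hnt2 (T4_par hn2 hm a2 m2)
    exact hs01 (three_lines hG hN hs0 hn1 hn2 hm ht1 ht2 m0 h12 a1 a2)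
  · push Not at h2
    obtain ⟨m, hm, m0, m1, m2⟩ := key s0 hs0 hsm0
    exact hnt1 (T4_par hn1 hm (h2 m hm m0) m1)

def SD (Γ : Subgroup (AffGroup 4)) (n : E4) : Prop :=
  Nul n ∧ ∃ ε : ℝ, 0 < ε ∧ ∀ s ∈ Γ, ‖Lc s - 1‖ ≤ ε → T4 s n

theorem SD_inv {Γ : Subgroup (AffGroup 4)} (hG : Good1 Γ) {n : E4} (h : SD Γ n) {g : AffGroup 4} (hg : g ∈ Γ) :
    SD Γ (g.linear n) := by
  obtain ⟨hn, ε, hε, hs⟩ := h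
  refine ⟨hG.toGood.nul hg hn, ε / (‖Lc g⁻¹‖ * ‖Lc g‖ + 1), by positivity, ?_⟩
  intro s hsΓ hsm
  have h1 := hs (g⁻¹ * s * g) (Γ.mul_mem (Γ.mul_mem (Γ.inv_mem hg) hsΓ) hg) ?_
  · unfold T4 at *
    have h2 : (g⁻¹ * s * g) ^ 4 = g⁻¹ * s ^ 4 * g := by
      have := conj_pow (a := g⁻¹) (b := s) (i := 4)
      rwa [inv_inv] at this
    rw [h2, mul_lin, mul_lin] at h1
    have h3 := hG.inv_lor (Γ.inv_mem hg) ((s ^ 4).linear (g.linear n)) n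
    rw [inv_inv] at h3
    rw [← h3]
    exact h1
  · have : Lc (g⁻¹ * s * g) - 1 = Lc g⁻¹ * (Lc s - 1) * Lc g := by
      rw [Lc_mul, Lc_mul, mul_sub, sub_mul, mul_one, Lc_inv_mul]
    rw [this]
    calc ‖Lc g⁻¹ * (Lc s - 1) * Lc g‖ ≤ ‖Lc g⁻¹‖ * ‖Lc s - 1‖ * ‖Lc g‖ :=
          (norm_mul_le _ _).trans (mul_le_mul_of_nonneg_right (norm_mul_le _ _) (norm_nonneg _))
      _ = ‖Lc s - 1‖ * (‖Lc g⁻¹‖ * ‖Lc g‖) := by ring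
      _ ≤ (ε / (‖Lc g⁻¹‖ * ‖Lc g‖ + 1)) * (‖Lc g⁻¹‖ * ‖Lc g‖ + 1) := by
          apply mul_le_mul hsm (by linarith) (by positivity) (by positivity)
      _ = ε := by field_simp

theorem SD_three {Γ : Subgroup (AffGroup 4)} (hG : Good1 Γ) (hN : NoTrans Γ) {n1 n2 n3 : E4} (h1 : SD Γ n1)
    (h2 : SD Γ n2) (h3 : SD Γ n3) (h12 : Bf n1 n2 ≠ 0) (h13 : Bf n1 n3 ≠ 0) (h23 : Bf n2 n3 ≠ 0) : False := by
  obtain ⟨hn1, e1, he1, hs1⟩ := h1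
  obtain ⟨hn2, e2, he2, hs2⟩ := h2
  obtain ⟨hn3, e3, he3, hs3⟩ := h3
  obtain ⟨s, hs, hs', hsm⟩ := exists_small hG (lt_min he1 (lt_min he2 he3))
  have a1 := hsm.trans (min_le_left _ _)
  have a2 := hsm.trans ((min_le_right _ _).trans (min_le_left _ _))
  have a3 := hsm.trans ((min_le_right _ _).trans (min_le_right _ _))
  exact hs' (three_lines hG hN hs hn1 hn2 hn3 (hs1 s hs a1) (hs2 s hs a2) (hs3 s hs a3) h12 h13 h23)

theorem Good1.sub {Γ H : Subgroup (AffGroup 4)} (hG : Good1 Γ) (hle : H ≤ Γ) (hH : Good H) : Good1 H :=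
  { hH with fut := fun γ hγ => hG.fut γ (hle hγ) }

theorem NoTrans.sub {Γ H : Subgroup (AffGroup 4)} (hG : NoTrans Γ) (hle : H ≤ Γ) : NoTrans H :=
  fun γ hγ => hG γ (hle hγ)

theorem null_line {Γ : Subgroup (AffGroup 4)} (hG : Good1 Γ) (hN : NoTrans Γ) :
    ∃ n, Bf n n = 0 ∧ n 3 = 1 ∧ ∃ H ≤ Γ, Good1 H ∧ ∀ γ ∈ H, ∃ c : ℝ, γ.linear n = c • n := by
  obtain ⟨n, hn, hs⟩ := exists_S hG hN
  have hD : SD Γ n := ⟨hn, 1 / 32, by norm_num, hs⟩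
  let H : Subgroup (AffGroup 4) :=
    { carrier := {γ | γ ∈ Γ ∧ Bf (γ.linear n) n = 0}
      one_mem' := ⟨Γ.one_mem, by rw [one_lin]; exact hn.2⟩
      mul_mem' := by
        rintro a b ⟨ha, ha'⟩ ⟨hb, hb'⟩
        refine ⟨Γ.mul_mem ha hb, ?_⟩
        rw [mul_lin]
        exact (hG.toGood.nul ha (hG.toGood.nul hb hn)).tr (hG.toGood.nul ha hn)
          (by rw [hG.lor a ha]; exact hb') ha'
      inv_mem' := by
        rintro a ⟨ha, ha'⟩
        refine ⟨Γ.inv_mem ha, ?_⟩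
        rw [Bf_comm, ← hG.inv_lor ha]; exact ha' }
  have hle : H ≤ Γ := fun γ h => h.1
  have hH : Good H := by
    apply hG.toGood.of_two hle
    intro γ hγ δ hδ hγH hδH
    refine ⟨Γ.mul_mem hγ hδ, ?_⟩
    by_contra hcon
    have a1 : Bf (γ.linear n) n ≠ 0 := fun h => hγH ⟨hγ, h⟩
    have a2 : Bf (δ.linear n) n ≠ 0 := fun h => hδH ⟨hδ, h⟩
    exact SD_three hG hN (SD_inv hG hD (Γ.mul_mem hγ hδ)) (SD_inv hG hD hγ) hD
      (by rw [mul_lin, hG.lor γ hγ]; exact a2) hcon a1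
  refine ⟨(n 3)⁻¹ • n, ?_, ?_, H, hle, hG.sub hle hH, ?_⟩
  · rw [Bf_smul_left, Bf_smul_right, hn.2]; simp
  · simp only [Pi.smul_apply, smul_eq_mul]; exact inv_mul_cancel₀ hn.three
  · intro γ hγ
    obtain ⟨c, hc⟩ := null_par (hG.toGood.nul hγ.1 hn).2 hn.2 hγ.2 hn.1
    exact ⟨c, by rw [map_smul, hc, smul_comm]⟩
end

noncomputable section
open Set Topology Filter ComplexConjugate

theorem two_pred {Γ : Subgroup (AffGroup 4)} {P Q : AffGroup 4 → Prop} (h : ∀ γ ∈ Γ, P γ ∨ Q γ)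
    (hP : ∀ γ ∈ Γ, ∀ δ ∈ Γ, P δ → P (γ * δ) → P γ) (hQ : ∀ γ ∈ Γ, ∀ δ ∈ Γ, Q γ → Q (γ * δ) → Q δ) :
    (∀ γ ∈ Γ, P γ) ∨ ∀ γ ∈ Γ, Q γ := by
  by_contra hcon
  push Not at hcon
  obtain ⟨⟨γ, hγ, h1⟩, δ, hδ, h2⟩ := hcon
  have a1 := (h γ hγ).resolve_left h1
  have a2 := (h δ hδ).resolve_right h2
  rcases h _ (Γ.mul_mem hγ hδ) with h3 | h3
  · exact h1 (hP γ hγ δ hδ a2 h3)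
  · exact h2 (hQ γ hγ δ hδ a1 h3)

theorem Good.inv_bdd {Γ : Subgroup (AffGroup 4)} (hG : Good Γ) {f : E4 → ℝ} (hf : Continuous f)
    (hi : ∀ γ ∈ Γ, ∀ x, f (γ x) = f x) : ∃ M, ∀ x, f x ≤ M := by
  obtain ⟨K, hK, hc⟩ := hG.cc
  obtain ⟨M, hM⟩ := (hK.image hf).bddAbove
  refine ⟨M, fun x => ?_⟩
  obtain ⟨γ, hγ, hx⟩ := hc x
  rw [← hi γ hγ]
  exact hM ⟨_, hx, rfl⟩

namespace Frame
variable {n : E4} (F : Frame n)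

theorem Ty.inv {F : Frame n} {A B : E4 →ₗ[ℝ] E4} {l : ℝ} {ρ w : ℂ} (h : F.Ty A l ρ w)
    (hAB : ∀ x, A (B x) = x) : F.Ty B l⁻¹ ρ⁻¹ (-(ρ⁻¹ * w * l)) := by
  have hl := h.pos.ne'
  have hr : ρ ≠ 0 := by intro h0; have := h.nrm; rw [h0] at this; simp at this
  have hV : ∀ x, F.V (B x) = l * F.V x := by
    intro x
    have := h.V (B x)
    rw [hAB] at this
    rw [this]; field_simp
  refine ⟨inv_pos.mpr h.pos, by rw [norm_inv, h.nrm, inv_one], fun x => by rw [hV, inv_inv], fun x => ?_⟩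
  have := h.Z (B x)
  rw [hAB, hV] at this
  rw [this]
  push_cast
  field_simp
  ring

/-- rotation type subgroup -/
def RT (Γ : Subgroup (AffGroup 4)) : Prop := ∀ γ ∈ Γ, ∃ l ρ w, F.Ty (γ.linear : E4 →ₗ[ℝ] E4) l ρ w

theorem rot_sub {Γ : Subgroup (AffGroup 4)} (hG : Good1 Γ) (hn : ∀ γ ∈ Γ, ∃ c : ℝ, γ.linear n = c • n) :
    ∃ H ≤ Γ, Good1 H ∧ F.RT H ∧ ∀ γ ∈ Γ, ∀ δ ∈ Γ, γ ∉ H → δ ∉ H → γ * δ ∈ H := by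
  let H : Subgroup (AffGroup 4) :=
    { carrier := {γ | γ ∈ Γ ∧ ∃ l ρ w, F.Ty (γ.linear : E4 →ₗ[ℝ] E4) l ρ w}
      one_mem' := ⟨Γ.one_mem, 1, 1, 0, Ty.one F⟩
      mul_mem' := by
        rintro a b ⟨ha, l, ρ, w, h⟩ ⟨hb, l', ρ', w', h'⟩
        exact ⟨Γ.mul_mem ha hb, _, _, _, h.comp h'⟩
      inv_mem' := by
        rintro a ⟨ha, l, ρ, w, h⟩
        exact ⟨Γ.inv_mem ha, _, _, _, h.inv (fun x => lin_inv a x)⟩ }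
  have hle : H ≤ Γ := fun γ h => h.1
  have h2 : ∀ γ ∈ Γ, ∀ δ ∈ Γ, γ ∉ H → δ ∉ H → γ * δ ∈ H := by
    intro γ hγ δ hδ h1 h2
    refine ⟨Γ.mul_mem hγ hδ, ?_⟩
    have key : ∀ γ ∈ Γ, γ ∉ H → ∃ (l : ℝ) (ρ w : ℂ), 0 < l ∧ ‖ρ‖ = 1 ∧
        (∀ x, F.V (γ.linear x) = l⁻¹ * F.V x) ∧ ∀ x, F.Z (γ.linear x) = ρ * conj (F.Z x) + w * F.V x := by
      intro γ hγ h1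
      obtain ⟨c, hc⟩ := hn γ hγ
      exact (F.ty_or (A := (γ.linear : E4 →ₗ[ℝ] E4)) (fun x y => hG.lor γ hγ x y) (hG.fut γ hγ) hc).resolve_left
        (fun h => h1 ⟨hγ, h⟩)
    obtain ⟨l, ρ, w, a1, a2, a3, a4⟩ := key γ hγ h1
    obtain ⟨l', ρ', w', b1, b2, b3, b4⟩ := key δ hδ h2
    refine ⟨l * l', ρ * conj ρ', ρ * conj w' + w * (l'⁻¹ : ℝ), mul_pos a1 b1, by simp [a2, b2], ?_, ?_⟩
    · intro x
      show F.V ((γ * δ).linear x) = _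
      rw [mul_lin, a3, b3, mul_inv]; ring
    · intro x
      show F.Z ((γ * δ).linear x) = _
      rw [mul_lin, a4, b4, b3]
      simp only [map_add, map_mul, Complex.conj_conj, Complex.conj_ofReal]
      push_cast
      ring
  exact ⟨H, hle, hG.sub hle (hG.toGood.of_two hle h2), fun γ h => h.2, h2⟩

def prm (γ : AffGroup 4) : ℝ × ℂ × ℂ :=
  Classical.epsilon fun p => F.Ty (γ.linear : E4 →ₗ[ℝ] E4) p.1 p.2.1 p.2.2
def l (γ : AffGroup 4) : ℝ := (F.prm γ).1
def r (γ : AffGroup 4) : ℂ := (F.prm γ).2.1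
def w (γ : AffGroup 4) : ℂ := (F.prm γ).2.2
def a (γ : AffGroup 4) : ℂ := F.Z (γ 0)
def c (γ : AffGroup 4) : ℝ := F.V (γ 0)
def b (γ : AffGroup 4) : ℝ := F.U (γ 0)

variable {F} {Γ : Subgroup (AffGroup 4)}

theorem RT.ty (h : F.RT Γ) {γ : AffGroup 4} (hγ : γ ∈ Γ) : F.Ty (γ.linear : E4 →ₗ[ℝ] E4) (F.l γ) (F.r γ) (F.w γ) := by
  obtain ⟨l, ρ, w, h1⟩ := h γ hγ
  exact Classical.epsilon_spec (p := fun p : ℝ × ℂ × ℂ => F.Ty (γ.linear : E4 →ₗ[ℝ] E4) p.1 p.2.1 p.2.2) ⟨(l, ρ, w), h1⟩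

theorem RT.sub (h : F.RT Γ) {H : Subgroup (AffGroup 4)} (hle : H ≤ Γ) : F.RT H := fun γ hγ => h γ (hle hγ)

theorem RT.mul (h : F.RT Γ) {γ δ : AffGroup 4} (hγ : γ ∈ Γ) (hδ : δ ∈ Γ) :
    F.l (γ * δ) = F.l γ * F.l δ ∧ F.r (γ * δ) = F.r γ * F.r δ ∧
      F.w (γ * δ) = F.r γ * F.w δ + F.w γ * ((F.l δ)⁻¹ : ℝ) :=
  (h.ty (Γ.mul_mem hγ hδ)).uniq ((h.ty hγ).comp (h.ty hδ))

theorem RT.one (h : F.RT Γ) : F.l 1 = 1 ∧ F.r 1 = 1 ∧ F.w 1 = 0 :=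
  (h.ty Γ.one_mem).uniq (Ty.one F)

theorem RT.rn (h : F.RT Γ) {γ : AffGroup 4} (hγ : γ ∈ Γ) : F.r γ ≠ 0 := by
  intro h0; have := (h.ty hγ).nrm; rw [h0] at this; simp at this

theorem RT.inv (h : F.RT Γ) {γ : AffGroup 4} (hγ : γ ∈ Γ) :
    F.l γ⁻¹ = (F.l γ)⁻¹ ∧ F.r γ⁻¹ = (F.r γ)⁻¹ := by
  have := (h.ty (Γ.inv_mem hγ)).uniq ((h.ty hγ).inv (B := (γ⁻¹.linear : E4 →ₗ[ℝ] E4)) (fun x => lin_inv γ x))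
  exact ⟨this.1, this.2.1⟩

theorem RT.Vap (h : F.RT Γ) {γ : AffGroup 4} (hγ : γ ∈ Γ) (x : E4) : F.V (γ x) = (F.l γ)⁻¹ * F.V x + F.c γ := by
  rw [aff_apply, map_add]; congr 1; exact (h.ty hγ).V x

theorem RT.Zap (h : F.RT Γ) {γ : AffGroup 4} (hγ : γ ∈ Γ) (x : E4) :
    F.Z (γ x) = F.r γ * F.Z x + F.w γ * F.V x + F.a γ := by
  rw [aff_apply, map_add]; congr 1; exact (h.ty hγ).Z x

theorem RT.Uap (h : F.RT Γ) (hG : Good Γ) {γ : AffGroup 4} (hγ : γ ∈ Γ) (x : E4) :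
    F.U (γ x) = F.l γ * (F.U x - (conj (F.w γ) * F.r γ * F.Z x).re
      - ((F.w γ).re ^ 2 + (F.w γ).im ^ 2) / 2 * F.V x) + F.b γ := by
  rw [aff_apply, map_add]; congr 1; exact (h.ty hγ).U (fun x y => hG.lor γ hγ x y) x

theorem RT.c_mul (h : F.RT Γ) {γ : AffGroup 4} (hγ : γ ∈ Γ) (δ : AffGroup 4) :
    F.c (γ * δ) = (F.l γ)⁻¹ * F.c δ + F.c γ := by
  rw [c, mul_ap, h.Vap hγ, c, c]

theorem RT.a_mul (h : F.RT Γ) {γ : AffGroup 4} (hγ : γ ∈ Γ) (δ : AffGroup 4) :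
    F.a (γ * δ) = F.r γ * F.a δ + F.w γ * F.c δ + F.a γ := by
  rw [a, mul_ap, h.Zap hγ, a, a, c]

theorem RT.b_mul (h : F.RT Γ) (hG : Good Γ) {γ : AffGroup 4} (hγ : γ ∈ Γ) (δ : AffGroup 4) :
    F.b (γ * δ) = F.l γ * (F.b δ - (conj (F.w γ) * F.r γ * F.a δ).re
      - ((F.w γ).re ^ 2 + (F.w γ).im ^ 2) / 2 * F.c δ) + F.b γ := by
  rw [b, mul_ap, h.Uap hG hγ, b, b, c, a]

/-- freeness -/
theorem RT.lr (h : F.RT Γ) (hG : Good Γ) {γ : AffGroup 4} (hγ : γ ∈ Γ) : F.l γ = 1 ∨ F.r γ = 1 := by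
  by_contra hcon
  push Not at hcon
  obtain ⟨hl, hr⟩ := hcon
  have hl0 := (h.ty hγ).pos.ne'
  have e1 : 1 - (F.l γ)⁻¹ ≠ 0 := by
    intro h0; apply hl; rw [sub_eq_zero] at h0; exact (inv_eq_one.mp h0.symm)
  have e2 : 1 - F.r γ ≠ 0 := by intro h0; apply hr; rw [sub_eq_zero] at h0; exact h0.symm
  have e3 : 1 - F.l γ ≠ 0 := by intro h0; apply hl; rw [sub_eq_zero] at h0; exact h0.symm
  set v := F.c γ / (1 - (F.l γ)⁻¹) with hv
  set q := (F.w γ * v + F.a γ) / (1 - F.r γ) with hq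
  set S := (conj (F.w γ) * F.r γ * q).re + ((F.w γ).re ^ 2 + (F.w γ).im ^ 2) / 2 * v with hS
  obtain ⟨x, x1, x2, x3⟩ := F.surj ((F.b γ - F.l γ * S) / (1 - F.l γ)) q v
  have hγ1 : γ = 1 := by
    apply hG.free γ hγ
    refine ⟨x, F.inj ?_ ?_ ?_⟩
    · rw [h.Uap hG hγ, x1, x2, x3]
      rw [sub_sub, ← hS]
      generalize S = S
      field_simp
      ring
    · rw [h.Zap hγ, x2, x3]
      have : q * (1 - F.r γ) = F.w γ * v + F.a γ := by rw [hq]; field_simp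
      linear_combination -this
    · rw [h.Vap hγ, x3]
      have : v * (1 - (F.l γ)⁻¹) = F.c γ := by rw [hv]; field_simp
      linear_combination -this
  apply hl
  rw [hγ1]; exact h.one.1

theorem RT.lr_all (h : F.RT Γ) (hG : Good Γ) : (∀ γ ∈ Γ, F.l γ = 1) ∨ ∀ γ ∈ Γ, F.r γ = 1 := by
  apply two_pred (fun γ hγ => h.lr hG hγ)
  · intro γ hγ δ hδ h1 h2
    rw [(h.mul hγ hδ).1, h1, mul_one] at h2
    exact h2
  · intro γ hγ δ hδ h1 h2
    rw [(h.mul hγ hδ).2.1, h1, one_mul] at h2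
    exact h2

theorem RT.ext (h : F.RT Γ) (hG : Good Γ) (hN : NoTrans Γ) {γ δ : AffGroup 4} (hγ : γ ∈ Γ) (hδ : δ ∈ Γ)
    (h1 : F.l γ = F.l δ) (h2 : F.r γ = F.r δ) (h3 : F.w γ = F.w δ) : γ = δ := by
  have key : ∀ x, γ.linear x = δ.linear x := by
    intro x
    have e1 := h.ty hγ
    have e2 := h.ty hδ
    rw [h1, h2, h3] at e1
    apply F.inj
    · exact (e1.U (fun x y => hG.lor γ hγ x y) x).trans (e2.U (fun x y => hG.lor δ hδ x y) x).symm
    · exact (e1.Z x).trans (e2.Z x).symm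
    · exact (e1.V x).trans (e2.V x).symm
  have := hN (γ⁻¹ * δ) (Γ.mul_mem (Γ.inv_mem hγ) hδ) (fun x => by rw [mul_lin, ← key, inv_lin])
  exact (inv_mul_eq_one.mp this)

theorem RT.comm (h : F.RT Γ) (hG : Good Γ) (hN : NoTrans Γ) {γ δ : AffGroup 4} (hγ : γ ∈ Γ) (hδ : δ ∈ Γ)
    (h1 : F.l γ = 1) (h2 : F.r γ = 1) (h3 : F.l δ = 1) (h4 : F.r δ = 1) : γ * δ = δ * γ := by
  apply h.ext hG hN (Γ.mul_mem hγ hδ) (Γ.mul_mem hδ hγ)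
  · rw [(h.mul hγ hδ).1, (h.mul hδ hγ).1, h1, h3]
  · rw [(h.mul hγ hδ).2.1, (h.mul hδ hγ).2.1, h2, h4]
  · rw [(h.mul hγ hδ).2.2, (h.mul hδ hγ).2.2, h1, h2, h3, h4]; simp [add_comm]

/-- commutation relations -/
theorem RT.rel (h : F.RT Γ) (hG : Good Γ) (hN : NoTrans Γ) {γ δ : AffGroup 4} (hγ : γ ∈ Γ) (hδ : δ ∈ Γ)
    (h1 : F.l γ = 1) (h2 : F.r γ = 1) (h3 : F.l δ = 1) (h4 : F.r δ = 1) :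
    F.w γ * F.c δ = F.w δ * F.c γ ∧
    (conj (F.w γ) * F.a δ).re + ((F.w γ).re ^ 2 + (F.w γ).im ^ 2) / 2 * F.c δ =
    (conj (F.w δ) * F.a γ).re + ((F.w δ).re ^ 2 + (F.w δ).im ^ 2) / 2 * F.c γ := by
  have hc := h.comm hG hN hγ hδ h1 h2 h3 h4
  constructor
  · have e1 := h.a_mul hγ δ
    have e2 := h.a_mul hδ γ
    rw [hc, e2, h2, h4] at e1
    linear_combination -e1
  · have e1 := h.b_mul hG hγ δ
    have e2 := h.b_mul hG hδ γ
    rw [hc, e2, h2, h4, h1, h3, mul_one, mul_one] at e1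
    linear_combination e1

theorem RT.conj (h : F.RT Γ) {γ ν : AffGroup 4} (hγ : γ ∈ Γ) (hν : ν ∈ Γ) (h1 : F.l ν = 1) (h2 : F.r ν = 1) :
    F.l (γ * ν * γ⁻¹) = 1 ∧ F.r (γ * ν * γ⁻¹) = 1 := by
  have e1 := h.mul (Γ.mul_mem hγ hν) (Γ.inv_mem hγ)
  have e2 := h.mul hγ hν
  have e3 := h.inv hγ
  refine ⟨?_, ?_⟩
  · rw [e1.1, e2.1, e3.1, h1, mul_one]; exact mul_inv_cancel₀ (h.ty hγ).pos.ne'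
  · rw [e1.2.1, e2.2.1, e3.2, h2, mul_one]; exact mul_inv_cancel₀ (h.rn hγ)

theorem V_hyp (hG : Good Γ) (v0 : ℝ) (h : ∀ γ ∈ Γ, ∀ x, F.V x = v0 → F.V (γ x) = v0) : False := by
  obtain ⟨x, x1, x2, x3⟩ := F.surj 0 0 v0
  obtain ⟨y, y1, y2, y3⟩ := F.surj 0 0 1
  refine no_hyperplane hG (LinearMap.toContinuousLinearMap F.V) ?_ v0 x (fun γ hγ => h γ hγ x x3)
  intro h0
  have : (LinearMap.toContinuousLinearMap F.V) y = 0 := by rw [h0]; rfl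
  rw [LinearMap.coe_toContinuousLinearMap', y3] at this
  exact one_ne_zero this

end Frame
end

noncomputable section
open Set Topology Filter ComplexConjugate

namespace Frame
variable {n : E4} {F : Frame n} {Γ : Subgroup (AffGroup 4)}

theorem RT.w0 (h : F.RT Γ) (hG : Good Γ) (hN : NoTrans Γ) {ν : AffGroup 4} (hν : ν ∈ Γ)
    (h1 : F.l ν = 1) (h2 : F.r ν = 1) (h3 : F.w ν = 0) : ν = 1 := by
  have := h.one
  exact h.ext hG hN hν Γ.one_mem (by rw [h1, this.1]) (by rw [h2, this.2.1]) (by rw [h3, this.2.2])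

theorem c_one : F.c 1 = 0 := by rw [c, one_ap, map_zero]

theorem RT.comm_mem (h : F.RT Γ) {γ δ : AffGroup 4} (hγ : γ ∈ Γ) (hδ : δ ∈ Γ) :
    ∃ ν ∈ Γ, F.l ν = 1 ∧ F.r ν = 1 ∧ γ * δ = ν * (δ * γ) := by
  have hm1 := Γ.mul_mem hγ hδ
  have hm2 := Γ.mul_mem hδ hγ
  refine ⟨(γ * δ) * (δ * γ)⁻¹, Γ.mul_mem hm1 (Γ.inv_mem hm2), ?_, ?_, by group⟩
  · rw [(h.mul hm1 (Γ.inv_mem hm2)).1, (h.inv hm2).1, (h.mul hγ hδ).1, (h.mul hδ hγ).1]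
    have := (h.ty hγ).pos.ne'
    have := (h.ty hδ).pos.ne'
    field_simp
  · rw [(h.mul hm1 (Γ.inv_mem hm2)).2.1, (h.inv hm2).2, (h.mul hγ hδ).2.1, (h.mul hδ hγ).2.1]
    have := h.rn hγ
    have := h.rn hδ
    field_simp

theorem case_i (h : F.RT Γ) (hG : Good Γ) (hN : NoTrans Γ) (hr : ∀ γ ∈ Γ, F.r γ = 1)
    {γ : AffGroup 4} (hγ : γ ∈ Γ) (hl : F.l γ ≠ 1) : False := by
  have hl0 := (h.ty hγ).pos
  have e1 : 1 - (F.l γ)⁻¹ ≠ 0 := by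
    intro h0; apply hl; rw [sub_eq_zero] at h0; exact (inv_eq_one.mp h0.symm)
  have hc : ∀ ν ∈ Γ, F.l ν = 1 → F.c ν = 0 := by
    intro ν hν h1
    set ν' := γ * ν * γ⁻¹ with hν'
    have hm : ν' ∈ Γ := Γ.mul_mem (Γ.mul_mem hγ hν) (Γ.inv_mem hγ)
    have hcj := h.conj hγ hν h1 (hr ν hν)
    have heq : ν' * γ = γ * ν := by rw [hν']; group
    have w1 := (h.mul hm hγ).2.2
    have w2 := (h.mul hγ hν).2.2
    have c1 := h.c_mul hm γ
    have c2 := h.c_mul hγ ν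
    rw [heq] at w1 c1
    rw [w2, hr γ hγ, hr ν' hm, h1] at w1
    rw [c2, hcj.1] at c1
    have hl0' : (F.l γ : ℂ) ≠ 0 := by exact_mod_cast hl0.ne'
    have w3 : F.w ν' = F.l γ * F.w ν := by
      push_cast at w1; field_simp at w1; linear_combination -w1
    have c3 : F.c ν' = (F.l γ)⁻¹ * F.c ν := by linarith
    have rel := (h.rel hG hN hν hm h1 (hr ν hν) hcj.1 hcj.2).1
    rw [w3, c3] at rel
    push_cast at rel
    field_simp at rel
    by_contra hcn
    have hw : F.w ν ≠ 0 := by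
      intro h0
      have := h.w0 hG hN hν h1 (hr ν hν) h0
      rw [this] at hcn; exact hcn c_one
    have hcn' : (F.c ν : ℂ) ≠ 0 := by exact_mod_cast hcn
    have rel2 : (F.l γ : ℂ) ^ 2 = 1 := by
      have : F.w ν * F.c ν * ((F.l γ : ℂ) ^ 2 - 1) = 0 := by linear_combination -rel
      rcases mul_eq_zero.mp this with h0 | h0
      · exact absurd h0 (mul_ne_zero hw hcn')
      · linear_combination h0
    have rel3 : (F.l γ) ^ 2 = 1 := by exact_mod_cast rel2
    apply hl; nlinarith
  set v0 := F.c γ / (1 - (F.l γ)⁻¹) with hv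
  have hv' : F.c γ = (1 - (F.l γ)⁻¹) * v0 := by rw [hv]; field_simp
  refine V_hyp (F := F) hG v0 ?_
  intro δ hδ x hx
  rw [h.Vap hδ, hx]
  obtain ⟨ν, hν, n1, n2, n3⟩ := h.comm_mem hγ hδ
  have c1 := h.c_mul hγ δ
  rw [n3, h.c_mul hν, n1, hc ν hν n1, h.c_mul hδ, hv'] at c1
  have : (1 - (F.l γ)⁻¹) * ((F.l δ)⁻¹ * v0 + F.c δ - v0) = 0 := by linear_combination c1
  have := (mul_eq_zero.mp this).resolve_left e1
  linarith

theorem case_iia (h : F.RT Γ) (hG : Good Γ) (hN : NoTrans Γ) (hr : ∀ γ ∈ Γ, F.r γ = 1)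
    (hl : ∀ γ ∈ Γ, F.l γ = 1) {γ0 : AffGroup 4} (hγ0 : γ0 ∈ Γ) (hc0 : F.c γ0 ≠ 0) : False := by
  have hc0' : (F.c γ0 : ℂ) ≠ 0 := by exact_mod_cast hc0
  set p := F.w γ0 / F.c γ0 with hp
  have hw0 : F.w γ0 = p * F.c γ0 := by rw [hp]; field_simp
  have hw : ∀ γ ∈ Γ, F.w γ = p * F.c γ := by
    intro γ hγ
    have := (h.rel hG hN hγ hγ0 (hl γ hγ) (hr γ hγ) (hl _ hγ0) (hr _ hγ0)).1
    rw [hw0] at this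
    apply mul_right_cancel₀ hc0'
    linear_combination this
  have hp0 : p ≠ 0 := by
    intro h0
    rw [h0, zero_mul] at hw0
    have := h.w0 hG hN hγ0 (hl _ hγ0) (hr _ hγ0) hw0
    rw [this] at hc0
    exact hc0 c_one
  set P := p.re ^ 2 + p.im ^ 2 with hP
  have hPpos : 0 < P := by
    have := Complex.normSq_pos.mpr hp0
    rw [Complex.normSq_apply] at this
    rw [hP]; nlinarith
  set κ := (conj p * F.a γ0).re / F.c γ0 - P * F.c γ0 / 2 with hκ
  have hκ' : (conj p * F.a γ0).re = κ * F.c γ0 + P * F.c γ0 ^ 2 / 2 := by rw [hκ]; field_simp; ring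
  have ha : ∀ γ ∈ Γ, (conj p * F.a γ).re = κ * F.c γ + P * F.c γ ^ 2 / 2 := by
    intro γ hγ
    have := (h.rel hG hN hγ hγ0 (hl γ hγ) (hr γ hγ) (hl _ hγ0) (hr _ hγ0)).2
    rw [hw γ hγ, hw0] at this
    apply mul_right_cancel₀ hc0
    simp at this hκ'
    simp only [Complex.mul_re, Complex.conj_re, Complex.conj_im]
    linear_combination -this + F.c γ * hκ' + (F.c γ ^ 2 * F.c γ0 - F.c γ * F.c γ0 ^ 2) / 2 * hP
  let f : E4 → ℝ := fun x => (conj p * F.Z x).re - κ * F.V x - P / 2 * F.V x ^ 2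
  have hf : Continuous f := by
    have h1 := F.cont_V
    have h2 := F.cont_Z
    have h3 := Complex.continuous_re
    exact ((h3.comp (continuous_const.mul h2)).sub (continuous_const.mul h1)).sub (continuous_const.mul (h1.pow 2))
  have hinv : ∀ γ ∈ Γ, ∀ x, f (γ x) = f x := by
    intro γ hγ x
    have e := ha γ hγ
    simp only [f]
    rw [h.Vap hγ, h.Zap hγ, hl γ hγ, hr γ hγ, hw γ hγ]
    simp at e ⊢
    linear_combination e + (-F.c γ * F.V x) * hP
  obtain ⟨M, hM⟩ := hG.inv_bdd hf hinv
  obtain ⟨x, x1, x2, x3⟩ := F.surj 0 (((|M| + 1) / P : ℝ) * p) 0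
  have := hM x
  simp only [f] at this
  rw [x2, x3] at this
  have h4 : (conj p * (((|M| + 1) / P : ℝ) * p)).re = |M| + 1 := by
    have : (conj p * (((|M| + 1) / P : ℝ) * p)).re = ((|M| + 1) / P) * P := by
      rw [hP, Complex.mul_re, Complex.re_ofReal_mul, Complex.im_ofReal_mul, Complex.conj_re, Complex.conj_im]; ring
    rw [this]; field_simp
  rw [h4] at this
  have := le_abs_self M
  linarith

theorem exists_c (h : F.RT Γ) (hG : Good Γ) (hl : ∀ γ ∈ Γ, F.l γ = 1) : ∃ γ ∈ Γ, F.c γ ≠ 0 := by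
  by_contra hcon
  push Not at hcon
  refine V_hyp (F := F) hG 0 ?_
  intro γ hγ x hx
  rw [h.Vap hγ, hx, hcon γ hγ]; simp

theorem case_iib (h : F.RT Γ) (hG : Good Γ) (hN : NoTrans Γ)
    (hl : ∀ γ ∈ Γ, F.l γ = 1) {γ0 : AffGroup 4} (hγ0 : γ0 ∈ Γ) (hr0 : F.r γ0 ≠ 1)
    {ν : AffGroup 4} (hν : ν ∈ Γ) (hν1 : ν ≠ 1) (hrν : F.r ν = 1) : False := by
  have hw : F.w ν ≠ 0 := fun h0 => hν1 (h.w0 hG hN hν (hl ν hν) hrν h0)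
  have key : ∀ γ ∈ Γ, F.w (γ * ν * γ⁻¹) = F.r γ * F.w ν ∧ F.c (γ * ν * γ⁻¹) = F.c ν ∧
      F.a (γ * ν * γ⁻¹) = F.r γ * F.a ν + F.w γ * F.c ν - F.r γ * F.w ν * F.c γ := by
    intro γ hγ
    set ν' := γ * ν * γ⁻¹ with hν'
    have hm : ν' ∈ Γ := Γ.mul_mem (Γ.mul_mem hγ hν) (Γ.inv_mem hγ)
    have hcj := h.conj hγ hν (hl ν hν) hrν
    have heq : ν' * γ = γ * ν := by rw [hν']; group
    have w1 := (h.mul hm hγ).2.2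
    have w2 := (h.mul hγ hν).2.2
    have c1 := h.c_mul hm γ
    have c2 := h.c_mul hγ ν
    have a1 := h.a_mul hm γ
    have a2 := h.a_mul hγ ν
    rw [heq] at w1 c1 a1
    rw [w2, hcj.2, hl γ hγ, hl ν hν] at w1
    rw [c2, hcj.1, hl γ hγ] at c1
    rw [a2, hcj.2] at a1
    have w3 : F.w ν' = F.r γ * F.w ν := by push_cast at w1; linear_combination -w1
    refine ⟨w3, by linarith, ?_⟩
    rw [w3] at a1
    linear_combination -a1
  have rel : ∀ γ ∈ Γ, _ := fun γ hγ => h.rel hG hN hν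
    (Γ.mul_mem (Γ.mul_mem hγ hν) (Γ.inv_mem hγ)) (hl ν hν) hrν (h.conj hγ hν (hl ν hν) hrν).1
    (h.conj hγ hν (hl ν hν) hrν).2
  have hc : F.c ν = 0 := by
    have := (rel γ0 hγ0).1
    rw [(key γ0 hγ0).1, (key γ0 hγ0).2.1] at this
    have h2 : F.w ν * (1 - F.r γ0) * F.c ν = 0 := by linear_combination this
    rcases mul_eq_zero.mp h2 with h0 | h0
    · rcases mul_eq_zero.mp h0 with h0 | h0
      · exact absurd h0 hw
      · exact absurd (sub_eq_zero.mp h0).symm hr0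
    · exact_mod_cast h0
  set W := (F.w ν).re ^ 2 + (F.w ν).im ^ 2 with hW
  have hWpos : 0 < W := by
    have := Complex.normSq_pos.mpr hw
    rw [Complex.normSq_apply] at this
    rw [hW]; nlinarith
  set I := (conj (F.w ν) * F.a ν).im with hI
  have rel2 : ∀ γ ∈ Γ, -2 * (F.r γ).im * I = F.c γ * W * (F.r γ).re := by
    intro γ hγ
    have e := (rel γ hγ).2
    rw [(key γ hγ).1, (key γ hγ).2.1, (key γ hγ).2.2, hc] at e
    rw [hI, hW]
    simp at e ⊢
    linear_combination e
  have alt : ∀ γ ∈ Γ, F.c γ = 0 ∨ (F.r γ).im = 0 := by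
    intro γ hγ
    have e1 := rel2 γ hγ
    have e2 := rel2 (γ * γ) (Γ.mul_mem hγ hγ)
    rw [(h.mul hγ hγ).2.1, h.c_mul hγ, hl γ hγ] at e2
    simp at e2
    have : W * (F.c γ * ((F.r γ).im * (F.r γ).im)) = 0 := by
      linear_combination e2 / 2 - (F.r γ).re * e1
    rcases mul_eq_zero.mp this with h0 | h0
    · exact absurd h0 hWpos.ne'
    rcases mul_eq_zero.mp h0 with h0 | h0
    · left; exact h0
    · right; exact mul_self_eq_zero.mp h0
  have nrm : ∀ γ ∈ Γ, (F.r γ).im = 0 → F.r γ = 1 ∨ F.r γ = -1 := by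
    intro γ hγ h0
    have := (h.ty hγ).nrm
    have e : F.r γ = ((F.r γ).re : ℂ) := Complex.ext (by simp) (by simp [h0])
    rw [e, Complex.norm_real, Real.norm_eq_abs] at this
    rcases eq_or_eq_neg_of_abs_eq this with h1 | h1
    · left; rw [e, h1]; simp
    · right; rw [e, h1]; simp
  have two := two_pred alt
    (by intro γ hγ δ hδ h1 h2
        rw [h.c_mul hγ, h1] at h2; simpa using h2)
    (by intro γ hγ δ hδ h1 h2
        rw [(h.mul hγ hδ).2.1] at h2
        rcases nrm γ hγ h1 with h3 | h3 <;> rw [h3] at h2 <;> simpa using h2)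
  obtain ⟨γ1, hγ1, hc1⟩ := exists_c h hG hl
  rcases two with t | t
  · exact hc1 (t γ1 hγ1)
  let H : Subgroup (AffGroup 4) :=
    { carrier := {γ | γ ∈ Γ ∧ F.r γ = 1}
      one_mem' := ⟨Γ.one_mem, h.one.2.1⟩
      mul_mem' := by
        rintro a b ⟨ha, ha'⟩ ⟨hb, hb'⟩
        exact ⟨Γ.mul_mem ha hb, by rw [(h.mul ha hb).2.1, ha', hb', one_mul]⟩
      inv_mem' := by
        rintro a ⟨ha, ha'⟩
        exact ⟨Γ.inv_mem ha, by rw [(h.inv ha).2, ha', inv_one]⟩ }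
  have hle : H ≤ Γ := fun γ h => h.1
  have hH : Good H := by
    apply hG.of_two hle
    intro γ hγ δ hδ h1 h2
    refine ⟨Γ.mul_mem hγ hδ, ?_⟩
    have a1 := (nrm γ hγ (t γ hγ)).resolve_left (fun h => h1 ⟨hγ, h⟩)
    have a2 := (nrm δ hδ (t δ hδ)).resolve_left (fun h => h2 ⟨hδ, h⟩)
    rw [(h.mul hγ hδ).2.1, a1, a2]; norm_num
  obtain ⟨γ2, hγ2, hc2⟩ := exists_c (h.sub hle) hH (fun γ hγ => hl γ hγ.1)
  exact case_iia (h.sub hle) hH (hN.sub hle) (fun γ hγ => hγ.2) (fun γ hγ => hl γ hγ.1) hγ2 hc2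

theorem case_iic (h : F.RT Γ) (hG : Good Γ)
    (hl : ∀ γ ∈ Γ, F.l γ = 1) {γ0 : AffGroup 4} (hγ0 : γ0 ∈ Γ) (hr0 : F.r γ0 ≠ 1)
    (hN1 : ∀ ν ∈ Γ, F.r ν = 1 → ν = 1) : False := by
  have e0 : 1 - F.r γ0 ≠ 0 := by intro h0; apply hr0; rw [sub_eq_zero] at h0; exact h0.symm
  set α := F.w γ0 / (1 - F.r γ0) with hα
  set β := (F.a γ0 - α * F.c γ0) / (1 - F.r γ0) with hβ
  have hα' : F.w γ0 = (1 - F.r γ0) * α := by rw [hα]; field_simp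
  have hβ' : F.a γ0 - α * F.c γ0 = (1 - F.r γ0) * β := by rw [hβ]; field_simp
  have key : ∀ δ ∈ Γ, F.a δ = (1 - F.r δ) * β + α * F.c δ := by
    intro δ hδ
    obtain ⟨ν, hν, n1, n2, n3⟩ := h.comm_mem hγ0 hδ
    rw [hN1 ν hν n2, one_mul] at n3
    have w1 := (h.mul hγ0 hδ).2.2
    have a1 := h.a_mul hγ0 δ
    rw [n3, (h.mul hδ hγ0).2.2, hl δ hδ, hl γ0 hγ0] at w1
    rw [n3, h.a_mul hδ γ0] at a1
    have w2 : F.w δ = (1 - F.r δ) * α := by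
      apply mul_left_cancel₀ e0
      push_cast at w1
      linear_combination w1 + (1 - F.r δ) * hα'
    rw [w2] at a1
    apply mul_left_cancel₀ e0
    linear_combination a1 + (1 - F.r δ) * hβ' + F.c δ * hα'
  obtain ⟨x, x1, x2, x3⟩ := F.surj 0 β 0
  let L : E4 →ₗ[ℝ] ℝ :=
    { toFun := fun x => (F.Z x - α * F.V x).re
      map_add' := fun x y => by simp; ring
      map_smul' := fun c x => by simp; ring }
  refine no_hyperplane hG (LinearMap.toContinuousLinearMap L) ?_ β.re x ?_
  · intro h0
    obtain ⟨y, y1, y2, y3⟩ := F.surj 0 1 0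
    have h1 : (LinearMap.toContinuousLinearMap L) y = 0 := by rw [h0]; rfl
    have h2 : (F.Z y - α * F.V y).re = 0 := h1
    rw [y2, y3] at h2
    simp at h2
  · intro γ hγ
    show (F.Z (γ x) - α * F.V (γ x)).re = β.re
    rw [h.Zap hγ, h.Vap hγ, x2, x3, key γ hγ, hl γ hγ]
    congr 1
    push_cast
    ring

end Frame

theorem no_noTrans {Γ : Subgroup (AffGroup 4)} (hG : Good1 Γ) (hN : NoTrans Γ) : False := by
  obtain ⟨n, hn, hn3, H, hle, hH, hfix⟩ := null_line hG hN
  obtain ⟨F⟩ := frame_exists hn hn3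
  obtain ⟨H2, hle2, hH2, hR, -⟩ := F.rot_sub hH hfix
  have hN2 := (hN.sub hle).sub hle2
  rcases hR.lr_all hH2.toGood with hl | hr
  · by_cases hr : ∀ γ ∈ H2, F.r γ = 1
    · obtain ⟨γ, hγ, hc⟩ := Frame.exists_c hR hH2.toGood hl
      exact Frame.case_iia hR hH2.toGood hN2 hr hl hγ hc
    push Not at hr
    obtain ⟨γ0, hγ0, hr0⟩ := hr
    by_cases hν : ∀ ν ∈ H2, F.r ν = 1 → ν = 1
    · exact Frame.case_iic hR hH2.toGood hl hγ0 hr0 hν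
    push Not at hν
    obtain ⟨ν, hν, h1, h2⟩ := hν
    exact Frame.case_iib hR hH2.toGood hN2 hl hγ0 hr0 hν h2 h1
  · by_cases hl : ∀ γ ∈ H2, F.l γ = 1
    · obtain ⟨γ, hγ, hc⟩ := Frame.exists_c hR hH2.toGood hl
      exact Frame.case_iia hR hH2.toGood hN2 hr hl hγ hc
    push Not at hl
    obtain ⟨γ, hγ, hl⟩ := hl
    exact Frame.case_i hR hH2.toGood hN2 hr hγ hl
end

noncomputable section
open Set Topology Filter ComplexConjugate
open scoped Pointwise

def FO (Γ : Subgroup (AffGroup 4)) (a : E4) : Prop := {y | ∃ γ ∈ Γ, γ.linear a = y}.Finite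

theorem FO_two {Γ H : Subgroup (AffGroup 4)} (h2 : ∀ γ ∈ Γ, ∀ δ ∈ Γ, γ ∉ H → δ ∉ H → γ * δ ∈ H)
    {a : E4} (h : FO H a) : FO Γ a := by
  by_cases hex : ∃ γ0 ∈ Γ, γ0 ∉ H
  · obtain ⟨γ0, h0, h0'⟩ := hex
    refine (h.union (h.image γ0⁻¹.linear)).subset ?_
    rintro y ⟨γ, hγ, rfl⟩
    by_cases hγH : γ ∈ H
    · left; exact ⟨γ, hγH, rfl⟩
    · right
      refine ⟨(γ0 * γ).linear a, ⟨γ0 * γ, h2 _ h0 _ hγ h0' hγH, rfl⟩, ?_⟩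
      rw [mul_lin, inv_lin]
  · push Not at hex
    refine h.subset ?_
    rintro y ⟨γ, hγ, rfl⟩
    exact ⟨γ, hex γ hγ, rfl⟩

def TL (Γ : Subgroup (AffGroup 4)) : AddSubgroup E4 where
  carrier := {a | ∃ τ ∈ Γ, ∀ x, τ x = x + a}
  zero_mem' := ⟨1, Γ.one_mem, fun x => by rw [one_ap, add_zero]⟩
  add_mem' := by
    rintro a b ⟨τ, h1, h2⟩ ⟨σ, h3, h4⟩
    exact ⟨τ * σ, Γ.mul_mem h1 h3, fun x => by rw [mul_ap, h2, h4]; abel⟩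
  neg_mem' := by
    rintro a ⟨τ, h1, h2⟩
    refine ⟨τ⁻¹, Γ.inv_mem h1, fun x => ?_⟩
    have := inv_ap τ (x + -a)
    rwa [h2, neg_add_cancel_right] at this

theorem Lat_mono {H Γ : Subgroup (AffGroup 4)} (h : H ≤ Γ) {a : E4} (ha : a ∈ TL H) : a ∈ TL Γ := by
  obtain ⟨τ, h1, h2⟩ := ha
  exact ⟨τ, h h1, h2⟩

theorem Lat_inv {Γ : Subgroup (AffGroup 4)} {γ : AffGroup 4} (hγ : γ ∈ Γ) {a : E4} (ha : a ∈ TL Γ) :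
    γ.linear a ∈ TL Γ := by
  obtain ⟨τ, h1, h2⟩ := ha
  refine ⟨γ * τ * γ⁻¹, Γ.mul_mem (Γ.mul_mem hγ h1) (Γ.inv_mem hγ), fun x => ?_⟩
  rw [mul_ap, mul_ap, h2, aff_apply, map_add, add_right_comm, ← aff_apply, ap_inv]

theorem Lat_lin {Γ : Subgroup (AffGroup 4)} {γ : AffGroup 4} (hγ : γ ∈ Γ) (h : ∀ x, γ.linear x = x) :
    γ 0 ∈ TL Γ := ⟨γ, hγ, fun x => by rw [aff_apply, h]⟩

theorem Good.lat_fin {Γ : Subgroup (AffGroup 4)} (hG : Good Γ) (R : ℝ) : {a | a ∈ TL Γ ∧ ‖a‖ ≤ R}.Finite := by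
  have hf := hG.pd (Metric.closedBall 0 |R|) (isCompact_closedBall _ _)
  refine (hf.image (fun γ : AffGroup 4 => γ 0)).subset ?_
  rintro a ⟨⟨τ, h1, h2⟩, hR⟩
  have h0 : τ 0 = a := by rw [h2, zero_add]
  refine ⟨τ, ⟨h1, a, ⟨0, by simp, h0⟩, ?_⟩, h0⟩
  rw [mem_closedBall_zero_iff]
  exact hR.trans (le_abs_self R)

theorem exists_lat {Γ : Subgroup (AffGroup 4)} (hG : Good1 Γ) : ∃ a ∈ TL Γ, a ≠ 0 := by
  by_contra hcon
  push Not at hcon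
  refine no_noTrans hG ?_
  intro γ hγ hl
  have := hcon _ (Lat_lin hγ hl)
  apply aff_ext
  intro x
  rw [aff_apply, hl, this, one_ap, add_zero]

/-- real span -/
def LV (Γ : Subgroup (AffGroup 4)) : Submodule ℝ E4 := Submodule.span ℝ (TL Γ : Set E4)

theorem Lat_le {Γ : Subgroup (AffGroup 4)} {a : E4} (ha : a ∈ TL Γ) : a ∈ LV Γ := Submodule.subset_span ha

theorem LV_le {Γ : Subgroup (AffGroup 4)} {p : Submodule ℝ E4} (h : ∀ a ∈ TL Γ, a ∈ p) {x : E4} (hx : x ∈ LV Γ) :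
    x ∈ p := (Submodule.span_le (p := p)).mpr h hx

theorem LV_inv {Γ : Subgroup (AffGroup 4)} {γ : AffGroup 4} (hγ : γ ∈ Γ) {a : E4} (ha : a ∈ LV Γ) :
    γ.linear a ∈ LV Γ := by
  exact LV_le (p := (LV Γ).comap (γ.linear : E4 →ₗ[ℝ] E4)) (fun b hb => Lat_le (Lat_inv hγ hb)) ha

theorem lat_cocompact (Γ : Subgroup (AffGroup 4)) : ∃ C : Set E4, IsCompact C ∧
    ∀ v ∈ LV Γ, ∃ a ∈ TL Γ, v - a ∈ C := by
  have hfg : (LV Γ).FG := IsNoetherian.noetherian _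
  rw [LV, Submodule.fg_span_iff_fg_span_finset_subset] at hfg
  obtain ⟨s, hs, hsp⟩ := hfg
  refine ⟨(fun t : s → ℝ => ∑ i, t i • (i : E4)) '' (Set.univ.pi fun _ => Set.Icc 0 1),
    (isCompact_univ_pi fun _ => isCompact_Icc).image (by fun_prop), ?_⟩
  intro v hv
  rw [LV, hsp, ← Set.image_id (s : Set E4)] at hv
  obtain ⟨t, ht⟩ : ∃ t : s → ℝ, ∑ i, t i • (i : E4) = v := by
    rw [Set.image_id, Submodule.mem_span_finset'] at hv
    exact hv
  refine ⟨∑ i, ⌊t i⌋ • (i : E4), AddSubgroup.sum_mem _ fun i _ => AddSubgroup.zsmul_mem _ (hs i.2) _, ?_⟩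
  refine ⟨fun i => Int.fract (t i), fun i _ => ⟨Int.fract_nonneg _, (Int.fract_lt_one _).le⟩, ?_⟩
  simp only [Int.fract]
  rw [← ht, ← Finset.sum_sub_distrib]
  refine Finset.sum_congr rfl fun i _ => ?_
  rw [sub_smul, Int.cast_smul_eq_zsmul]

theorem Good.FL {Γ : Subgroup (AffGroup 4)} (hG : Good Γ) {K : Set E4} (hK : IsCompact K) :
    ∃ F : Set (AffGroup 4), F.Finite ∧ ∀ γ ∈ Γ, (∃ v ∈ LV Γ, γ 0 - v ∈ K) →
      ∃ f ∈ F, ∃ a ∈ TL Γ, ∀ x, γ x = f x + a := by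
  obtain ⟨C, hC, hC'⟩ := lat_cocompact Γ
  have hD : IsCompact (insert 0 (C + K)) := (hC.add hK).insert 0
  refine ⟨_, hG.pd _ hD, ?_⟩
  rintro γ hγ ⟨v, hv, hvK⟩
  obtain ⟨a, ha, hvC⟩ := hC' v hv
  obtain ⟨τ, h1, h2⟩ := (TL Γ).neg_mem ha
  refine ⟨τ * γ, ⟨Γ.mul_mem h1 hγ, (τ * γ) 0, ⟨0, by simp, rfl⟩, ?_⟩, a, ha, ?_⟩
  · right
    rw [mul_ap, h2]
    refine ⟨v - a, hvC, γ 0 - v, hvK, ?_⟩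
    simp only
    abel
  · intro x
    rw [mul_ap, h2]; abel

theorem lin_of_trans {γ f : AffGroup 4} {a : E4} (h : ∀ x, γ x = f x + a) (x : E4) : γ.linear x = f.linear x := by
  have h1 := aff_apply γ x
  have h2 := aff_apply f x
  rw [h, h 0, h2] at h1
  have : f.linear x + (f 0 + a) = γ.linear x + (f 0 + a) := by rw [← h1]; abel
  exact (add_right_cancel this).symm

theorem pd_bound (p : Submodule ℝ E4) (hp : ∀ v ∈ p, v ≠ 0 → 0 < Bf v v) :
    ∃ c : ℝ, 0 < c ∧ ∀ v ∈ p, c * ‖v‖ ^ 2 ≤ Bf v v := by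
  have hS : IsCompact (Metric.sphere (0 : E4) 1 ∩ p) :=
    (isCompact_sphere _ _).inter_right p.closed_of_finiteDimensional
  have hB : Continuous fun v : E4 => Bf v v := Bf_cont.comp (continuous_id.prodMk continuous_id)
  have key : ∃ c : ℝ, 0 < c ∧ ∀ v ∈ Metric.sphere (0 : E4) 1 ∩ p, c ≤ Bf v v := by
    rcases (Metric.sphere (0 : E4) 1 ∩ p).eq_empty_or_nonempty with h | h
    · exact ⟨1, one_pos, by rw [h]; simp⟩
    · obtain ⟨v, hv, hmin⟩ := hS.exists_isMinOn h hB.continuousOn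
      refine ⟨Bf v v, hp v hv.2 ?_, fun w hw => hmin hw⟩
      intro h0
      have := hv.1
      rw [h0] at this; simp at this
  obtain ⟨c, hc, h⟩ := key
  refine ⟨c, hc, fun v hv => ?_⟩
  by_cases h0 : v = 0
  · rw [h0]; simp [Bf_zero_left]
  have hn : 0 < ‖v‖ := norm_pos_iff.mpr h0
  have := h (‖v‖⁻¹ • v) ⟨by rw [mem_sphere_zero_iff_norm, norm_smul, norm_inv, norm_norm]; field_simp, p.smul_mem _ hv⟩
  rw [Bf_smul_left, Bf_smul_right] at this
  field_simp at this
  linarith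

theorem case_a {Γ : Subgroup (AffGroup 4)} (hG : Good1 Γ) (hp : ∀ v ∈ LV Γ, v ≠ 0 → 0 < Bf v v) :
    ∃ a ∈ TL Γ, a ≠ 0 ∧ FO Γ a := by
  obtain ⟨a, ha, ha0⟩ := exists_lat hG
  obtain ⟨c, hc, hb⟩ := pd_bound _ hp
  refine ⟨a, ha, ha0, (hG.toGood.lat_fin (√(Bf a a / c))).subset ?_⟩
  rintro y ⟨γ, hγ, rfl⟩
  have hm := Lat_inv hγ ha
  refine ⟨hm, ?_⟩
  apply Real.le_sqrt_of_sq_le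
  have := hb _ (Lat_le hm)
  rw [hG.lor γ hγ] at this
  rw [le_div_iff₀ hc]; linarith
end

noncomputable section
open Set Topology Filter ComplexConjugate

theorem Frame.lat_fin {n : E4} (F : Frame n) {Γ : Subgroup (AffGroup 4)} (hG : Good Γ) (a b c : ℝ) :
    {x | x ∈ TL Γ ∧ |F.U x| ≤ a ∧ ‖F.Z x‖ ≤ b ∧ |F.V x| ≤ c}.Finite := by
  let f : E4 →ₗ[ℝ] ℝ × ℂ × ℝ := F.U.prod (F.Z.prod F.V)
  have hf : LinearMap.ker f = ⊥ := by
    rw [LinearMap.ker_eq_bot]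
    intro x y h
    have h1 : (F.U x, F.Z x, F.V x) = (F.U y, F.Z y, F.V y) := h
    simp only [Prod.mk.injEq] at h1
    exact F.inj h1.1 h1.2.1 h1.2.2
  obtain ⟨K, hK, hf'⟩ := f.exists_antilipschitzWith hf
  refine (hG.lat_fin (K * max a (max b c))).subset ?_
  rintro x ⟨hx, h1, h2, h3⟩
  refine ⟨hx, ?_⟩
  have h4 := hf'.le_mul_dist x 0
  rw [map_zero, dist_zero_right, dist_zero_right] at h4
  refine h4.trans (mul_le_mul_of_nonneg_left ?_ K.2)
  change ‖(F.U x, F.Z x, F.V x)‖ ≤ _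
  rw [Prod.norm_mk, Prod.norm_mk]
  exact max_le_max h1 (max_le_max h2 h3)

theorem periodic_of {A : E4 → E4} (hA : Function.Injective A) {S : Set E4} (hS : S.Finite) {x : E4}
    (h : ∀ j : ℕ, A^[j] x ∈ S) : ∃ m > 0, A^[m] x = x := by
  by_contra hcon
  push Not at hcon
  refine Set.infinite_of_injective_forall_mem (f := fun j : ℕ => A^[j] x) ?_ h hS
  have key : ∀ i k : ℕ, 0 < k → A^[i] x ≠ A^[i + k] x := by
    intro i k hk he
    rw [Function.iterate_add_apply] at he
    exact hcon k hk ((hA.iterate i) he).symm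
  intro i j hij
  rcases lt_trichotomy i j with hl | hl | hl
  · obtain ⟨k, rfl⟩ := Nat.exists_eq_add_of_lt hl
    exact absurd hij (key i (k+1) (by omega))
  · exact hl
  · obtain ⟨k, rfl⟩ := Nat.exists_eq_add_of_lt hl
    exact absurd hij.symm (key j (k+1) (by omega))

def perMod (A : E4 →ₗ[ℝ] E4) : Submodule ℝ E4 where
  carrier := {x | ∃ m > 0, Function.IsPeriodicPt A m x}
  zero_mem' := ⟨1, one_pos, by simp [Function.IsPeriodicPt, Function.IsFixedPt]⟩
  add_mem' := by
    rintro x y ⟨m, hm, h1⟩ ⟨k, hk, h2⟩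
    refine ⟨m * k, Nat.mul_pos hm hk, ?_⟩
    have h3 := h1.mul_const k
    have h4 := h2.const_mul m
    rw [Function.IsPeriodicPt, Function.IsFixedPt] at *
    rw [iterate_map_add, h3, h4]
  smul_mem' := by
    rintro c x ⟨m, hm, h1⟩
    refine ⟨m, hm, ?_⟩
    rw [Function.IsPeriodicPt, Function.IsFixedPt] at *
    rw [← Module.End.pow_apply] at h1 ⊢
    rw [map_smul, h1]

theorem Lat_iter {Γ : Subgroup (AffGroup 4)} {γ : AffGroup 4} (hγ : γ ∈ Γ) {a : E4} (ha : a ∈ TL Γ) (j : ℕ) :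
    (γ.linear : E4 → E4)^[j] a ∈ TL Γ := by
  induction j with
  | zero => exact ha
  | succ j ih => rw [Function.iterate_succ_apply']; exact Lat_inv hγ ih

theorem Frame.Ty.n_ap {n : E4} {F : Frame n} {A : E4 →ₗ[ℝ] E4} {l : ℝ} {ρ w : ℂ} (h : F.Ty A l ρ w)
    (hA : ∀ x y, Bf (A x) (A y) = Bf x y) : A n = l • n := by
  apply F.inj
  · rw [h.U hA, map_smul, F.Un, F.Zn, F.Vn]; simp
  · rw [h.Z, map_smul, F.Zn, F.Vn]; simp
  · rw [h.V, map_smul, F.Vn]; simp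

theorem Frame.eq_smul {n : E4} (F : Frame n) {x : E4} (h1 : F.Z x = 0) (h2 : F.V x = 0) : x = F.U x • n := by
  apply F.inj
  · rw [map_smul, F.Un, smul_eq_mul, mul_one]
  · rw [map_smul, F.Zn, h1, smul_zero]
  · rw [map_smul, F.Vn, h2, smul_zero]

/-- no contraction on the null line -/
theorem b_l {Γ : Subgroup (AffGroup 4)} (hG : Good Γ) {n : E4} (F : Frame n) (hV : ∀ x ∈ LV Γ, F.V x = 0)
    (hn : n ∈ LV Γ) {γ : AffGroup 4} (hγ : γ ∈ Γ) {l : ℝ} {ρ w : ℂ} (h : F.Ty (γ.linear : E4 →ₗ[ℝ] E4) l ρ w)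
    (hl : l < 1) : False := by
  have hA : ∀ x y, Bf ((γ.linear : E4 →ₗ[ℝ] E4) x) ((γ.linear : E4 →ₗ[ℝ] E4) y) = Bf x y := fun x y => hG.lor γ hγ x y
  have h0 := h.pos
  have hper : n ∈ perMod (γ.linear : E4 →ₗ[ℝ] E4) := by
    refine LV_le ?_ hn
    intro a ha
    have hV' : ∀ j : ℕ, F.V ((γ.linear : E4 → E4)^[j] a) = 0 := fun j => hV _ (Lat_le (Lat_iter hγ ha j))
    have hZ : ∀ j : ℕ, ‖F.Z ((γ.linear : E4 → E4)^[j] a)‖ = ‖F.Z a‖ := by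
      intro j
      induction j with
      | zero => rfl
      | succ j ih =>
        rw [Function.iterate_succ_apply']
        have := h.Z ((γ.linear : E4 → E4)^[j] a)
        rw [hV' j] at this
        erw [this]
        rw [Complex.ofReal_zero, mul_zero, add_zero, norm_mul, h.nrm, one_mul, ih]
    obtain ⟨M, hM1, hM2⟩ : ∃ M : ℝ, |F.U a| ≤ M ∧ l * (M + ‖w‖ * ‖F.Z a‖) ≤ M := by
      refine ⟨max |F.U a| (l * (‖w‖ * ‖F.Z a‖) / (1 - l)), le_max_left _ _, ?_⟩
      have := le_max_right |F.U a| (l * (‖w‖ * ‖F.Z a‖) / (1 - l))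
      rw [div_le_iff₀ (by linarith)] at this
      linarith
    have hU : ∀ j : ℕ, |F.U ((γ.linear : E4 → E4)^[j] a)| ≤ M := by
      intro j
      induction j with
      | zero => exact hM1
      | succ j ih =>
        rw [Function.iterate_succ_apply']
        have e := h.U hA ((γ.linear : E4 → E4)^[j] a)
        erw [e]
        rw [hV' j, mul_zero, sub_zero, abs_mul, abs_of_pos h0]
        refine le_trans (mul_le_mul_of_nonneg_left ?_ h0.le) hM2
        refine (abs_sub _ _).trans (add_le_add ih ?_)
        refine (Complex.abs_re_le_norm _).trans ?_
        rw [norm_mul, norm_mul, Complex.norm_conj, h.nrm, mul_one, hZ]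
    obtain ⟨m, hm, h1⟩ := periodic_of γ.linear.injective (F.lat_fin hG M ‖F.Z a‖ 0)
      (x := a) (fun j => ⟨Lat_iter hγ ha j, hU j, (hZ j).le, by rw [hV' j, abs_zero]⟩)
    exact ⟨m, hm, h1⟩
  obtain ⟨m, hm, hp⟩ := hper
  have hA' := h.n_ap hA
  have hit : ∀ j : ℕ, (γ.linear : E4 →ₗ[ℝ] E4)^[j] n = l ^ j • n := by
    intro j
    induction j with
    | zero => simp
    | succ j ih => rw [Function.iterate_succ_apply', ih, map_smul, hA', smul_smul, pow_succ]
  have h2 := hit m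
  rw [hp] at h2
  have h3 := congrArg F.U h2
  rw [map_smul, F.Un, smul_eq_mul, mul_one] at h3
  have := pow_lt_one₀ h0.le hl hm.ne'
  linarith

/-- rotation produces a lattice vector on the null line -/
theorem b_r {Γ : Subgroup (AffGroup 4)} (hG : Good Γ) {n : E4} (F : Frame n) (hV : ∀ x ∈ LV Γ, F.V x = 0)
    (hn : n ∈ LV Γ) {γ : AffGroup 4} (hγ : γ ∈ Γ) {ρ w : ℂ} (h : F.Ty (γ.linear : E4 →ₗ[ℝ] E4) 1 ρ w)
    (hr : ρ ≠ 1) : ∃ a ∈ TL Γ, a ≠ 0 ∧ ∃ c : ℝ, a = c • n := by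
  have hA : ∀ x y, Bf ((γ.linear : E4 →ₗ[ℝ] E4) x) ((γ.linear : E4 →ₗ[ℝ] E4) y) = Bf x y := fun x y => hG.lor γ hγ x y
  have hr' : ρ - 1 ≠ 0 := sub_ne_zero.mpr hr
  set c : ℂ := conj w * ρ / (ρ - 1) with hc
  let g : E4 →ₗ[ℝ] ℝ := F.U + Complex.reLm ∘ₗ ((LinearMap.mulLeft ℝ c) ∘ₗ F.Z)
  have hg : ∀ x, g x = F.U x + (c * F.Z x).re := fun x => rfl
  have hgi : ∀ x, F.V x = 0 → g (γ.linear x) = g x := by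
    intro x hx
    have e1 := h.U hA x
    have e2 := h.Z x
    rw [hx] at e1 e2
    rw [hg, hg]
    erw [e1, e2]
    have : c * (ρ * F.Z x + w * (0:ℝ)) = c * F.Z x + conj w * ρ * F.Z x := by
      rw [hc]; field_simp; push_cast; ring
    rw [this, Complex.add_re]; ring
  have hgn : g n = 1 := by rw [hg, F.Un, F.Zn]; simp
  obtain ⟨a, ha, hga⟩ : ∃ a ∈ TL Γ, g a ≠ 0 := by
    by_contra hcon
    push Not at hcon
    have : n ∈ LinearMap.ker g := LV_le (fun a ha => hcon a ha) hn
    rw [LinearMap.mem_ker, hgn] at this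
    exact one_ne_zero this
  have hV' : ∀ j : ℕ, F.V ((γ.linear : E4 → E4)^[j] a) = 0 := fun j => hV _ (Lat_le (Lat_iter hγ ha j))
  have hZ : ∀ j : ℕ, ‖F.Z ((γ.linear : E4 → E4)^[j] a)‖ = ‖F.Z a‖ := by
    intro j
    induction j with
    | zero => rfl
    | succ j ih =>
      rw [Function.iterate_succ_apply']
      have := h.Z ((γ.linear : E4 → E4)^[j] a)
      rw [hV' j] at this
      erw [this]
      rw [Complex.ofReal_zero, mul_zero, add_zero, norm_mul, h.nrm, one_mul, ih]
  have hgj : ∀ j : ℕ, g ((γ.linear : E4 → E4)^[j] a) = g a := by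
    intro j
    induction j with
    | zero => rfl
    | succ j ih => rw [Function.iterate_succ_apply', hgi _ (hV' j), ih]
  have hU : ∀ j : ℕ, |F.U ((γ.linear : E4 → E4)^[j] a)| ≤ |g a| + ‖c‖ * ‖F.Z a‖ := by
    intro j
    have e := hgj j
    rw [hg] at e
    have : F.U ((γ.linear : E4 → E4)^[j] a) = g a - (c * F.Z ((γ.linear : E4 → E4)^[j] a)).re := by linarith
    rw [this]
    refine (abs_sub _ _).trans (add_le_add le_rfl ?_)
    refine (Complex.abs_re_le_norm _).trans ?_
    rw [norm_mul, hZ]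
  obtain ⟨m, hm, h1⟩ := periodic_of γ.linear.injective (F.lat_fin hG _ ‖F.Z a‖ 0)
      (x := a) (fun j => ⟨Lat_iter hγ ha j, hU j, (hZ j).le, by rw [hV' j, abs_zero]⟩)
  set s : E4 := ∑ j ∈ Finset.range m, (γ.linear : E4 → E4)^[j] a with hs
  have hsm : s ∈ TL Γ := AddSubgroup.sum_mem _ fun j _ => Lat_iter hγ ha j
  have hgs : g s = m * g a := by
    rw [hs, map_sum, Finset.sum_congr rfl (fun j _ => hgj j)]; simp
  have hfix : γ.linear s = s := by
    have e1 : γ.linear s = ∑ j ∈ Finset.range m, (γ.linear : E4 → E4)^[j+1] a := by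
      rw [hs, map_sum]
      exact Finset.sum_congr rfl fun j _ => (Function.iterate_succ_apply' _ _ _).symm
    have e2 := Finset.sum_range_succ (fun j => (γ.linear : E4 → E4)^[j] a) m
    have e3 := Finset.sum_range_succ' (fun j => (γ.linear : E4 → E4)^[j] a) m
    rw [e2, h1] at e3
    rw [e1]
    exact (add_right_cancel e3).symm
  have hsV : F.V s = 0 := hV _ (Lat_le hsm)
  have hsZ : F.Z s = 0 := by
    have e := h.Z s
    rw [hsV] at e
    erw [hfix] at e
    rw [Complex.ofReal_zero, mul_zero, add_zero] at e
    have : (ρ - 1) * F.Z s = 0 := by rw [sub_mul, one_mul, ← e, sub_self]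
    exact (mul_eq_zero.mp this).resolve_left hr'
  refine ⟨s, hsm, ?_, _, F.eq_smul hsZ hsV⟩
  intro h0
  rw [h0, map_zero] at hgs
  have : (m : ℝ) ≠ 0 := by exact_mod_cast hm.ne'
  exact (mul_ne_zero this hga) hgs.symm

theorem FO_fix {Γ : Subgroup (AffGroup 4)} {a : E4} (h : ∀ γ ∈ Γ, γ.linear a = a) : FO Γ a := by
  refine (Set.finite_singleton a).subset ?_
  rintro y ⟨γ, hγ, rfl⟩
  exact h γ hγ

theorem case_b {Γ : Subgroup (AffGroup 4)} (hG : Good1 Γ) (hp : ∀ v ∈ LV Γ, 0 ≤ Bf v v)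
    {n : E4} (hn : Nul n) (hnV : n ∈ LV Γ) :
    ∃ a ∈ TL Γ, a ≠ 0 ∧ FO Γ a := by
  wlog h3 : n 3 = 1 generalizing n
  · have h := hn.three
    refine this (n := (n 3)⁻¹ • n) ⟨smul_ne_zero (inv_ne_zero h) hn.1, ?_⟩ ((LV Γ).smul_mem _ hnV) ?_
    · rw [Bf_smul_left, Bf_smul_right, hn.2]; simp
    · simp [h]
  have horth : ∀ v ∈ LV Γ, Bf n v = 0 := by
    intro v hv
    by_contra h0
    have := hp (v + (-(Bf v v + 1) / (2 * Bf n v)) • n) ((LV Γ).add_mem hv ((LV Γ).smul_mem _ hnV))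
    simp only [Bf_add_left, Bf_add_right, Bf_smul_left, Bf_smul_right, hn.2, Bf_comm v n] at this
    have e : (-(Bf v v + 1) / (2 * Bf n v)) * Bf n v = -(Bf v v + 1) / 2 := by field_simp
    rw [e] at this
    linarith
  have hline : ∀ γ ∈ Γ, ∃ c : ℝ, γ.linear n = c • n := by
    intro γ hγ
    have h1 := hG.toGood.nul hγ hn
    refine null_par h1.2 hn.2 ?_ hn.1
    rw [Bf_comm]; exact horth _ (LV_inv hγ hnV)
  obtain ⟨F⟩ := frame_exists hn.2 h3
  obtain ⟨H, hle, hH, hRT, h2⟩ := F.rot_sub hG hline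
  have hV : ∀ x ∈ LV Γ, F.V x = 0 := fun x hx => by rw [F.V_eq]; exact horth x hx
  have hl : ∀ γ ∈ H, F.l γ = 1 := by
    intro γ hγ
    rcases lt_trichotomy (F.l γ) 1 with h | h | h
    · exact (b_l hG.toGood F hV hnV (hle hγ) (hRT.ty hγ) h).elim
    · exact h
    · have h' := hRT.ty (H.inv_mem hγ)
      rw [(hRT.inv hγ).1] at h'
      exact (b_l hG.toGood F hV hnV (hle (H.inv_mem hγ)) h' (inv_lt_one_of_one_lt₀ h)).elim
  have hfixn : ∀ γ ∈ H, γ.linear n = n := by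
    intro γ hγ
    have := (hRT.ty hγ).n_ap (fun x y => hH.lor γ hγ x y)
    rw [hl γ hγ, one_smul] at this
    exact this
  by_cases hex : ∃ a ∈ TL Γ, a ≠ 0 ∧ ∃ c : ℝ, a = c • n
  · obtain ⟨a, ha, ha0, c, hc⟩ := hex
    refine ⟨a, ha, ha0, FO_two h2 (FO_fix fun γ hγ => ?_)⟩
    rw [hc, map_smul, hfixn γ hγ]
  · have hr : ∀ γ ∈ H, F.r γ = 1 := by
      intro γ hγ
      by_contra hr
      have h' := hRT.ty hγ
      rw [hl γ hγ] at h'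
      exact hex (b_r hG.toGood F hV hnV (hle hγ) h' hr)
    obtain ⟨a, ha, ha0⟩ := exists_lat hG
    refine ⟨a, ha, ha0, FO_two h2 (FO_fix fun γ hγ => ?_)⟩
    by_contra hne
    refine hex ⟨γ.linear a - a, (TL Γ).sub_mem (Lat_inv (hle hγ) ha) ha, sub_ne_zero.mpr hne, _, F.eq_smul ?_ ?_⟩
    · have := (hRT.ty hγ).Z a
      rw [hr γ hγ, hV a (Lat_le ha), one_mul, Complex.ofReal_zero, mul_zero, add_zero] at this
      rw [map_sub]; erw [this]; exact sub_self _
    · exact hV _ ((LV Γ).sub_mem (LV_inv (hle hγ) (Lat_le ha)) (Lat_le ha))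
end

noncomputable section
open Set Topology Filter ComplexConjugate

theorem exists_orth {k : ℕ} (hk : k < 4) (f : Fin k → E4) : ∃ w : E4, w ≠ 0 ∧ ∀ i, Bf (f i) w = 0 := by
  let g : E4 →ₗ[ℝ] (Fin k → ℝ) := LinearMap.pi fun i => Bl (f i)
  have := LinearMap.ker_ne_bot_of_finrank_lt (f := g) (by simp [E4, hk])
  obtain ⟨w, hw, h0⟩ := Submodule.exists_mem_ne_zero_of_ne_bot this
  exact ⟨w, h0, fun i => congrFun hw i⟩

theorem cyc (S : AddSubgroup ℝ) {ε : ℝ} (hε : 0 < ε) (h : {s | s ∈ S ∧ |s| ≤ ε}.Finite) :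
    ∃ g ∈ S, ∀ s ∈ S, ∃ m : ℤ, s = m * g := by
  obtain ⟨a, ha, hd⟩ : ∃ a : ℝ, 0 < a ∧ ∀ s ∈ S, 0 < s → s < a → False := by
    have hf : {s | s ∈ S ∧ 0 < s ∧ s ≤ ε}.Finite := by
      refine h.subset ?_
      rintro s ⟨h1, h2, h3⟩
      exact ⟨h1, by rwa [abs_of_pos h2]⟩
    rcases {s | s ∈ S ∧ 0 < s ∧ s ≤ ε}.eq_empty_or_nonempty with he | he
    · refine ⟨ε, hε, fun s h1 h2 h3 => ?_⟩
      have : s ∈ {s | s ∈ S ∧ 0 < s ∧ s ≤ ε} := ⟨h1, h2, h3.le⟩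
      rw [he] at this; exact this
    · obtain ⟨a, ⟨h1, h2, h3⟩, hmin⟩ := Set.exists_min_image _ id hf he
      refine ⟨a, h2, fun s h4 h5 h6 => ?_⟩
      have : a ≤ s := hmin s ⟨h4, h5, (h6.le.trans h3)⟩
      linarith
  obtain ⟨g, hg⟩ := AddSubgroup.cyclic_of_isolated_zero (H := S) ha (by
    rw [Set.disjoint_left]
    rintro s h1 ⟨h2, h3⟩
    exact hd s h1 h2 h3)
  rw [← AddSubgroup.zmultiples_eq_closure] at hg
  refine ⟨g, by rw [hg]; exact AddSubgroup.mem_zmultiples g, fun s hs => ?_⟩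
  rw [hg, AddSubgroup.mem_zmultiples_iff] at hs
  obtain ⟨m, hm⟩ := hs
  exact ⟨m, by rw [← hm, zsmul_eq_mul]⟩

theorem hom_zpow {H : Subgroup (AffGroup 4)} {f : AffGroup 4 → ℝ}
    (hf : ∀ γ ∈ H, ∀ δ ∈ H, f (γ * δ) = f γ + f δ) {γ : AffGroup 4} (hγ : γ ∈ H) (m : ℤ) :
    f (γ ^ m) = m * f γ := by
  let F : Additive H →+ ℝ := AddMonoidHom.mk' (fun x => f (Additive.toMul x : H)) (fun x y => hf _ x.toMul.2 _ y.toMul.2)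
  have := map_zsmul F m (Additive.ofMul ⟨γ, hγ⟩)
  rw [zsmul_eq_mul] at this
  exact this

theorem hom_cyc {H : Subgroup (AffGroup 4)} {f : AffGroup 4 → ℝ}
    (hf : ∀ γ ∈ H, ∀ δ ∈ H, f (γ * δ) = f γ + f δ) {ε : ℝ} (hε : 0 < ε)
    (h : {s | ∃ γ ∈ H, f γ = s ∧ |s| ≤ ε}.Finite) : ∃ γ0 ∈ H, ∀ γ ∈ H, ∃ m : ℤ, f (γ * γ0 ^ m) = 0 := by
  let F : Additive H →+ ℝ := AddMonoidHom.mk' (fun x => f (Additive.toMul x : H)) (fun x y => hf _ x.toMul.2 _ y.toMul.2)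
  obtain ⟨g, ⟨γ0, hg⟩, hm⟩ := cyc F.range hε (by
    refine h.subset ?_
    rintro s ⟨⟨x, hx⟩, hs⟩
    exact ⟨(Additive.toMul x : H), x.toMul.2, hx, hs⟩)
  refine ⟨(Additive.toMul γ0 : H), γ0.toMul.2, fun γ hγ => ?_⟩
  obtain ⟨m, hm⟩ := hm (f γ) ⟨Additive.ofMul ⟨γ, hγ⟩, rfl⟩
  refine ⟨-m, ?_⟩
  rw [hf _ hγ _ (H.zpow_mem γ0.toMul.2 _), hom_zpow hf γ0.toMul.2]
  have : f (Additive.toMul γ0 : H) = g := hg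
  rw [this, hm]; push_cast; ring

theorem case_c1 {Γ : Subgroup (AffGroup 4)} (hG : Good1 Γ) {t : E4} (ht : t ∈ LV Γ) (htt : Bf t t < 0)
    (hk : Module.finrank ℝ (LV Γ) = 1) : ∃ a ∈ TL Γ, a ≠ 0 ∧ FO Γ a := by
  obtain ⟨a, ha, ha0⟩ := exists_lat hG
  have h1 := (finrank_eq_one_iff_of_nonzero' (⟨a, Lat_le ha⟩ : LV Γ) (by
    intro h; exact ha0 (congrArg Subtype.val h))).mp hk
  have h2 : ∀ v ∈ LV Γ, ∃ c : ℝ, c • a = v := by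
    intro v hv
    obtain ⟨c, hc⟩ := h1 ⟨v, hv⟩
    exact ⟨c, congrArg Subtype.val hc⟩
  have haa : Bf a a ≠ 0 := by
    obtain ⟨c, rfl⟩ := h2 t ht
    intro h
    rw [Bf_smul_left, Bf_smul_right, h] at htt
    simp at htt
  refine ⟨a, ha, ha0, (Set.toFinite {a, -a}).subset ?_⟩
  rintro y ⟨γ, hγ, rfl⟩
  obtain ⟨c, hc⟩ := h2 _ (LV_inv hγ (Lat_le ha))
  have h3 := hG.lor γ hγ a a
  rw [← hc, Bf_smul_left, Bf_smul_right] at h3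
  have h4 : c * c = 1 := by
    apply mul_right_cancel₀ haa
    linarith
  rw [← hc]
  rcases mul_self_eq_one_iff.mp h4 with rfl | rfl
  · left; simp
  · right; simp

theorem case_c4 {Γ : Subgroup (AffGroup 4)} (hG : Good1 Γ)
    (hk : Module.finrank ℝ (LV Γ) = 4) : ∃ a ∈ TL Γ, a ≠ 0 ∧ FO Γ a := by
  obtain ⟨a, ha, ha0⟩ := exists_lat hG
  have htop : LV Γ = ⊤ := Submodule.eq_top_of_finrank_eq (by rw [hk]; simp [E4])
  obtain ⟨F, hF, h⟩ := hG.toGood.FL (K := {0}) isCompact_singleton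
  refine ⟨a, ha, ha0, (hF.image (fun f => f.linear a)).subset ?_⟩
  rintro y ⟨γ, hγ, rfl⟩
  obtain ⟨f, hf, b, hb, hfb⟩ := h γ hγ ⟨γ 0, by rw [htop]; trivial, by simp⟩
  exact ⟨f, hf, (lin_of_trans hfb a).symm⟩

/-- core of the rank two case, hyperbolic alternative -/
theorem c2_hyp {Γ H : Subgroup (AffGroup 4)} (hG : Good1 Γ) (hle : H ≤ Γ) (hH : Good1 H) {n n1 n2 : E4} (F : Frame n)
    (hRT : F.RT H) (hr : ∀ γ ∈ H, F.r γ = 1) {c : ℝ} (hn1 : n1 = c • n) (hc0 : c ≠ 0)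
    (hs : ∀ v ∈ LV Γ, ∃ α β : ℝ, v = α • n1 + β • n2) (h1V : n1 ∈ LV Γ)
    (h11 : Bf n1 n1 = 0) (h22 : Bf n2 n2 = 0) (h12 : Bf n1 n2 = -2)
    (hl2 : ∀ γ ∈ H, ∃ c : ℝ, γ.linear n2 = c • n2) : False := by
  have hA1 : ∀ γ ∈ H, γ.linear n1 = F.l γ • n1 := by
    intro γ hγ
    have := (hRT.ty hγ).n_ap (fun x y => hH.lor γ hγ x y)
    have h : γ.linear n = F.l γ • n := this
    rw [hn1, map_smul, h, smul_comm]
  have hA2 : ∀ γ ∈ H, γ.linear n2 = (F.l γ)⁻¹ • n2 := by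
    intro γ hγ
    obtain ⟨d, hd⟩ := hl2 γ hγ
    have h := hH.lor γ hγ n1 n2
    rw [hA1 γ hγ, hd, Bf_smul_left, Bf_smul_right, h12] at h
    have h0 := (hRT.ty hγ).pos.ne'
    rw [hd]; congr 1
    field_simp
    linarith
  have hperp : ∀ γ ∈ H, ∀ x, Bf n1 x = 0 → Bf n2 x = 0 → γ.linear x = x := by
    intro γ hγ x h1 h2
    have hVx : F.V x = 0 := by
      rw [F.V_eq]
      rw [hn1, Bf_smul_left] at h1
      exact (mul_eq_zero.mp h1).resolve_left hc0
    have hV := (hRT.ty hγ).V x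
    have hZ := (hRT.ty hγ).Z x
    rw [hVx, mul_zero] at hV
    rw [hVx, hr γ hγ, one_mul, Complex.ofReal_zero, mul_zero, add_zero] at hZ
    have e := F.eq_smul (x := γ.linear x - x) (by rw [map_sub]; erw [hZ]; exact sub_self _)
      (by rw [map_sub]; erw [hV]; rw [hVx, sub_self])
    have h3 : Bf n2 (γ.linear x - x) = 0 := by
      have h4 := hH.lor γ hγ n2 x
      rw [hA2 γ hγ, Bf_smul_left, h2] at h4
      have h5 := (mul_eq_zero.mp h4).resolve_left (inv_ne_zero (hRT.ty hγ).pos.ne')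
      rw [Bf_sub_right, h5, h2, sub_zero]
    have h4 : Bf n2 n ≠ 0 := by
      intro h
      rw [hn1, Bf_comm, Bf_smul_right, h] at h12
      norm_num at h12
    rw [e, Bf_smul_right] at h3
    have h5 := (mul_eq_zero.mp h3).resolve_right h4
    rw [h5, zero_smul] at e
    exact sub_eq_zero.mp e
  have hid : ∀ γ ∈ H, F.l γ = 1 → ∀ x, γ.linear x = x := by
    intro γ hγ hl x
    have h1 := hA1 γ hγ
    have h2 := hA2 γ hγ
    rw [hl, one_smul] at h1
    rw [hl, inv_one, one_smul] at h2
    have h3 := hperp γ hγ (x + (Bf n2 x / 2) • n1 + (Bf n1 x / 2) • n2)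
      (by simp only [Bf_add_right, Bf_smul_right, h11, h12]; ring)
      (by simp only [Bf_add_right, Bf_smul_right, h22, Bf_comm n2 n1, h12]; ring)
    rw [map_add, map_add, map_smul, map_smul, h1, h2] at h3
    exact add_right_cancel (add_right_cancel h3)
  -- lattice vector with nonzero first coordinate
  obtain ⟨a, ha, α, β, hab, hα⟩ : ∃ a ∈ TL Γ, ∃ α β : ℝ, a = α • n1 + β • n2 ∧ α ≠ 0 := by
    by_contra hcon
    push Not at hcon
    have : n1 ∈ LinearMap.ker (Bl n2) := by
      refine LV_le ?_ h1V
      intro a ha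
      obtain ⟨α, β, hab⟩ := hs a (Lat_le ha)
      rw [LinearMap.mem_ker, Bl_ap, hab, hcon a ha α β hab]
      simp [Bf_smul_right, h22, Bf_add_right]
    rw [LinearMap.mem_ker, Bl_ap, Bf_comm, h12] at this
    norm_num at this
  let g : ℝ → E4 := fun s => (α * (Real.exp s - 1)) • n1 + (β * ((Real.exp s)⁻¹ - 1)) • n2
  have hgc : Continuous g := by
    have : Continuous fun s : ℝ => (Real.exp s)⁻¹ := Real.continuous_exp.inv₀ fun s => (Real.exp_pos s).ne'
    fun_prop
  have hginj : Function.Injective g := by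
    intro s s' h
    have h1 := congrArg (Bf n2) h
    simp only [g, Bf_add_right, Bf_smul_right, h22, Bf_comm n2 n1, h12] at h1
    have h2 : α * (Real.exp s - Real.exp s') = 0 := by linarith
    exact Real.exp_injective (sub_eq_zero.mp ((mul_eq_zero.mp h2).resolve_left hα))
  have hgl : ∀ γ ∈ H, g (Real.log (F.l γ)) ∈ TL Γ := by
    intro γ hγ
    have e : g (Real.log (F.l γ)) = γ.linear a - a := by
      simp only [g]
      rw [Real.exp_log (hRT.ty hγ).pos, hab, map_add, map_smul, map_smul, hA1 γ hγ, hA2 γ hγ]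
      module
    rw [e]
    exact (TL Γ).sub_mem (Lat_inv (hle hγ) ha) ha
  obtain ⟨ε, hε, hε'⟩ : ∃ ε > 0, ∀ s : ℝ, |s| ≤ ε → ‖g s‖ ≤ 1 := by
    have h0 : ‖g 0‖ < 1 := by simp [g]
    have := (hgc.norm.tendsto 0).eventually (gt_mem_nhds h0)
    obtain ⟨ε, hε, h⟩ := Metric.eventually_nhds_iff.mp this
    refine ⟨ε / 2, by positivity, fun s hs => (h ?_).le⟩
    rw [Real.dist_eq, sub_zero]; linarith
  have hhom : ∀ γ ∈ H, ∀ δ ∈ H, Real.log (F.l (γ * δ)) = Real.log (F.l γ) + Real.log (F.l δ) := by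
    intro γ hγ δ hδ
    rw [(hRT.mul hγ hδ).1, Real.log_mul (hRT.ty hγ).pos.ne' (hRT.ty hδ).pos.ne']
  obtain ⟨γ0, h0, hm⟩ := hom_cyc (f := fun γ => Real.log (F.l γ)) hhom hε (by
    have := (hG.toGood.lat_fin 1).preimage (f := g) hginj.injOn
    refine this.subset ?_
    rintro s ⟨γ, hγ, rfl, hs⟩
    exact ⟨hgl γ hγ, hε' _ hs⟩)
  obtain ⟨x, hx0, hx⟩ := exists_orth (by norm_num : 3 < 4) ![n1, n2, γ0 0]
  have hx1 : Bf n1 x = 0 := hx 0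
  have hx2 : Bf n2 x = 0 := hx 1
  have hx3 : Bf (γ0 0) x = 0 := hx 2
  have hφ : ∀ γ ∈ H, ∀ δ ∈ H, Bf x ((γ * δ) 0) = Bf x (γ 0) + Bf x (δ 0) := by
    intro γ hγ δ hδ
    rw [mul_ap, aff_apply γ, Bf_add_right]
    have := hH.lor γ hγ x (δ 0)
    rw [hperp γ hγ x hx1 hx2] at this
    rw [this]; ring
  refine no_hyperplane hH.toGood (LinearMap.toContinuousLinearMap (Bl x)) ?_ 0 0 ?_
  · intro h
    apply hx0
    apply Bf_nondeg
    intro y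
    exact congrArg (fun l : E4 →L[ℝ] ℝ => l y) h
  · intro γ hγ
    change Bf x (γ 0) = 0
    obtain ⟨m, hm⟩ := hm γ hγ
    have hz := H.zpow_mem h0 m
    have hδ := H.mul_mem hγ hz
    have hl : F.l (γ * γ0 ^ m) = 1 := by
      have := (hRT.ty hδ).pos
      exact Real.eq_one_of_pos_of_log_eq_zero this hm
    have hv := Lat_le (Lat_lin (hle hδ) (hid _ hδ hl))
    obtain ⟨p, q, hpq⟩ := hs _ hv
    have h1 := hφ γ hγ _ hz
    have h2 := hom_zpow (f := fun γ => Bf x (γ 0)) hφ h0 m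
    rw [h2, Bf_comm x (γ0 0), hx3, mul_zero, add_zero, hpq, Bf_add_right, Bf_smul_right, Bf_smul_right,
      Bf_comm x n1, Bf_comm x n2, hx1, hx2] at h1
    rw [← h1]; ring
end

noncomputable section
open Set Topology Filter ComplexConjugate

theorem exists_pair {p : Submodule ℝ E4} {t : E4} (ht : t ∈ p) (htt : Bf t t < 0) (hk : Module.finrank ℝ p = 2) :
    ∃ n1 ∈ p, ∃ n2 ∈ p, Bf n1 n1 = 0 ∧ Bf n2 n2 = 0 ∧ Bf n1 n2 = -2 ∧ ∀ v ∈ p, ∃ α β : ℝ, v = α • n1 + β • n2 := by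
  have hker := LinearMap.ker_ne_bot_of_finrank_lt (f := (Bl t).domRestrict p) (by simp [hk])
  obtain ⟨e, he, he0⟩ := Submodule.exists_mem_ne_zero_of_ne_bot hker
  have hte : Bf t e = 0 := he
  have he0' : (e : E4) ≠ 0 := fun h => he0 (Subtype.ext h)
  have hee := orth_pos htt he0' hte
  have hli : LinearIndependent ℝ ![t, (e : E4)] := by
    rw [LinearIndependent.pair_iff]
    intro s r h
    have h1 := congrArg (Bf t) h
    have h2 := congrArg (Bf (e : E4)) h
    simp only [Bf_add_right, Bf_smul_right, hte, Bf_zero_right, Bf_comm (e : E4) t, mul_zero, add_zero, zero_add] at h1 h2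
    exact ⟨(mul_eq_zero.mp h1).resolve_right htt.ne, (mul_eq_zero.mp h2).resolve_right hee.ne'⟩
  have hspan : Submodule.span ℝ {t, (e : E4)} = p := by
    apply Submodule.eq_of_le_of_finrank_eq
    · rw [Submodule.span_le]
      rintro x (rfl | rfl)
      · exact ht
      · exact e.2
    · have := finrank_span_eq_card hli
      rw [Matrix.range_cons, Matrix.range_cons, Matrix.range_empty, Set.union_empty, Set.singleton_union] at this
      rw [this, hk]; simp
  set a := (√(-Bf t t))⁻¹ with ha
  set b := (√(Bf (e : E4) e))⁻¹ with hb
  have ha2 : a * a * Bf t t = -1 := by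
    rw [ha, ← mul_inv, Real.mul_self_sqrt (by linarith)]
    have := htt.ne
    field_simp
  have hb2 : b * b * Bf (e : E4) e = 1 := by
    rw [hb, ← mul_inv, Real.mul_self_sqrt hee.le]
    have := hee.ne'
    field_simp
  have ha0 : a ≠ 0 := by rintro h; rw [h] at ha2; norm_num at ha2
  have hb0 : b ≠ 0 := by rintro h; rw [h] at hb2; norm_num at hb2
  have hat := p.smul_mem a ht
  have hbe := p.smul_mem b e.2
  refine ⟨a • t + b • (e : E4), p.add_mem hat hbe, a • t - b • (e : E4), p.sub_mem hat hbe, ?_, ?_, ?_, ?_⟩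
  · simp only [Bf_add_right, Bf_add_left, Bf_smul_right, Bf_smul_left, hte, Bf_comm (e : E4) t]; linarith
  · simp only [Bf_sub_right, Bf_sub_left, Bf_smul_right, Bf_smul_left, hte, Bf_comm (e : E4) t]; linarith
  · simp only [Bf_sub_right, Bf_add_left, Bf_smul_right, Bf_smul_left, hte, Bf_comm (e : E4) t]; linarith
  · intro v hv
    rw [← hspan, Submodule.mem_span_pair] at hv
    obtain ⟨x, y, rfl⟩ := hv
    refine ⟨(x / a + y / b) / 2, (x / a - y / b) / 2, ?_⟩
    have e1 : x • t = (x / a) • (a • t) := by rw [smul_smul]; congr 1; field_simp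
    have e2 : y • (e : E4) = (y / b) • (b • (e : E4)) := by rw [smul_smul]; congr 1; field_simp
    rw [e1, e2]
    module

theorem case_c2 {Γ : Subgroup (AffGroup 4)} (hG : Good1 Γ) {t : E4} (ht : t ∈ LV Γ) (htt : Bf t t < 0)
    (hk : Module.finrank ℝ (LV Γ) = 2) : ∃ a ∈ TL Γ, a ≠ 0 ∧ FO Γ a := by
  obtain ⟨n1, h1V, n2, h2V, h11, h22, h12, hs⟩ := exists_pair ht htt hk
  have h21 : Bf n2 n1 = -2 := by rw [Bf_comm, h12]
  have hnul : ∀ v ∈ LV Γ, Bf v v = 0 → (∃ c : ℝ, v = c • n1) ∨ ∃ c : ℝ, v = c • n2 := by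
    intro v hv h0
    obtain ⟨α, β, rfl⟩ := hs v hv
    simp only [Bf_add_right, Bf_add_left, Bf_smul_right, Bf_smul_left, h11, h22, h12, h21] at h0
    have : α * β = 0 := by linarith
    rcases mul_eq_zero.mp this with rfl | rfl
    · right; exact ⟨β, by simp⟩
    · left; exact ⟨α, by simp⟩
  have hA1 : ∀ γ ∈ Γ, (∃ c : ℝ, γ.linear n1 = c • n1) ∨ ∃ c : ℝ, γ.linear n1 = c • n2 := fun γ hγ =>
    hnul _ (LV_inv hγ h1V) (by rw [hG.lor γ hγ, h11])
  have hA2 : ∀ γ ∈ Γ, (∃ c : ℝ, γ.linear n2 = c • n1) ∨ ∃ c : ℝ, γ.linear n2 = c • n2 := fun γ hγ =>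
    hnul _ (LV_inv hγ h2V) (by rw [hG.lor γ hγ, h22])
  have hA3 : ∀ γ ∈ Γ, (∃ c : ℝ, γ.linear n1 = c • n1) → ∃ c : ℝ, γ.linear n2 = c • n2 := by
    rintro γ hγ ⟨c, hc⟩
    rcases hA2 γ hγ with ⟨d, hd⟩ | h
    · have := hG.lor γ hγ n1 n2
      rw [hc, hd, Bf_smul_left, Bf_smul_right, h11, h12] at this
      norm_num at this
    · exact h
  have hA4 : ∀ γ ∈ Γ, (∃ c : ℝ, γ.linear n1 = c • n2) → ∃ c : ℝ, γ.linear n2 = c • n1 := by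
    rintro γ hγ ⟨c, hc⟩
    rcases hA2 γ hγ with h | ⟨d, hd⟩
    · exact h
    · have := hG.lor γ hγ n1 n2
      rw [hc, hd, Bf_smul_left, Bf_smul_right, h22, h12] at this
      norm_num at this
  have hn1 : Nul n1 := ⟨by rintro rfl; rw [Bf_zero_left] at h12; norm_num at h12, h11⟩
  let H1 : Subgroup (AffGroup 4) :=
    { carrier := {γ | γ ∈ Γ ∧ ∃ c : ℝ, γ.linear n1 = c • n1}
      one_mem' := ⟨Γ.one_mem, 1, by rw [one_lin, one_smul]⟩
      mul_mem' := by
        rintro a b ⟨ha, c, hc⟩ ⟨hb, d, hd⟩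
        exact ⟨Γ.mul_mem ha hb, d * c, by rw [mul_lin, hd, map_smul, hc, smul_smul]⟩
      inv_mem' := by
        rintro a ⟨ha, c, hc⟩
        refine ⟨Γ.inv_mem ha, c⁻¹, ?_⟩
        have hc0 : c ≠ 0 := by
          rintro rfl
          rw [zero_smul] at hc
          exact hn1.1 (a.linear.injective (by rw [hc, map_zero]))
        have : a⁻¹.linear (a.linear n1) = n1 := inv_lin a n1
        rw [hc, map_smul] at this
        rw [← this, smul_smul, inv_mul_cancel₀ hc0, one_smul, this] }
  have hle1 : H1 ≤ Γ := fun γ h => h.1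
  have hc1 : ∀ γ ∈ Γ, ∀ δ ∈ Γ, γ ∉ H1 → δ ∉ H1 → γ * δ ∈ H1 := by
    intro γ hγ δ hδ h1 h2
    obtain ⟨c, hc⟩ := (hA1 δ hδ).resolve_left fun h => h2 ⟨hδ, h⟩
    obtain ⟨d, hd⟩ := hA4 γ hγ ((hA1 γ hγ).resolve_left fun h => h1 ⟨hγ, h⟩)
    exact ⟨Γ.mul_mem hγ hδ, c * d, by rw [mul_lin, hc, map_smul, hd, smul_smul]⟩
  have hH1 : Good1 H1 := hG.sub hle1 (hG.toGood.of_two hle1 hc1)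
  set n : E4 := (n1 3)⁻¹ • n1 with hn
  have h3 := hn1.three
  have hnn : Bf n n = 0 := by rw [hn, Bf_smul_left, Bf_smul_right, h11]; simp
  have hn3 : n 3 = 1 := by rw [hn]; simp [h3]
  have hn1n : n1 = n1 3 • n := by rw [hn, smul_smul, mul_inv_cancel₀ h3, one_smul]
  obtain ⟨F⟩ := frame_exists hnn hn3
  obtain ⟨H, hle, hH, hRT, hc2⟩ := F.rot_sub hH1 (by
    rintro γ ⟨hγ, c, hc⟩
    exact ⟨c, by rw [hn, map_smul, hc, smul_comm]⟩)
  have hl2 : ∀ γ ∈ H, ∃ c : ℝ, γ.linear n2 = c • n2 := fun γ hγ => hA3 γ (hle1 (hle hγ)) (hle hγ).2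
  rcases hRT.lr_all hH.toGood with hl | hr
  · obtain ⟨a, ha, ha0⟩ := exists_lat hG
    refine ⟨a, ha, ha0, FO_two hc1 (FO_two hc2 (FO_fix fun γ hγ => ?_))⟩
    have e1 : γ.linear n = n := by
      have := (hRT.ty hγ).n_ap (fun x y => hH.lor γ hγ x y)
      rw [hl γ hγ, one_smul] at this
      exact this
    have e2 : γ.linear n1 = n1 := by rw [hn1n, map_smul, e1]
    obtain ⟨c, hc⟩ := hl2 γ hγ
    have h := hH.lor γ hγ n1 n2
    rw [e2, hc, Bf_smul_right, h12] at h
    have hc' : c = 1 := by linarith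
    rw [hc', one_smul] at hc
    obtain ⟨α, β, hab⟩ := hs a (Lat_le ha)
    rw [hab, map_add, map_smul, map_smul, e2, hc]
  · exact (c2_hyp hG (hle.trans hle1) hH F hRT hr hn1n h3 hs h1V h11 h22 h12 hl2).elim
end

noncomputable section
open Set Topology Filter ComplexConjugate

theorem det_three (M : Matrix (Fin 3) (Fin 3) ℝ) (G : Matrix (Fin 3) (Fin 3) ℝ) (hG : G.det ≠ 0)
    (h : M.transpose * G * M = G) : (M * M - 1).det = 0 := by
  have hd : M.det * M.det = 1 := by
    have := congrArg Matrix.det h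
    rw [Matrix.det_mul, Matrix.det_mul, Matrix.det_transpose] at this
    apply mul_right_cancel₀ hG
    linarith
  set B := M * M with hB
  have hBG : B.transpose * G * B = G := by
    rw [hB, Matrix.transpose_mul]
    calc M.transpose * M.transpose * G * (M * M) = M.transpose * (M.transpose * G * M) * M := by
          simp only [Matrix.mul_assoc]
      _ = G := by rw [h, h]
  have hBd : B.det = 1 := by rw [hB, Matrix.det_mul, hd]
  have h1 : B.transpose * G * (B - 1) = -((B - 1).transpose * G) := by
    rw [Matrix.mul_sub, hBG, Matrix.mul_one, Matrix.transpose_sub, Matrix.sub_mul, Matrix.transpose_one, Matrix.one_mul]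
    abel
  have h2 := congrArg Matrix.det h1
  rw [Matrix.det_neg, Matrix.det_mul, Matrix.det_mul, Matrix.det_mul, Matrix.det_transpose, Matrix.det_transpose, hBd] at h2
  simp only [Fintype.card_fin] at h2
  have h3 : G.det * (B - 1).det = 0 := by linarith
  exact (mul_eq_zero.mp h3).resolve_left hG

theorem Good.lat_discrete {Γ : Subgroup (AffGroup 4)} (hG : Good Γ) :
    DiscreteTopology (AddSubgroup.toIntSubmodule (TL Γ)) := by
  apply discreteTopology_of_isOpen_singleton_zero
  rw [Metric.isOpen_singleton_iff]
  have hf := (hG.lat_fin 1).subset (sdiff_subset (t := {0}))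
  have : ({a | a ∈ TL Γ ∧ ‖a‖ ≤ 1} \ {0})ᶜ ∈ 𝓝 (0 : E4) := hf.isClosed.isOpen_compl.mem_nhds (by simp)
  obtain ⟨ε, hε, h⟩ := Metric.mem_nhds_iff.mp this
  refine ⟨min ε 1, by positivity, fun y hy => ?_⟩
  rw [Subtype.dist_eq, lt_min_iff] at hy
  have h1 := h hy.1
  by_contra h0
  apply h1
  refine ⟨⟨y.2, ?_⟩, fun h => h0 (Subtype.ext h)⟩
  have := hy.2.le
  rw [ZeroMemClass.coe_zero, dist_zero_right] at this
  exact this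

def linZ {Γ : Subgroup (AffGroup 4)} {γ : AffGroup 4} (hγ : γ ∈ Γ) :
    AddSubgroup.toIntSubmodule (TL Γ) →ₗ[ℤ] AddSubgroup.toIntSubmodule (TL Γ) :=
  AddMonoidHom.toIntLinearMap
    { toFun := fun a => ⟨γ.linear a, Lat_inv hγ a.2⟩
      map_zero' := Subtype.ext (map_zero γ.linear)
      map_add' := fun _ _ => Subtype.ext (map_add γ.linear _ _) }

theorem linZ_ap {Γ : Subgroup (AffGroup 4)} {γ : AffGroup 4} (hγ : γ ∈ Γ) (a : AddSubgroup.toIntSubmodule (TL Γ)) :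
    (linZ hγ a : E4) = γ.linear a := rfl

theorem fix_vec {Γ : Subgroup (AffGroup 4)} (hG : Good Γ) (hk : Module.finrank ℝ (LV Γ) = 3)
    (hnd : ∀ v ∈ LV Γ, (∀ u ∈ LV Γ, Bf u v = 0) → v = 0) {γ : AffGroup 4} (hγ : γ ∈ Γ) :
    ∃ a ∈ TL Γ, a ≠ 0 ∧ γ.linear (γ.linear a) = a := by
  set L := AddSubgroup.toIntSubmodule (TL Γ) with hL
  have hdisc : DiscreteTopology L := hG.lat_discrete
  have hspZ : Submodule.span ℤ (TL Γ : Set E4) = L := by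
    have : (TL Γ : Set E4) = (L : Set E4) := rfl
    rw [this, Submodule.span_eq]
  have hrk : Module.finrank ℤ L = 3 := by
    have h := Real.finrank_eq_int_finrank_of_discrete (s := (TL Γ : Set E4)) (by rw [hspZ]; exact hdisc)
    rw [Set.finrank, Set.finrank, hspZ] at h
    rw [← h]; exact hk
  have hfree : Module.Free ℤ L := inferInstance
  let b : Module.Basis (Fin 3) ℤ L := Module.finBasisOfFinrankEq ℤ L hrk
  let bv : Fin 3 → E4 := fun i => (b i : E4)
  have hspR : Submodule.span ℝ (Set.range bv) = LV Γ := by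
    apply le_antisymm
    · rw [Submodule.span_le]
      rintro x ⟨i, rfl⟩
      exact Lat_le (b i).2
    · intro x hx
      refine LV_le ?_ hx
      intro a ha
      have h1 := b.sum_repr ⟨a, ha⟩
      have h2 := congrArg (Subtype.val) h1
      rw [AddSubmonoidClass.coe_finsetSum] at h2
      change _ = a at h2
      rw [← h2]
      refine Submodule.sum_mem _ fun i _ => ?_
      have : (((b.repr ⟨a, ha⟩) i • b i : L) : E4) = (b.repr ⟨a, ha⟩ i) • bv i := rfl
      rw [this, ← Int.cast_smul_eq_zsmul ℝ]
      exact Submodule.smul_mem _ _ (Submodule.subset_span ⟨i, rfl⟩)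
  have hli : LinearIndependent ℝ bv := by
    rw [linearIndependent_iff_card_eq_finrank_span, Set.finrank, hspR, hk]; simp
  let G : Matrix (Fin 3) (Fin 3) ℝ := Matrix.of fun i j => Bf (bv i) (bv j)
  have hBsum : ∀ (x : E4) (c : Fin 3 → ℝ), Bf x (∑ j, c j • bv j) = ∑ j, c j * Bf x (bv j) := by
    intro x c
    rw [← Bl_ap, map_sum]
    simp only [map_smul, Bl_ap, smul_eq_mul]
  have hGd : G.det ≠ 0 := by
    intro h0
    obtain ⟨c, hc0, hc⟩ := Matrix.exists_mulVec_eq_zero_iff.mpr h0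
    apply hc0
    have hv : ∑ j, c j • bv j = 0 := by
      apply hnd
      · exact Submodule.sum_mem _ fun j _ => Submodule.smul_mem _ _ (Lat_le (b j).2)
      · intro u hu
        have hi : ∀ i, Bf (bv i) (∑ j, c j • bv j) = 0 := by
          intro i
          have := congrFun hc i
          rw [hBsum]
          simp only [Matrix.mulVec, dotProduct, G, Matrix.of_apply, Pi.zero_apply] at this
          rw [← this]
          exact Finset.sum_congr rfl fun j _ => mul_comm _ _
        rw [← hspR] at hu
        have : u ∈ LinearMap.ker (Bl (∑ j, c j • bv j)) := by
          refine (Submodule.span_le.mpr ?_) hu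
          rintro x ⟨i, rfl⟩
          change Bf _ _ = 0
          rw [Bf_comm]; exact hi i
        rw [Bf_comm]; exact this
    have := Fintype.linearIndependent_iff.mp hli c hv
    funext i; exact this i
  let f := linZ hγ
  let M : Matrix (Fin 3) (Fin 3) ℤ := LinearMap.toMatrix b b f
  let MR : Matrix (Fin 3) (Fin 3) ℝ := M.map (Int.castRingHom ℝ)
  have hcol : ∀ j, γ.linear (bv j) = ∑ i, MR i j • bv i := by
    intro j
    have h1 : ∑ i, M i j • b i = f (b j) := by
      have := b.sum_repr (f (b j))
      refine Eq.trans (Finset.sum_congr rfl fun i _ => ?_) this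
      congr 1
      exact LinearMap.toMatrix_apply b b f i j
    have h2 := congrArg (Subtype.val) h1
    rw [AddSubmonoidClass.coe_finsetSum] at h2
    rw [linZ_ap] at h2
    rw [← h2]
    refine Finset.sum_congr rfl fun i _ => ?_
    have : ((M i j • b i : L) : E4) = M i j • bv i := rfl
    refine this.trans ?_
    rw [← Int.cast_smul_eq_zsmul ℝ]; rfl
  have hMG : MR.transpose * G * MR = G := by
    ext i j
    have h1 := hG.lor γ hγ (bv i) (bv j)
    rw [hcol i, hcol j, hBsum] at h1
    change _ = Bf (bv i) (bv j)
    rw [← h1, Matrix.mul_apply]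
    refine Finset.sum_congr rfl fun k _ => ?_
    rw [mul_comm]; congr 1
    rw [Bf_comm, hBsum, Matrix.mul_apply]
    refine Finset.sum_congr rfl fun l _ => ?_
    rw [Matrix.transpose_apply]; congr 1
    exact Bf_comm _ _
  have hdet := det_three MR G hGd hMG
  have hdetZ : (M * M - 1).det = 0 := by
    have e : (M * M - 1).map (Int.castRingHom ℝ) = MR * MR - 1 := by
      rw [Matrix.map_sub _ (map_sub _), Matrix.map_mul, Matrix.map_one _ (map_zero _) (map_one _)]
    have h1 := RingHom.map_det (Int.castRingHom ℝ) (M * M - 1)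
    rw [RingHom.mapMatrix_apply, e, hdet] at h1
    rw [eq_intCast] at h1
    exact_mod_cast h1
  obtain ⟨v, hv0, hv⟩ := Matrix.exists_mulVec_eq_zero_iff.mpr hdetZ
  have hvM : M.mulVec (M.mulVec v) = v := by
    rw [Matrix.sub_mulVec, Matrix.one_mulVec, sub_eq_zero] at hv
    rw [Matrix.mulVec_mulVec]; exact hv
  let a : L := b.equivFun.symm v
  have hrep : ∀ x : Fin 3 → ℤ, f (b.equivFun.symm x) = b.equivFun.symm (M.mulVec x) := by
    intro x
    apply b.equivFun.injective
    have := LinearMap.toMatrix_mulVec_repr b b f (b.equivFun.symm x)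
    rw [LinearEquiv.apply_symm_apply]
    have h2 : (b.repr (b.equivFun.symm x) : Fin 3 → ℤ) = x := by
      have := b.equivFun.apply_symm_apply x
      exact this
    rw [h2] at this
    exact this.symm
  refine ⟨a, a.2, ?_, ?_⟩
  · intro h
    have : a = 0 := Subtype.ext h
    apply hv0
    have h2 := b.equivFun.apply_symm_apply v
    rw [← h2]
    change b.equivFun a = 0
    rw [this, map_zero]
  · have : f (f a) = a := by
      change f (f (b.equivFun.symm v)) = b.equivFun.symm v
      rw [hrep, hrep, hvM]
    have h2 := congrArg Subtype.val this
    rwa [linZ_ap, linZ_ap] at h2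
end

noncomputable section
open Set Topology Filter ComplexConjugate

theorem orth_two {Γ : Subgroup (AffGroup 4)} (hG : Good Γ) :
    ∀ γ ∈ Γ, ∀ δ ∈ Γ, γ ∉ orth Γ hG → δ ∉ orth Γ hG → γ * δ ∈ orth Γ hG := by
  have key : ∀ γ ∈ Γ, γ ∉ orth Γ hG → ∀ y, Fut y → Fut (-(γ.linear y)) := by
    intro γ hγ hn y hy
    have : ∃ z, Fut z ∧ ¬ Fut (γ.linear z) := by
      by_contra hcon
      push Not at hcon
      exact hn ⟨hγ, hcon⟩
    obtain ⟨z, hz, hz'⟩ := this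
    have h1 : Bf (γ.linear z) (γ.linear z) < 0 := by rw [hG.lor _ hγ]; exact hz.1
    have h2 := (Fut_or h1).resolve_left hz'
    refine Fut_of_Bf h2 ?_ ?_
    · rw [Bf_neg_left, Bf_neg_right, hG.lor _ hγ]; linarith [hy.1]
    · rw [Bf_neg_left, Bf_neg_right, hG.lor _ hγ]; linarith [Fut_Bf hz hy]
  intro γ hγ δ hδ h1 h2
  refine ⟨Γ.mul_mem hγ hδ, fun y hy => ?_⟩
  have := key γ hγ h1 _ (key δ hδ h2 y hy)
  rw [map_neg, neg_neg] at this
  exact this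

theorem case_c3 {Γ : Subgroup (AffGroup 4)} (hG : Good1 Γ) {t : E4} (ht : t ∈ LV Γ) (htt : Bf t t < 0)
    (hk : Module.finrank ℝ (LV Γ) = 3) : ∃ a ∈ TL Γ, a ≠ 0 ∧ FO Γ a := by
  let b : Module.Basis (Fin 3) ℝ (LV Γ) := Module.finBasisOfFinrankEq ℝ (LV Γ) hk
  obtain ⟨w, hw0, hwb⟩ := exists_orth (by norm_num : 3 < 4) (fun i => (b i : E4))
  have hw : ∀ v ∈ LV Γ, Bf w v = 0 := by
    intro v hv
    have h1 := congrArg Subtype.val (b.sum_repr ⟨v, hv⟩)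
    rw [AddSubmonoidClass.coe_finsetSum] at h1
    change _ = v at h1
    rw [← h1, ← Bl_ap, map_sum]
    refine Finset.sum_eq_zero fun i _ => ?_
    have : (((b.repr ⟨v, hv⟩) i • b i : LV Γ) : E4) = (b.repr ⟨v, hv⟩ i) • (b i : E4) := rfl
    rw [this, map_smul, Bl_ap, Bf_comm, hwb, smul_zero]
  have hww : 0 < Bf w w := orth_pos htt hw0 (by rw [Bf_comm]; exact hw t ht)
  have hV : ∀ x, Bf w x = 0 → x ∈ LV Γ := by
    have hle : LV Γ ≤ LinearMap.ker (Bl w) := fun v hv => hw v hv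
    have hlt : Module.finrank ℝ (LinearMap.ker (Bl w)) < 4 := by
      have h : LinearMap.ker (Bl w) < ⊤ := by
        refine lt_top_iff_ne_top.mpr fun h => ?_
        have : w ∈ LinearMap.ker (Bl w) := by rw [h]; trivial
        exact hww.ne' this
      have := Submodule.finrank_lt h.ne
      simpa [E4] using this
    have heq := Submodule.eq_of_le_of_finrank_le hle (by omega)
    intro x hx
    rw [heq]; exact hx
  have hnd : ∀ v ∈ LV Γ, (∀ u ∈ LV Γ, Bf u v = 0) → v = 0 := by
    intro v hv h
    by_contra h0
    have := orth_pos htt h0 (h t ht)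
    rw [h v hv] at this
    exact lt_irrefl _ this
  have hpar : ∀ γ ∈ Γ, γ.linear w = w ∨ γ.linear w = -w := by
    intro γ hγ
    set c := Bf w (γ.linear w) / Bf w w with hc
    have hz : γ.linear w - c • w = 0 := by
      have h1 : Bf w (γ.linear w - c • w) = 0 := by
        rw [Bf_sub_right, Bf_smul_right, hc]; field_simp; ring
      refine hnd _ (hV _ h1) fun u hu => ?_
      rw [Bf_sub_right, Bf_smul_right, Bf_comm u w, hw u hu, mul_zero, sub_zero, Bf_comm, hG.toGood.inv_lor hγ]
      exact hw _ (LV_inv (Γ.inv_mem hγ) hu)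
    rw [sub_eq_zero] at hz
    have h2 := hG.lor γ hγ w w
    rw [hz, Bf_smul_left, Bf_smul_right] at h2
    have h4 : c * c = 1 := by
      apply mul_right_cancel₀ hww.ne'
      linarith
    rw [hz]
    rcases mul_self_eq_one_iff.mp h4 with h | h
    · left; rw [h, one_smul]
    · right; rw [h, neg_smul, one_smul]
  let H : Subgroup (AffGroup 4) :=
    { carrier := {γ | γ ∈ Γ ∧ γ.linear w = w}
      one_mem' := ⟨Γ.one_mem, one_lin w⟩
      mul_mem' := by
        rintro a b ⟨ha, hc⟩ ⟨hb, hd⟩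
        exact ⟨Γ.mul_mem ha hb, by rw [mul_lin, hd, hc]⟩
      inv_mem' := by
        rintro a ⟨ha, hc⟩
        refine ⟨Γ.inv_mem ha, ?_⟩
        have : a⁻¹.linear (a.linear w) = w := inv_lin a w
        rwa [hc] at this }
  have hle : H ≤ Γ := fun γ h => h.1
  have h2 : ∀ γ ∈ Γ, ∀ δ ∈ Γ, γ ∉ H → δ ∉ H → γ * δ ∈ H := by
    intro γ hγ δ hδ h1 h2
    have e1 := (hpar γ hγ).resolve_left fun h => h1 ⟨hγ, h⟩
    have e2 := (hpar δ hδ).resolve_left fun h => h2 ⟨hδ, h⟩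
    exact ⟨Γ.mul_mem hγ hδ, by rw [mul_lin, e2, map_neg, e1, neg_neg]⟩
  have hτ : ∀ γ ∈ H, ∀ δ ∈ H, Bf w ((γ * δ) 0) = Bf w (γ 0) + Bf w (δ 0) := by
    intro γ hγ δ hδ
    rw [mul_ap, aff_apply γ, Bf_add_right]
    have := hG.lor γ (hle hγ) w (δ 0)
    rw [hγ.2] at this
    rw [this]; ring
  obtain ⟨F, hF, hFL⟩ := hG.toGood.FL (K := (fun s : ℝ => s • w) '' Set.Icc (-(Bf w w)⁻¹) (Bf w w)⁻¹)
    (isCompact_Icc.image (by fun_prop))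
  have hFL' : ∀ γ ∈ H, |Bf w (γ 0)| ≤ 1 → ∃ f ∈ F, ∃ a ∈ TL Γ, ∀ x, γ x = f x + a := by
    intro γ hγ h
    apply hFL γ (hle hγ)
    refine ⟨γ 0 - (Bf w (γ 0) / Bf w w) • w, hV _ ?_, Bf w (γ 0) / Bf w w, ?_, ?_⟩
    · rw [Bf_sub_right, Bf_smul_right]; field_simp; ring
    · rw [Set.mem_Icc, ← abs_le, abs_div, abs_of_pos hww, div_eq_mul_inv]
      exact mul_le_of_le_one_left (inv_pos.mpr hww).le h
    · simp
  obtain ⟨γ0, h0, hm⟩ := hom_cyc (f := fun γ => Bf w (γ 0)) hτ one_pos (by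
    refine (hF.image (fun f : AffGroup 4 => Bf w (f 0))).subset ?_
    rintro s ⟨γ, hγ, rfl, hs⟩
    obtain ⟨f, hf, a, ha, hfa⟩ := hFL' γ hγ hs
    refine ⟨f, hf, ?_⟩
    simp only
    rw [hfa 0, Bf_add_right, hw a (Lat_le ha), add_zero])
  obtain ⟨a, ha, ha0, hfix⟩ := fix_vec hG.toGood hk hnd (hle h0)
  refine ⟨a, ha, ha0, FO_two h2 ?_⟩
  let St : Subgroup (AffGroup 4) :=
    { carrier := {γ | γ.linear a = a}
      one_mem' := one_lin a
      mul_mem' := by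
        intro x y hx hy
        change (x * y).linear a = a
        rw [mul_lin, hy, hx]
      inv_mem' := by
        intro x hx
        have : x⁻¹.linear (x.linear a) = a := inv_lin x a
        rwa [hx] at this }
  have hpow : ∀ m : ℤ, (γ0 ^ m).linear a = a ∨ (γ0 ^ m).linear a = γ0.linear a := by
    intro m
    have hsq : γ0 * γ0 ∈ St := by
      change (γ0 * γ0).linear a = a
      rw [mul_lin, hfix]
    rcases Int.even_or_odd' m with ⟨q, rfl | rfl⟩
    · left
      have := St.zpow_mem hsq q
      rw [zpow_mul, zpow_two]; exact this
    · right
      have h : (γ0 * γ0) ^ q ∈ St := St.zpow_mem hsq q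
      rw [add_comm, zpow_add, zpow_one, zpow_mul, zpow_two, mul_lin]
      congr 1
  refine ((hF.image (fun f => f.linear a)).union (hF.image (fun f => f.linear (γ0.linear a)))).subset ?_
  rintro y ⟨γ, hγ, rfl⟩
  obtain ⟨m, hm⟩ := hm γ hγ
  have hδ := H.mul_mem hγ (H.zpow_mem h0 m)
  obtain ⟨f, hf, c, hc, hfc⟩ := hFL' _ hδ (by
    change |Bf w ((γ * γ0 ^ m) 0)| ≤ 1
    have : Bf w ((γ * γ0 ^ m) 0) = 0 := hm
    rw [this]; simp)
  have e : γ = (γ * γ0 ^ m) * γ0 ^ (-m) := by rw [zpow_neg, mul_inv_cancel_right]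
  rcases hpow (-m) with h | h
  · left
    refine ⟨f, hf, ?_⟩
    rw [e, mul_lin, h]; exact (lin_of_trans hfc a).symm
  · right
    refine ⟨f, hf, ?_⟩
    rw [e, mul_lin, h]; exact (lin_of_trans hfc _).symm

theorem main1 {Γ : Subgroup (AffGroup 4)} (hG : Good1 Γ) : ∃ a ∈ TL Γ, a ≠ 0 ∧ FO Γ a := by
  by_cases hc : ∃ t ∈ LV Γ, Bf t t < 0
  · obtain ⟨t, ht, htt⟩ := hc
    have h4 : Module.finrank ℝ (LV Γ) ≤ 4 := by
      have := Submodule.finrank_le (LV Γ)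
      simpa [E4] using this
    have h0 : Module.finrank ℝ (LV Γ) ≠ 0 := by
      intro h
      rw [Submodule.finrank_eq_zero] at h
      rw [h, Submodule.mem_bot] at ht
      rw [ht, Bf_zero_left] at htt
      exact lt_irrefl _ htt
    obtain h | h | h | h : Module.finrank ℝ (LV Γ) = 1 ∨ Module.finrank ℝ (LV Γ) = 2 ∨
        Module.finrank ℝ (LV Γ) = 3 ∨ Module.finrank ℝ (LV Γ) = 4 := by omega
    · exact case_c1 hG ht htt h
    · exact case_c2 hG ht htt h
    · exact case_c3 hG ht htt h
    · exact case_c4 hG h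
  · push Not at hc
    by_cases hb : ∃ n ∈ LV Γ, Nul n
    · obtain ⟨n, hn, hnn⟩ := hb
      exact case_b hG hc hnn hn
    · push Not at hb
      refine case_a hG fun v hv h0 => lt_of_le_of_ne (hc v hv) fun h => hb v hv ⟨h0, h.symm⟩

theorem main0 {Γ : Subgroup (AffGroup 4)} (hG : Good Γ) : ∃ a ∈ TL Γ, a ≠ 0 ∧ FO Γ a := by
  obtain ⟨a, ha, ha0, h⟩ := main1 (orth_good1 hG)
  exact ⟨a, Lat_mono (H := orth Γ hG) (fun γ h => And.left h) ha, ha0, FO_two (orth_two hG) h⟩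

def stab (Γ : Subgroup (AffGroup 4)) (a : E4) : Subgroup Γ where
  carrier := {γ | (γ : AffGroup 4).linear a = a}
  one_mem' := one_lin a
  mul_mem' := by
    intro x y hx hy
    change ((x : AffGroup 4) * y).linear a = a
    rw [mul_lin, hy, hx]
  inv_mem' := by
    intro x hx
    have : (x : AffGroup 4)⁻¹.linear ((x : AffGroup 4).linear a) = a := inv_lin _ a
    rwa [hx] at this

theorem stab_fin {Γ : Subgroup (AffGroup 4)} {a : E4} (h : FO Γ a) : (stab Γ a).FiniteIndex := by
  have hfin : Finite {y | ∃ γ ∈ Γ, γ.linear a = y} := h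
  let q : Γ ⧸ stab Γ a → {y | ∃ γ ∈ Γ, γ.linear a = y} := fun x =>
    ⟨(x.out : AffGroup 4).linear a, x.out, x.out.2, rfl⟩
  have hq : Function.Injective q := by
    intro x y hxy
    have h1 : (x.out : AffGroup 4).linear a = (y.out : AffGroup 4).linear a := congrArg Subtype.val hxy
    rw [← x.out_eq, ← y.out_eq]
    refine (QuotientGroup.eq (s := stab Γ a)).mpr ?_
    change ((x.out : AffGroup 4)⁻¹ * y.out).linear a = a
    rw [mul_lin, ← h1, inv_lin]
  have : Finite (Γ ⧸ stab Γ a) := Finite.of_injective q hq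
  exact Subgroup.finiteIndex_of_finite_quotient

theorem main_final {Γ : Subgroup (AffGroup 4)} (hG : Good Γ) :
    ∃ Γ' : Subgroup ↥Γ, Γ'.FiniteIndex ∧
      ∃ γ ∈ Γ', (γ : AffGroup 4) ≠ 1 ∧
        (∃ a : E4, a ≠ 0 ∧ ∀ x : E4, (γ : AffGroup 4) x = x + a) ∧
        ∀ δ ∈ Γ', δ * γ = γ * δ := by
  obtain ⟨a, ⟨τ, hτ, hτa⟩, ha0, h⟩ := main0 hG
  refine ⟨stab Γ a, stab_fin h, ⟨τ, hτ⟩, ?_, ?_, ⟨a, ha0, hτa⟩, ?_⟩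
  · change τ.linear a = a
    have := aff_apply τ a
    rw [hτa, hτa 0, zero_add] at this
    exact (add_right_cancel this).symm
  · intro h1
    have h1' : τ = 1 := h1
    have := hτa 0
    rw [h1', one_ap, zero_add] at this
    exact ha0 this.symm
  · intro δ hδ
    apply Subtype.ext
    apply aff_ext
    intro x
    change ((δ : AffGroup 4) * τ) x = (τ * (δ : AffGroup 4)) x
    have hδ' : (δ : AffGroup 4).linear a = a := hδ
    rw [mul_ap, mul_ap, hτa, hτa, aff_apply, map_add, hδ', aff_apply (δ : AffGroup 4) x]
    abel

theorem good_of {Γ : Subgroup (AffGroup 4)}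
    (hLor : ∀ γ ∈ Γ, ∀ v : E4, lorentzQ 2 (γ.linear v) = lorentzQ 2 v)
    (hFree : FreeAction Γ) (hPD : ProperlyDisc Γ) (hCC : CocompactAction Γ) : Good Γ where
  lor := by
    intro γ hγ x y
    have h : ∀ v, Bf (γ.linear v) (γ.linear v) = Bf v v := by
      intro v
      rw [← lorentzQ_eq, ← lorentzQ_eq]; exact hLor γ hγ v
    rw [Bf_polar, Bf_polar x y, ← map_add, h, h, h]
  free := hFree
  pd := hPD
  cc := hCC
end

/-- The fundamental group of a compact complete Lorentzian flat 4-manifold has a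
finite-index subgroup containing a central nontrivial pure translation: if
`Γ ≤ E(3,1) = ℝ^4 ⋊ O(3,1)` acts freely, properly discontinuously and cocompactly on
`ℝ^4`, then `Γ` has a finite-index subgroup `Γ'` containing a nontrivial pure
translation which is central in `Γ'`. -/
theorem statement8 (Γ : Subgroup (AffGroup (2 + 2)))
    (hLor : ∀ γ ∈ Γ, ∀ v : Vec (2 + 2), lorentzQ 2 (γ.linear v) = lorentzQ 2 v)
    (hFree : FreeAction Γ) (hPD : ProperlyDisc Γ) (hCC : CocompactAction Γ) :
    ∃ Γ' : Subgroup ↥Γ, Γ'.FiniteIndex ∧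
      ∃ γ ∈ Γ', (γ : AffGroup (2 + 2)) ≠ 1 ∧
        (∃ a : Vec (2 + 2), a ≠ 0 ∧ ∀ x : Vec (2 + 2), (γ : AffGroup (2 + 2)) x = x + a) ∧
        ∀ δ ∈ Γ', δ * γ = γ * δ := by
  exact main_final (good_of hLor hFree hPD hCC)
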